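/- arXiv:2107.12353 — 6 statements merged into one kernel-verified Lean document; each statement's English description precedes it below -/
import Mathlib

section
/- For all n ≥ 2, the number of cyclic permutations of length n avoiding the vincular cyclic pattern [\overline{12}43] equals 1 + \sum_{i=0}^{n-2} i·(i+1)^{n-i-2}. -/
/-- The position obtained from `p` by moving `k` steps forward cyclically. -/
def cyc {n : ℕ} (p : Fin n) (k : ℕ) : Fin n :=
  ⟨(p.val + k) % n, Nat.mod_lt _ p.pos⟩

/-- Contains the vincular cyclic pattern 12-43: entries \`a = σ p\`, \`b = σ (p+1)\`
cyclically adjacent, followed (going once around the circle) by \`c = σ (p+k)\` and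
then \`d = σ (p+l)\` with \`a < b < d < c\`. -/
def Contains1243 {n : ℕ} (σ : Equiv.Perm (Fin n)) : Prop :=
  ∃ (p : Fin n) (k l : ℕ), 2 ≤ k ∧ k < l ∧ l < n ∧
    σ p < σ (cyc p 1) ∧ σ (cyc p 1) < σ (cyc p l) ∧ σ (cyc p l) < σ (cyc p k)

open Finset

namespace Vincular1243

/-- The entries of `σ` with value at least `k` occur in increasing order. -/
def IncFrom {n : ℕ} (σ : Equiv.Perm (Fin n)) (k : ℕ) : Prop :=
  ∀ u v : Fin n, k ≤ u.val → u < v → σ.symm u < σ.symm v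

/-- The linear form of avoidance, for the rotation placing the largest entry last. -/
def LinAvoid {N : ℕ} (σ : Equiv.Perm (Fin (N + 1))) : Prop :=
  σ (Fin.last N) = Fin.last N ∧
    ∀ p q : Fin (N + 1), q.val = p.val + 1 → σ p < σ q → IncFrom σ (σ q).val

lemma IncFrom.mono {n : ℕ} {σ : Equiv.Perm (Fin n)} {k l : ℕ} (h : IncFrom σ k) (hkl : k ≤ l) :
    IncFrom σ l :=
  fun u v hu huv => h u v (hkl.trans hu) huv

lemma IncFrom.le_of_symm_le {n : ℕ} {σ : Equiv.Perm (Fin n)} {k : ℕ} (h : IncFrom σ k)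
    {u v : Fin n} (hv : k ≤ v.val) (huv : σ.symm u ≤ σ.symm v) : u ≤ v := by
  by_contra! hlt
  exact absurd (h v u hv hlt) (not_lt.2 huv)

/-! ### Rotations -/

lemma cyc_eq_add {N : ℕ} (p : Fin (N + 1)) (k : ℕ) : cyc p k = p + (Fin.ofNat (N + 1) k) := by
  ext
  simp [cyc, Fin.val_add]

/-- The rotation of `σ` starting at position `c`. -/
def rotate {N : ℕ} (c : Fin (N + 1)) (σ : Equiv.Perm (Fin (N + 1))) :
    Equiv.Perm (Fin (N + 1)) :=
  (Equiv.addRight c).trans σ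

@[simp] lemma rotate_apply {N : ℕ} (c i : Fin (N + 1)) (σ : Equiv.Perm (Fin (N + 1))) :
    rotate c σ i = σ (i + c) := rfl

@[simp] lemma rotate_symm_apply {N : ℕ} (c i : Fin (N + 1)) (σ : Equiv.Perm (Fin (N + 1))) :
    (rotate c σ).symm i = σ.symm i - c := by
  rw [Equiv.symm_apply_eq]
  simp

lemma contains1243_of_rotate {N : ℕ} {c : Fin (N + 1)} {σ : Equiv.Perm (Fin (N + 1))}
    (h : Contains1243 (rotate c σ)) : Contains1243 σ := by
  obtain ⟨p, k, l, hk, hkl, hl, h1, h2, h3⟩ := h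
  refine ⟨p + c, k, l, hk, hkl, hl, ?_⟩
  simp only [cyc_eq_add, rotate_apply, add_right_comm p _ c] at h1 h2 h3 ⊢
  exact ⟨h1, h2, h3⟩

lemma contains1243_rotate_iff {N : ℕ} (c : Fin (N + 1)) (σ : Equiv.Perm (Fin (N + 1))) :
    Contains1243 (rotate c σ) ↔ Contains1243 σ := by
  refine ⟨contains1243_of_rotate, fun h => contains1243_of_rotate (c := -c) ?_⟩
  convert h using 1
  ext i
  simp

lemma last_add_one_add {N : ℕ} (c : Fin (N + 1)) : Fin.last N + (c + 1) = c := by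
  rw [add_comm c, ← add_assoc]
  simp

/-- Cyclic permutations may be represented with the entry `0` first or the largest entry last. -/
def zeroFirstEquivLastLast (N : ℕ) :
    {σ : Equiv.Perm (Fin (N + 1)) // σ 0 = 0 ∧ ¬ Contains1243 σ} ≃
      {σ : Equiv.Perm (Fin (N + 1)) // σ (Fin.last N) = Fin.last N ∧ ¬ Contains1243 σ} where
  toFun σ := ⟨rotate (σ.1.symm (Fin.last N) + 1) σ.1, by
    rw [contains1243_rotate_iff]
    exact ⟨by rw [rotate_apply, last_add_one_add, Equiv.apply_symm_apply], σ.2.2⟩⟩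
  invFun τ := ⟨rotate (τ.1.symm 0) τ.1, by
    rw [contains1243_rotate_iff]
    exact ⟨by simp, τ.2.2⟩⟩
  left_inv σ := by
    have h : σ.1.symm 0 = 0 := by rw [Equiv.symm_apply_eq, σ.2.1]
    refine Subtype.ext (Equiv.ext fun i => ?_)
    simp only [rotate_apply, rotate_symm_apply, h, zero_sub, neg_add_cancel_right]
  right_inv τ := by
    have h : τ.1.symm (Fin.last N) = Fin.last N := by rw [Equiv.symm_apply_eq, τ.2.1]
    refine Subtype.ext (Equiv.ext fun i => ?_)
    have : i + (Fin.last N - τ.1.symm 0 + 1) + τ.1.symm 0 = i := by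
      rw [show i + (Fin.last N - τ.1.symm 0 + 1) + τ.1.symm 0 = i + (Fin.last N + 1) by abel,
        Fin.last_add_one, add_zero]
    simp only [rotate_apply, rotate_symm_apply, h]
    rw [this]

lemma not_contains1243_iff {N : ℕ} {σ : Equiv.Perm (Fin (N + 1))}
    (hlast : σ (Fin.last N) = Fin.last N) :
    ¬ Contains1243 σ ↔
      ∀ p q : Fin (N + 1), q.val = p.val + 1 → σ p < σ q → IncFrom σ (σ q).val := by
  constructor
  · intro h p q hpq hlt u v hu huv
    by_contra! hle
    have hv : σ q < v := lt_of_le_of_lt hu huv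
    obtain ⟨i, rfl⟩ := σ.surjective u
    obtain ⟨j, rfl⟩ := σ.surjective v
    simp only [Equiv.symm_apply_apply] at hle
    have hji : j < i := lt_of_le_of_ne hle (fun e => by simp [e] at huv)
    have hjq : j ≠ q := fun e => by simp [e] at hv
    have hjp : j ≠ p := fun e => by rw [e] at hv; exact absurd (hv.trans hlt) (lt_irrefl _)
    have hcyc1 : cyc p 1 = q := by
      ext
      simp only [cyc]
      rw [Nat.mod_eq_of_lt (by omega)]
      omega
    rcases lt_or_gt_of_ne hjq with hj | hj
    · have hqN : q ≠ Fin.last N := fun e => by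
        rw [e, hlast] at hv
        exact absurd hv (not_lt.2 (Fin.le_last _))
      have hjN : j ≠ Fin.last N := fun e => by
        rw [e] at hj
        exact absurd hj (not_lt.2 (Fin.le_last _))
      have hqN' : q.val < N := Fin.val_lt_last hqN
      have hjp' : j.val < p.val := by
        have : j.val ≠ p.val := fun e => hjp (Fin.ext e)
        have : j.val < q.val := hj
        omega
      refine h ⟨p, N - p.val, j.val + (N + 1) - p.val, by omega, by omega, by omega, ?_⟩
      have hk : cyc p (N - p.val) = Fin.last N := by
        ext
        simp only [cyc, Fin.val_last]
        rw [Nat.mod_eq_of_lt (by omega)]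
        omega
      have hl : cyc p (j.val + (N + 1) - p.val) = j := by
        ext
        simp only [cyc]
        rw [show p.val + (j.val + (N + 1) - p.val) = j.val + (N + 1) by omega,
          Nat.add_mod_right, Nat.mod_eq_of_lt j.2]
      rw [hcyc1, hk, hl, hlast]
      refine ⟨hlt, hv, lt_of_le_of_ne (Fin.le_last _) fun e => hjN (σ.injective ?_)⟩
      rw [e, hlast]
    · have hj' : q.val < j.val := hj
      have hi' : j.val < i.val := hji
      refine h ⟨p, j.val - p.val, i.val - p.val, by omega, by omega, by omega, ?_⟩
      have key : ∀ x : Fin (N + 1), p.val ≤ x.val → cyc p (x.val - p.val) = x := by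
        intro x hx
        ext
        simp only [cyc]
        rw [Nat.mod_eq_of_lt (by omega)]
        omega
      rw [hcyc1, key j (by omega), key i (by omega)]
      refine ⟨hlt, lt_of_le_of_ne hu fun e => ?_, huv⟩
      have := congrArg Fin.val (σ.injective e)
      omega
  · rintro h ⟨p, k, l, hk, hkl, hl, h1, h2, h3⟩
    have hp : p.val < N := by
      refine Fin.val_lt_last fun e => ?_
      rw [e, hlast] at h1
      exact absurd h1 (not_lt.2 (Fin.le_last _))
    have hq : (cyc p 1).val = p.val + 1 := Nat.mod_eq_of_lt (by omega)
    have hinc := h p (cyc p 1) hq h1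
    have a1 := hinc _ _ le_rfl h2
    have a2 := hinc _ _ h2.le h3
    simp only [Equiv.symm_apply_apply] at a1 a2
    rw [Fin.lt_def] at a1 a2
    rw [hq] at a1
    simp only [cyc] at a1 a2
    by_cases hpl : p.val + l < N + 1
    · rw [Nat.mod_eq_of_lt hpl, Nat.mod_eq_of_lt (by omega)] at a2
      omega
    · rw [Nat.mod_eq_sub_mod (by omega), Nat.mod_eq_of_lt (by omega)] at a1
      omega

/-! ### Coding by functions -/

/-- The entries `v ≤ m` are listed, in decreasing order, directly before the entry `f v`;
ordering entries by `key m f` gives the resulting permutation. -/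
def key {n : ℕ} (m : ℕ) (f : Fin n → Fin n) (v : Fin n) : ℕ ×ₗ ℕ :=
  toLex ((f v).val, if m < v.val then n else n - 1 - v.val)

lemma key_lt_iff {n m : ℕ} {f : Fin n → Fin n} {u v : Fin n} :
    key m f u < key m f v ↔ (f u).val < (f v).val ∨ (f u).val = (f v).val ∧
      (if m < u.val then n else n - 1 - u.val) < (if m < v.val then n else n - 1 - v.val) := by
  simp [key, Prod.Lex.toLex_lt_toLex]

/-- The functions coding the permutations whose entries above `m` are increasing, those from `m`
on are not, and all of whose ascent tops are above `m`. -/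
def codes (n m : ℕ) : Finset (Fin n → Fin n) :=
  Fintype.piFinset fun v =>
    if m < v.val then {v} else if v.val = m then univ.filter (fun w => m + 1 < w.val)
      else univ.filter (fun w => m < w.val)

lemma mem_codes {n m : ℕ} {f : Fin n → Fin n} :
    f ∈ codes n m ↔ (∀ v, m < v.val → f v = v) ∧ (∀ v, m < (f v).val) ∧
      ∀ v, v.val = m → m + 1 < (f v).val := by
  simp only [codes, Fintype.mem_piFinset]
  constructor
  · intro h
    refine ⟨fun v hv => by simpa [hv] using h v, fun v => ?_, fun v hv => ?_⟩
    · have := h v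
      split_ifs at this with h1 h2
      · simp only [mem_singleton] at this
        rwa [this]
      · simp only [mem_filter, mem_univ, true_and] at this
        omega
      · simpa using this
    · simpa [hv] using h v
  · rintro ⟨h1, h2, h3⟩ v
    split_ifs with h4 h5
    · simpa using h1 v h4
    · simpa using h3 v h5
    · simpa using h2 v

lemma card_filter_lt_val (n m : ℕ) :
    (univ.filter (fun w : Fin n => m < w.val)).card = n - (m + 1) := by
  have h : (univ.filter (fun w : Fin n => m < w.val)).map Fin.valEmbedding = Ico (m + 1) n := by
    ext x
    simp only [mem_map, mem_filter, mem_univ, true_and, Fin.valEmbedding_apply, mem_Ico]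
    constructor
    · rintro ⟨a, ha, rfl⟩
      omega
    · rintro ⟨h1, h2⟩
      exact ⟨⟨x, h2⟩, h1, rfl⟩
  rw [← card_map Fin.valEmbedding, h, Nat.card_Ico]

lemma card_codes {N m : ℕ} (hm : m < N) :
    (codes (N + 1) m).card = (N - m - 1) * (N - m) ^ m := by
  have hcard : ∀ v : Fin (N + 1), (if m < v.val then ({v} : Finset (Fin (N + 1))) else
      if v.val = m then univ.filter (fun w => m + 1 < w.val)
      else univ.filter (fun w => m < w.val)).card =
      (fun x : ℕ => if m < x then 1 else if x = m then N - m - 1 else N - m) v.val := by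
    intro v
    dsimp only
    split_ifs
    · simp
    · rw [card_filter_lt_val]
      omega
    · rw [card_filter_lt_val]
      omega
  rw [codes, Fintype.card_piFinset, prod_congr rfl fun v _ => hcard v,
    Fin.prod_univ_eq_prod_range
      (fun x : ℕ => if m < x then 1 else if x = m then N - m - 1 else N - m) (N + 1),
    ← prod_range_mul_prod_Ico _ (show m + 1 ≤ N + 1 by omega), prod_range_succ]
  have h1 : ∏ x ∈ Ico (m + 1) (N + 1), (if m < x then 1 else if x = m then N - m - 1 else N - m)
      = 1 := prod_eq_one fun x hx => by
    rw [mem_Ico] at hx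
    rw [if_pos (by omega)]
  have h2 : ∏ x ∈ range m, (if m < x then 1 else if x = m then N - m - 1 else N - m)
      = (N - m) ^ m := by
    rw [prod_congr rfl (g := fun _ => N - m), prod_const, card_range]
    intro x hx
    rw [mem_range] at hx
    rw [if_neg (by omega), if_neg (by omega)]
  rw [h1, h2]
  simp [mul_comm]

lemma key_injective {n m : ℕ} {f : Fin n → Fin n} (hf : f ∈ codes n m) :
    Function.Injective (key m f) := by
  obtain ⟨h1, -, -⟩ := mem_codes.1 hf
  intro u v huv
  simp only [key, EmbeddingLike.apply_eq_iff_eq, Prod.mk.injEq] at huv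
  obtain ⟨e1, e2⟩ := huv
  ext
  split_ifs at e2 with a b b
  · rwa [h1 u a, h1 v b] at e1
  all_goals omega

lemma codes_eq_of_strictMono {n m : ℕ} {f g : Fin n → Fin n} (hf : f ∈ codes n m)
    (hg : g ∈ codes n m) {σ : Equiv.Perm (Fin n)} (hfσ : StrictMono (key m f ∘ σ))
    (hgσ : StrictMono (key m g ∘ σ)) : f = g := by
  have main : ∀ {f g : Fin n → Fin n}, f ∈ codes n m → g ∈ codes n m →
      StrictMono (key m f ∘ σ) → StrictMono (key m g ∘ σ) → ∀ v, g v ≤ f v := by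
    intro f g hf hg hfσ hgσ v
    obtain ⟨f1, f2, -⟩ := mem_codes.1 hf
    obtain ⟨g1, g2, -⟩ := mem_codes.1 hg
    have hk : ¬ key m f (f v) < key m f v := by
      rw [key_lt_iff, f1 _ (f2 v), if_pos (f2 v)]
      split_ifs <;> omega
    have h1 : ¬ σ.symm (f v) < σ.symm v := fun h => hk (by simpa using hfσ h)
    have h2 : ¬ key m g (f v) < key m g v := fun h => h1 <| hgσ.lt_iff_lt.1 (by simpa using h)
    rw [key_lt_iff, g1 _ (f2 v)] at h2
    rw [Fin.le_def]
    omega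
  funext v
  exact le_antisymm (main hg hf hgσ hfσ v) (main hf hg hfσ hgσ v)

lemma linAvoid_of_strictMono {N m : ℕ} (hm : m < N) {f : Fin (N + 1) → Fin (N + 1)}
    (hf : f ∈ codes (N + 1) m) {σ : Equiv.Perm (Fin (N + 1))} (hσ : StrictMono (key m f ∘ σ)) :
    LinAvoid σ ∧ IncFrom σ (m + 1) ∧ ¬ IncFrom σ m := by
  obtain ⟨f1, f2, f3⟩ := mem_codes.1 hf
  have hpos : ∀ u v, σ.symm u < σ.symm v ↔ key m f u < key m f v := by
    intro u v
    rw [← hσ.lt_iff_lt]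
    simp
  have hinc : IncFrom σ (m + 1) := by
    intro u v hu huv
    rw [hpos, key_lt_iff, f1 u (by omega), f1 v (by omega)]
    exact Or.inl huv
  refine ⟨⟨?_, ?_⟩, hinc, ?_⟩
  · rw [← Equiv.eq_symm_apply, eq_comm]
    by_contra hne
    have hlt : σ.symm (Fin.last N) < Fin.last N := lt_of_le_of_ne (Fin.le_last _) hne
    rw [← σ.symm_apply_apply (Fin.last N), hpos] at hlt
    rw [σ.symm_apply_apply, key_lt_iff, f1 (Fin.last N) (by simpa using hm),
      if_pos (by simpa using hm)] at hlt
    have := (f (σ (Fin.last N))).2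
    simp only [Fin.val_last] at hlt
    split_ifs at hlt <;> omega
  · intro p q hpq hlt
    refine hinc.mono ?_
    by_contra! hq
    have hk : key m f (σ p) < key m f (σ q) := hσ (by rw [Fin.lt_def]; omega)
    rw [key_lt_iff] at hk
    have hlt' : (σ p).val < (σ q).val := hlt
    rw [if_neg (by omega), if_neg (by omega)] at hk
    rcases hk with hk | hk
    · have e := f1 _ (f2 (σ p))
      have b1 : σ.symm (σ p) < σ.symm (f (σ p)) := by
        rw [hpos, key_lt_iff, e, if_neg (by omega), if_pos (f2 _)]
        omega
      have b2 : σ.symm (f (σ p)) < σ.symm (σ q) := by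
        rw [hpos, key_lt_iff, e]
        exact Or.inl hk
      rw [Equiv.symm_apply_apply, Fin.lt_def] at b1 b2
      omega
    · omega
  · intro h
    have := h ⟨m, by omega⟩ ⟨m + 1, by omega⟩ le_rfl (by simp [Fin.lt_def])
    rw [hpos, key_lt_iff, f1 ⟨m + 1, by omega⟩ (by simp)] at this
    have h3 := f3 ⟨m, by omega⟩ rfl
    simp only at this
    omega

lemma exists_code {N m : ℕ} (hm : m < N) {σ : Equiv.Perm (Fin (N + 1))} (hσ : LinAvoid σ)
    (hinc : IncFrom σ (m + 1)) (hninc : ¬ IncFrom σ m) :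
    ∃ f ∈ codes (N + 1) m, StrictMono (key m f ∘ σ) := by
  obtain ⟨hlast, hasc⟩ := hσ
  have hex : ∀ v, ∃ y : Fin (N + 1), (m < y.val ∧ σ.symm v ≤ σ.symm y) ∧
      ∀ z : Fin (N + 1), m < z.val → σ.symm v ≤ σ.symm z → y ≤ z := by
    intro v
    have hne : (univ.filter fun y : Fin (N + 1) => m < y.val ∧ σ.symm v ≤ σ.symm y).Nonempty := by
      refine ⟨Fin.last N, ?_⟩
      rw [mem_filter, (Equiv.symm_apply_eq σ).2 hlast.symm]
      exact ⟨mem_univ _, by simpa using hm, Fin.le_last _⟩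
    refine ⟨min' _ hne, (mem_filter.1 (min'_mem _ hne)).2, fun z hz hz' => min'_le _ _ ?_⟩
    exact mem_filter.2 ⟨mem_univ _, hz, hz'⟩
  choose f hf hmin using hex
  have f1 : ∀ v, m < v.val → f v = v := fun v hv =>
    le_antisymm (hmin v v hv le_rfl) (hinc.le_of_symm_le (hf v).1 (hf v).2)
  have hcode : f ∈ codes (N + 1) m := by
    refine mem_codes.2 ⟨f1, fun v => (hf v).1, fun v hv => ?_⟩
    by_contra! hle
    have hfv : (f v).val = m + 1 := le_antisymm hle (hf v).1
    refine hninc fun x y hx hxy => ?_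
    rcases hx.eq_or_lt with hx | hx
    · have hxv : x = v := Fin.ext (by omega)
      rw [hxv] at hxy ⊢
      have hvy : σ.symm (f v) ≤ σ.symm y := by
        by_contra! hlt
        have := hinc.le_of_symm_le (u := y) (v := f v) (by omega) hlt.le
        have e : y = f v := by
          ext
          have h1 : y.val ≤ (f v).val := this
          have h2 : v.val < y.val := hxy
          omega
        simp [e] at hlt
      refine lt_of_le_of_ne ((hf v).2.trans hvy) fun e => ?_
      exact hxy.ne (σ.symm.injective e)
    · exact hinc x y hx hxy
  refine ⟨f, hcode, Fin.strictMono_iff_lt_succ.2 fun i => ?_⟩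
  simp only [Function.comp_apply]
  set p := i.castSucc with hp
  set q := i.succ with hq
  have hpq : q.val = p.val + 1 := by simp [hp, hq]
  rw [key_lt_iff]
  by_cases h : m < (σ p).val
  · left
    rw [f1 _ h]
    have hle : p < σ.symm (f (σ q)) := by
      have := (hf (σ q)).2
      rw [Equiv.symm_apply_apply, Fin.le_def] at this
      rw [Fin.lt_def]
      omega
    have hle' : σ p ≤ f (σ q) :=
      hinc.le_of_symm_le (hf _).1 (by rw [Equiv.symm_apply_apply]; exact hle.le)
    refine lt_of_le_of_ne hle' fun e => ?_
    rw [← Fin.ext e, Equiv.symm_apply_apply] at hle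
    exact lt_irrefl _ hle
  · right
    have hstep : ∀ z : Fin (N + 1), m < z.val → (σ.symm (σ p) ≤ σ.symm z ↔
        σ.symm (σ q) ≤ σ.symm z) := by
      intro z hz
      rw [Equiv.symm_apply_apply, Equiv.symm_apply_apply, Fin.le_def, Fin.le_def]
      have : (σ.symm z).val ≠ p.val := fun e => by
        rw [← Fin.ext e, Equiv.apply_symm_apply] at h
        exact h hz
      omega
    have e : f (σ p) = f (σ q) := le_antisymm
      (hmin _ _ (hf _).1 ((hstep _ (hf _).1).2 (hf _).2))
      (hmin _ _ (hf _).1 ((hstep _ (hf _).1).1 (hf _).2))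
    refine ⟨by rw [e], ?_⟩
    rw [if_neg h]
    split_ifs with h'
    · omega
    · have hnot : ¬ σ p < σ q := fun hlt => hninc ((hasc p q hpq hlt).mono (by omega))
      have hne : (σ p).val ≠ (σ q).val := fun e => by
        have := congrArg Fin.val (σ.injective (Fin.ext e))
        omega
      rw [Fin.lt_def] at hnot
      omega

open Classical in
lemma card_filter_linAvoid {N m : ℕ} (hm : m < N) :
    (univ.filter fun σ : Equiv.Perm (Fin (N + 1)) =>
      LinAvoid σ ∧ IncFrom σ (m + 1) ∧ ¬ IncFrom σ m).card = (N - m - 1) * (N - m) ^ m := by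
  rw [← card_codes hm]
  have hsort : ∀ f ∈ codes (N + 1) m, StrictMono (key m f ∘ Tuple.sort (key m f)) := fun f hf =>
    (Tuple.monotone_sort _).strictMono_of_injective
      ((key_injective hf).comp (Equiv.injective _))
  symm
  refine card_bij (fun f _ => Tuple.sort (key m f)) (fun f hf => ?_) (fun f hf g hg h => ?_)
    fun σ hσ => ?_
  · exact mem_filter.2 ⟨mem_univ _, linAvoid_of_strictMono hm hf (hsort f hf)⟩
  · refine codes_eq_of_strictMono hf hg (hsort f hf) ?_
    rw [h]
    exact hsort g hg
  · obtain ⟨-, h1, h2, h3⟩ := mem_filter.1 hσ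
    obtain ⟨f, hf, hmono⟩ := exists_code hm h1 h2 h3
    refine ⟨f, hf, Equiv.ext fun i => key_injective hf ?_⟩
    exact congrFun (Tuple.unique_monotone (Tuple.monotone_sort _) hmono.monotone) i

lemma eq_one_of_incFrom_zero {n : ℕ} {σ : Equiv.Perm (Fin n)} (h : IncFrom σ 0) : σ = 1 := by
  have hmono : StrictMono σ.symm := fun u v huv => h u v (Nat.zero_le _) huv
  have : (σ.symm : Fin n → Fin n) = id :=
    Tuple.unique_monotone (f := id) (σ := σ.symm) (τ := 1) hmono.monotone monotone_id
  ext i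
  have := congrFun this (σ i)
  simp only [Equiv.symm_apply_apply, id] at this
  simp [← this]

open Classical in
lemma card_filter_linAvoid_incFrom {N k : ℕ} (hk : k ≤ N) :
    (univ.filter fun σ : Equiv.Perm (Fin (N + 1)) => LinAvoid σ ∧ IncFrom σ k).card =
      1 + ∑ m ∈ range k, (N - m - 1) * (N - m) ^ m := by
  induction k with
  | zero =>
    rw [sum_range_zero, add_zero, card_eq_one]
    refine ⟨1, ?_⟩
    ext σ
    simp only [mem_filter, mem_univ, true_and, mem_singleton]
    refine ⟨fun h => eq_one_of_incFrom_zero h.2, ?_⟩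
    rintro rfl
    exact ⟨⟨rfl, fun p q _ _ u v _ huv => huv⟩, fun u v _ huv => huv⟩
  | succ k ih =>
    rw [sum_range_succ, ← add_assoc, ← ih (by omega), ← card_filter_linAvoid (by omega),
      ← card_union_of_disjoint]
    · congr 1
      ext σ
      simp only [mem_filter, mem_univ, true_and, mem_union]
      have : IncFrom σ k → IncFrom σ (k + 1) := fun h => h.mono (Nat.le_succ k)
      tauto
    · rw [disjoint_filter]
      tauto

lemma natCard_linAvoid (N : ℕ) :
    Nat.card {σ : Equiv.Perm (Fin (N + 1)) // LinAvoid σ} =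
      1 + ∑ m ∈ range N, (N - m - 1) * (N - m) ^ m := by
  classical
  rw [← card_filter_linAvoid_incFrom le_rfl, Nat.card_eq_fintype_card, Fintype.card_subtype]
  congr 1
  refine filter_congr fun σ _ => (and_iff_left ?_).symm
  intro u v hu huv
  have h1 := v.2
  have h2 : u.val < v.val := huv
  omega

end Vincular1243

open Vincular1243 in
/-- for `n ≥ 2`, the number of cyclic permutations of length `n`
(counted via the unique rotation placing the entry `0` first) avoiding the
vincular cyclic pattern 12-43 equals `1 + ∑_{i=0}^{n-2} i (i+1)^{n-i-2}`. -/
theorem stmt8 (n : ℕ) (hn : 2 ≤ n) :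
    Nat.card {σ : Equiv.Perm (Fin n) //
        σ ⟨0, by omega⟩ = ⟨0, by omega⟩ ∧ ¬ Contains1243 σ} =
      1 + ∑ i ∈ Finset.range (n - 1), i * (i + 1) ^ (n - i - 2) := by
  obtain ⟨N, rfl⟩ : ∃ N, n = N + 1 := ⟨n - 1, by omega⟩
  have e : {σ : Equiv.Perm (Fin (N + 1)) // σ (Fin.last N) = Fin.last N ∧ ¬ Contains1243 σ} ≃
      {σ : Equiv.Perm (Fin (N + 1)) // LinAvoid σ} :=
    Equiv.subtypeEquivRight fun σ => and_congr_right fun h => not_contains1243_iff h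
  refine (Nat.card_congr ((zeroFirstEquivLastLast N).trans e)).trans ?_
  rw [natCard_linAvoid, Nat.add_sub_cancel,
    ← sum_range_reflect (fun i => i * (i + 1) ^ (N + 1 - i - 2))]
  congr 1
  refine sum_congr rfl fun m hm => ?_
  rw [mem_range] at hm
  rw [show N - 1 - m + 1 = N - m by omega, show N + 1 - (N - 1 - m) - 2 = m by omega,
    show N - 1 - m = N - m - 1 by omega]
end

section
/- For all n ≥ 2, the number of cyclic permutations of length n avoiding the vincular cyclic pattern [\overline{12}34] equals 1 + \sum_{i=0}^{n-2} i·(i+1)^{n-i-2}; in particular, the patterns [\overline{12}34] and [\overline{12}43] are Wilf equivalent as cyclic vincular patterns. -/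
/-- Contains the vincular cyclic pattern 12-34: entries `a = σ p`, `b = σ (p+1)`
cyclically adjacent, followed by `c = σ (p+k)` and `d = σ (p+l)` with
`a < b < c < d`. -/
def Contains1234 {n : ℕ} (σ : Equiv.Perm (Fin n)) : Prop :=
  ∃ (p : Fin n) (k l : ℕ), 2 ≤ k ∧ k < l ∧ l < n ∧
    σ p < σ (cyc p 1) ∧ σ (cyc p 1) < σ (cyc p k) ∧ σ (cyc p k) < σ (cyc p l)

/-- The entries of `l` smaller than `y` are ordered by `R`. -/
def OrderedBelow (R : ℕ → ℕ → Prop) (y : ℕ) (l : List ℕ) : Prop :=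
  (l.filter (· < y)).Pairwise R

/-- Reading the word `w` cyclically from `y`, the entries smaller than `y` are ordered by `R`. -/
def Good (R : ℕ → ℕ → Prop) (w : List ℕ) (y : ℕ) : Prop :=
  ∀ u v, w = u ++ y :: v → OrderedBelow R y (v ++ u)

/-- Every descent bottom of the word `w`, its first letter included, satisfies the condition
in `Good`. -/
def Valid (R : ℕ → ℕ → Prop) (w : List ℕ) : Prop :=
  ∀ u y v, w = u ++ y :: v → (∀ a ∈ u.getLast?, y < a) → OrderedBelow R y (v ++ u)

section

variable {R : ℕ → ℕ → Prop} {u v w : List ℕ} {y N : ℕ}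

theorem orderedBelow_insert (h : y < N) (a b : List ℕ) :
    OrderedBelow R y (a ++ N :: b) ↔ OrderedBelow R y (a ++ b) := by
  simp [OrderedBelow, h.not_gt]

theorem good_iff (h : (u ++ y :: v).Nodup) :
    Good R (u ++ y :: v) y ↔ OrderedBelow R y (v ++ u) := by
  refine ⟨fun H => H u v rfl, fun H u' v' e => ?_⟩
  have h1 : y ∉ u := by
    intro hy; simp [List.nodup_append] at h; exact (h.2.2 y hy).1 rfl
  have h2 : y ∉ v := by
    intro hy; simp [List.nodup_append] at h; exact h.2.1.1 hy
  obtain ⟨rfl, rfl⟩ : u = u' ∧ v = v' := by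
    rcases List.append_eq_append_iff.1 e with ⟨a, rfl, h'⟩ | ⟨a, rfl, h'⟩
    · cases a with
      | nil => simp_all
      | cons x a => simp at h'; simp [h'.2] at h2
    · cases a with
      | nil => simp_all
      | cons x a => simp_all
  exact H

theorem good_insert (h : (u ++ N :: v).Nodup) (hy : y ∈ u ++ v) (hN : y < N) :
    Good R (u ++ N :: v) y ↔ Good R (u ++ v) y := by
  have h' : (u ++ v).Nodup := h.sublist (by simp)
  rcases List.mem_append.1 hy with hy | hy
  · obtain ⟨a, b, rfl⟩ := List.append_of_mem hy
    simp only [List.append_assoc, List.cons_append] at h h' ⊢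
    rw [good_iff h, good_iff h']
    simp only [List.append_assoc, List.cons_append]
    rw [orderedBelow_insert hN]
  · obtain ⟨a, b, rfl⟩ := List.append_of_mem hy
    have e : u ++ N :: (a ++ y :: b) = (u ++ N :: a) ++ y :: b := by simp
    have e' : u ++ (a ++ y :: b) = (u ++ a) ++ y :: b := by simp
    rw [e] at h ⊢
    rw [e'] at h' ⊢
    rw [good_iff h, good_iff h', ← List.append_assoc, orderedBelow_insert hN, List.append_assoc]

theorem valid_of_insert (hN : ∀ y ∈ u ++ v, y < N) (H : Valid R (u ++ N :: v)) :
    Valid R (u ++ v) := by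
  intro x y z e hx
  have hy : y < N := hN y (by simp [e])
  rcases List.append_eq_append_iff.1 e with ⟨a, rfl, rfl⟩ | ⟨a, rfl, ha⟩
  · have := H (u ++ N :: a) y z (by simp) (by
      intro b hb
      rcases List.eq_nil_or_concat' a with rfl | ⟨a, c, rfl⟩
      · simp at hb; omega
      · apply hx; simpa [List.getLast?_append, List.getLast?_cons] using hb)
    rw [← List.append_assoc, orderedBelow_insert hy] at this
    simpa using this
  · rcases a with _ | ⟨c, a⟩
    · simp at ha
      subst ha
      have := H (x ++ [N]) y z (by simp) (by simpa using hy)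
      rw [← List.append_assoc, orderedBelow_insert hy] at this
      simpa using this
    · simp at ha
      obtain ⟨rfl, rfl⟩ := ha
      have := H x y (a ++ N :: v) (by simp) hx
      simp only [List.append_assoc, List.cons_append] at this ⊢
      rwa [orderedBelow_insert hy] at this

theorem good_of_valid_insert (hN : y < N) (h : (u ++ y :: v).Nodup)
    (H : Valid R (u ++ N :: y :: v)) : Good R (u ++ y :: v) y := by
  rw [good_iff h]
  have := H (u ++ [N]) y v (by simp) (by simpa using hN)
  rwa [← List.append_assoc, orderedBelow_insert hN, List.append_nil] at this

theorem valid_insert (hN : ∀ y ∈ u ++ v, y < N) (hu : u ≠ []) (H : Valid R (u ++ v))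
    (hv : ∀ y ∈ v.head?, Good R (u ++ v) y) : Valid R (u ++ N :: v) := by
  intro x y z e hx
  rcases List.append_eq_append_iff.1 e with ⟨a, rfl, ha⟩ | ⟨a, rfl, ha⟩
  · rcases a with _ | ⟨c, a⟩
    · simp at ha
      obtain ⟨rfl, rfl⟩ := ha
      have hne := List.getLast?_eq_some_getLast hu
      have h1 := hx (u.getLast hu) (by simp [hne])
      have h2 := hN (u.getLast hu) (by simp)
      omega
    · simp at ha
      obtain ⟨rfl, rfl⟩ := ha
      have hy : y < N := hN y (by simp)
      rw [← List.append_assoc, orderedBelow_insert hy, List.append_assoc]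
      rcases List.eq_nil_or_concat' a with rfl | ⟨a, c, rfl⟩
      · have := hv y (by simp) u z (by simp)
        simpa using this
      · apply H (u ++ (a ++ [c])) y z (by simp)
        intro b hb
        apply hx
        simpa [List.getLast?_append, List.getLast?_cons] using hb
  · rcases a with _ | ⟨c, a⟩
    · simp at ha
      obtain ⟨rfl, rfl⟩ := ha
      simp at hx hu hN
      have hne := List.getLast?_eq_some_getLast hu
      have h1 := hx (x.getLast hu) (by simp [hne])
      have h2 := hN (x.getLast hu) (by simp)
      omega
    · simp at ha
      obtain ⟨rfl, rfl⟩ := ha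
      have hy : y < N := hN y (by simp)
      simp only [List.append_assoc, List.cons_append]
      rw [orderedBelow_insert hy]
      have := H x y (a ++ v) (by simp) hx
      simpa using this

theorem pairwise_of_good_max (hN : ∀ y ∈ u ++ v, y < N) (H : Good R (u ++ N :: v) N) :
    (v ++ u).Pairwise R := by
  have := H u v rfl
  rwa [OrderedBelow, List.filter_eq_self.2] at this
  intro a ha
  simpa using hN a (by simp at ha ⊢; tauto)

theorem good_max_iff (h : (u ++ N :: v).Nodup) (hN : ∀ y ∈ u ++ v, y < N) :
    Good R (u ++ N :: v) N ↔ (v ++ u).Pairwise R :=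
  ⟨pairwise_of_good_max hN, fun H => (good_iff h).2 (H.filter _)⟩

theorem orderedBelow_of_pairwise (hR : R = (· < ·) ∨ R = (· > ·))
    (H : (u ++ y :: v).Pairwise R) : OrderedBelow R y (v ++ u) := by
  simp only [OrderedBelow, List.filter_append]
  simp only [List.pairwise_append, List.pairwise_cons, List.mem_cons] at H
  obtain ⟨h1, ⟨h2, h3⟩, h4⟩ := H
  rcases hR with rfl | rfl
  · rw [List.filter_eq_nil_iff.2]
    · exact h1.filter _
    · intro a ha
      simpa using (h2 a ha).le
  · rw [(List.filter_eq_nil_iff (l := u)).2]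
    · simpa using h3.filter _
    · intro a ha
      simpa using (h4 a ha y (by simp)).le

theorem good_of_good_max (hR : R = (· < ·) ∨ R = (· > ·)) (h : (u ++ N :: v).Nodup)
    (hN : ∀ y ∈ u ++ v, y < N) (H : Good R (u ++ N :: v) N) (hy : y ∈ u ++ N :: v) :
    Good R (u ++ N :: v) y := by
  have hs := pairwise_of_good_max hN H
  rw [List.mem_append, List.mem_cons] at hy
  rcases hy with hy | rfl | hy
  · have hyN := hN y (by simp [hy])
    obtain ⟨a, b, rfl⟩ := List.append_of_mem hy
    simp only [List.append_assoc, List.cons_append] at h hs ⊢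
    rw [good_iff h, List.append_assoc, List.cons_append, orderedBelow_insert hyN]
    rw [← List.append_assoc] at hs
    simpa using orderedBelow_of_pairwise hR hs
  · exact H
  · have hyN := hN y (by simp [hy])
    obtain ⟨a, b, rfl⟩ := List.append_of_mem hy
    have e : u ++ N :: (a ++ y :: b) = (u ++ N :: a) ++ y :: b := by simp
    rw [e] at h ⊢
    rw [good_iff h, ← List.append_assoc, orderedBelow_insert hyN]
    simp only [List.append_assoc, List.cons_append] at hs
    simpa using orderedBelow_of_pairwise hR hs

theorem valid_of_good (H : ∀ y ∈ w, Good R w y) : Valid R w := by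
  intro u y v e _
  exact H y (by simp [e]) u v e

open Classical in
/-- The valid words using each letter of `{0, …, N - 1}` once. -/
noncomputable def validWords (R : ℕ → ℕ → Prop) (N : ℕ) : Finset (List ℕ) :=
  (List.range N).permutations.toFinset.filter (Valid R)

theorem mem_validWords : w ∈ validWords R N ↔ w.Perm (List.range N) ∧ Valid R w := by
  simp [validWords]

theorem perm_insert_iff : (u ++ N :: v).Perm (List.range (N + 1)) ↔
    (u ++ v).Perm (List.range N) := by
  rw [List.range_succ]
  refine ⟨fun h => ?_, fun h => ?_⟩
  · have := (List.perm_middle.symm.trans h).trans (List.perm_append_comm)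
    simpa using this
  · refine List.perm_middle.trans ((List.Perm.cons _ h).trans ?_)
    exact List.perm_append_comm (l₁ := [N])

theorem lt_of_perm (h : w.Perm (List.range N)) : ∀ y ∈ w, y < N := by
  intro y hy
  simpa using h.subset hy

theorem nodup_of_perm (h : w.Perm (List.range N)) : w.Nodup :=
  h.nodup_iff.2 List.nodup_range

theorem exists_insert (h : w.Perm (List.range (N + 1))) : ∃ u v, w = u ++ N :: v :=
  List.append_of_mem (h.mem_iff.2 (by simp))

theorem exists_sorted (hR : R = (· < ·) ∨ R = (· > ·)) (N : ℕ) :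
    ∃ s : List ℕ, s.Perm (List.range N) ∧ s.Pairwise R := by
  rcases hR with rfl | rfl
  · exact ⟨List.range N, List.Perm.refl _, List.pairwise_lt_range⟩
  · exact ⟨(List.range N).reverse, List.reverse_perm _,
      List.pairwise_reverse.2 List.pairwise_lt_range⟩

theorem eq_of_sorted (hR : R = (· < ·) ∨ R = (· > ·)) (h : u.Perm v)
    (hu : u.Pairwise R) (hv : v.Pairwise R) : u = v := by
  refine h.eq_of_pairwise (fun a b _ _ h1 h2 => ?_) hu hv
  rcases hR with rfl | rfl
  · exact absurd h1 (lt_asymm h2)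
  · exact absurd h1 (lt_asymm h2)

open Classical in
/-- The number of letters of `w` below `N` that are good. -/
noncomputable def goodCount (R : ℕ → ℕ → Prop) (N : ℕ) (w : List ℕ) : ℕ :=
  ((Finset.range N).filter (Good R w)).card

theorem goodCount_le : goodCount R N w ≤ N := by
  classical
  exact (Finset.card_filter_le _ _).trans (by simp)

theorem goodCount_eq_iff : goodCount R N w = N ↔ ∀ y < N, Good R w y := by
  classical
  have := Finset.card_filter_eq_iff (s := Finset.range N) (p := Good R w)
  simpa [goodCount] using this

theorem goodCount_insert (h : (u ++ v).Perm (List.range N)) :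
    goodCount R N (u ++ N :: v) = goodCount R N (u ++ v) := by
  classical
  unfold goodCount
  congr 1
  refine Finset.filter_congr fun y hy => ?_
  rw [Finset.mem_range] at hy
  exact good_insert (nodup_of_perm (perm_insert_iff.2 h)) (h.mem_iff.2 (by simpa using hy)) hy

open Classical in
theorem goodCount_succ : goodCount R (N + 1) w =
    goodCount R N w + if Good R w N then 1 else 0 := by
  unfold goodCount
  rw [Finset.range_add_one, Finset.filter_insert]
  split_ifs with h
  · rw [Finset.card_insert_of_notMem (by simp)]
  · rfl

theorem goodCount_of_good_max (hR : R = (· < ·) ∨ R = (· > ·))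
    (h : w.Perm (List.range (N + 1))) (H : Good R w N) : goodCount R (N + 1) w = N + 1 := by
  obtain ⟨u, v, rfl⟩ := exists_insert h
  rw [goodCount_eq_iff]
  intro y hy
  exact good_of_good_max hR (nodup_of_perm h) (lt_of_perm (perm_insert_iff.1 h)) H
    (h.mem_iff.2 (by simpa using hy))

open Classical in
theorem card_filter_good_max (hR : R = (· < ·) ∨ R = (· > ·)) (N : ℕ) :
    ((validWords R (N + 1)).filter (Good R · N)).card = N + 1 ∧
    ((validWords R (N + 1)).filter (fun w => w.head? ≠ some N ∧ Good R w N)).card = N := by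
  obtain ⟨s, hs, hsR⟩ := exists_sorted hR N
  have hlen : s.length = N := by simpa using hs.length_eq
  have hNs : N ∉ s := fun h => (lt_of_perm hs N h).false
  set f : ℕ → List ℕ := fun j => s.drop j ++ N :: s.take j with hf
  have hperm (j : ℕ) : (s.drop j ++ s.take j).Perm (List.range N) := by
    refine List.perm_append_comm.trans ?_
    rwa [List.take_append_drop]
  have hinj : Set.InjOn f (Finset.range (N + 1)) := by
    intro i hi j hj hij
    have h1 : (f i).idxOf N = (f j).idxOf N := by rw [hij]
    have key (k : ℕ) : (f k).idxOf N = N - k := by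
      rw [hf]
      simp only
      rw [List.idxOf_append_of_notMem (fun h => hNs (List.mem_of_mem_drop h))]
      simp [hlen]
    rw [key, key] at h1
    simp at hi hj
    omega
  have hmem (w : List ℕ) : w ∈ (validWords R (N + 1)).filter (Good R · N) ↔
      ∃ j < N + 1, f j = w := by
    rw [Finset.mem_filter, mem_validWords]
    constructor
    · rintro ⟨⟨h, -⟩, hg⟩
      obtain ⟨u, v, rfl⟩ := exists_insert h
      have h' := perm_insert_iff.1 h
      have hp := pairwise_of_good_max (lt_of_perm h') hg
      have hvu : v ++ u = s :=
        eq_of_sorted hR (List.perm_append_comm.trans (h'.trans hs.symm)) hp hsR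
      refine ⟨v.length, ?_, ?_⟩
      · rw [← hlen, ← hvu, List.length_append]; omega
      · simp [hf, ← hvu]
    · rintro ⟨j, hj, rfl⟩
      have h := perm_insert_iff.2 (hperm j)
      have hg : Good R (f j) N := by
        rw [hf, good_max_iff (nodup_of_perm h) (lt_of_perm (hperm j)), List.take_append_drop]
        exact hsR
      refine ⟨⟨h, valid_of_good fun y hy => ?_⟩, hg⟩
      exact goodCount_eq_iff.1 (goodCount_of_good_max hR h hg) y (lt_of_perm h y hy)
  constructor
  · have : (validWords R (N + 1)).filter (Good R · N) = (Finset.range (N + 1)).image f := by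
      ext w
      rw [hmem]
      simp
    rw [this, Finset.card_image_of_injOn hinj, Finset.card_range]
  · have : (validWords R (N + 1)).filter (fun w => w.head? ≠ some N ∧ Good R w N) =
        (Finset.range N).image f := by
      ext w
      rw [← Finset.filter_filter, Finset.filter_comm, Finset.mem_filter, hmem]
      simp only [Finset.mem_image, Finset.mem_range]
      have hhead (j : ℕ) (hj : j < N + 1) : (f j).head? ≠ some N ↔ j < N := by
        rcases Nat.lt_succ_iff_lt_or_eq.1 hj with h | rfl
        · have h' : j < s.length := by omega
          simp only [hf, List.drop_eq_getElem_cons h', h, iff_true]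
          simp only [List.cons_append, List.head?_cons, ne_eq, Option.some.injEq]
          exact fun e => hNs (e ▸ List.getElem_mem h')
        · simp [hf, ← hlen]
      constructor
      · rintro ⟨⟨j, hj, rfl⟩, h⟩
        exact ⟨j, (hhead j hj).1 h, rfl⟩
      · rintro ⟨j, hj, rfl⟩
        exact ⟨⟨j, by omega, rfl⟩, (hhead j (by omega)).2 hj⟩
    rw [this, Finset.card_image_of_injOn, Finset.card_range]
    exact hinj.mono (by intro x; simp; omega)

open Classical in
theorem card_children (hw : w ∈ validWords R N) (hN0 : 0 < N) :
    ((validWords R (N + 1)).filter (fun w' => w'.erase N = w ∧ w'.head? ≠ some N)).card =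
      goodCount R N w := by
  obtain ⟨hp, hV⟩ := mem_validWords.1 hw
  have hlt := lt_of_perm hp
  have hnd := nodup_of_perm hp
  have hlen : w.length = N := by simpa using hp.length_eq
  have hNw : N ∉ w := fun h => (hlt N h).false
  set q : ℕ → ℕ := fun y => if w.idxOf y = 0 then N else w.idxOf y with hq
  have hq0 (y : ℕ) : 0 < q y := by simp only [hq]; split_ifs <;> omega
  symm
  refine Finset.card_bij (fun y _ => w.take (q y) ++ N :: w.drop (q y)) ?_ ?_ ?_
  · intro y hy
    rw [Finset.mem_filter, Finset.mem_range] at hy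
    have hyw : y ∈ w := hp.mem_iff.2 (by simpa using hy.1)
    have hne : w.take (q y) ≠ [] := by
      intro h
      have h1 := hq0 y
      rcases List.take_eq_nil_iff.1 h with h2 | h2
      · omega
      · simp [h2] at hyw
    rw [Finset.mem_filter, mem_validWords, perm_insert_iff, List.take_append_drop]
    refine ⟨⟨hp, valid_insert (by simpa using hlt) hne (by simpa using hV) ?_⟩, ?_, ?_⟩
    · rw [List.take_append_drop]
      intro z hz
      rw [List.head?_drop] at hz
      simp only [hq] at hz
      split_ifs at hz with h0
      · simp [← hlen] at hz
      · rw [List.getElem?_eq_getElem (List.idxOf_lt_length_of_mem hyw)] at hz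
        simp at hz
        exact hz ▸ hy.2
    · rw [List.erase_append_right _ (fun h => hNw (List.mem_of_mem_take h))]
      simp
    · rw [List.head?_append_of_ne_nil _ hne]
      intro h
      exact hNw (List.mem_of_mem_take (List.mem_of_head? h))
  · intro a ha b hb hab
    rw [Finset.mem_filter, Finset.mem_range] at ha hb
    have haw : a ∈ w := hp.mem_iff.2 (by simpa using ha.1)
    have hbw : b ∈ w := hp.mem_iff.2 (by simpa using hb.1)
    have hla := List.idxOf_lt_length_of_mem haw
    have hlb := List.idxOf_lt_length_of_mem hbw
    have hqle (y : ℕ) (h : w.idxOf y < w.length) : q y ≤ N := by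
      simp only [hq]; split_ifs <;> omega
    have key (y : ℕ) (h : w.idxOf y < w.length) :
        (w.take (q y) ++ N :: w.drop (q y)).idxOf N = q y := by
      rw [List.idxOf_append_of_notMem (fun h => hNw (List.mem_of_mem_take h))]
      simp [hlen, hqle y h]
    have h1 := congrArg (List.idxOf N) hab
    simp only [key a hla, key b hlb] at h1
    refine (List.idxOf_inj haw).1 ?_
    simp only [hq] at h1
    split_ifs at h1 <;> omega
  · intro w' hw'
    rw [Finset.mem_filter, mem_validWords] at hw'
    obtain ⟨⟨hp', hV'⟩, he, hh⟩ := hw'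
    obtain ⟨u, v, rfl⟩ := exists_insert hp'
    have hNu : N ∉ u := fun h => (lt_of_perm (perm_insert_iff.1 hp') N (by simp [h])).false
    rw [List.erase_append_right _ hNu, List.erase_cons_head] at he
    subst he
    rcases u with _ | ⟨x, u⟩
    · simp at hh
    rcases v with _ | ⟨y, v⟩
    · refine ⟨x, ?_, ?_⟩
      · rw [Finset.mem_filter, Finset.mem_range]
        refine ⟨hlt x (by simp), ?_⟩
        rw [List.append_nil] at *
        exact (good_iff (u := []) hnd).2 (hV [] x u rfl (by simp))
      · simp [hq] at hlen ⊢
        simp [← hlen]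
    · have hyu : y ∉ x :: u := by
        intro h
        exact (List.nodup_append.1 hnd).2.2 y h y (by simp) rfl
      refine ⟨y, ?_, ?_⟩
      · rw [Finset.mem_filter, Finset.mem_range]
        have hy : y < N := hlt y (by simp)
        exact ⟨hy, good_of_valid_insert hy hnd hV'⟩
      · have : q y = (x :: u).length := by
          simp only [hq]
          rw [List.idxOf_append_of_notMem hyu]
          simp
        rw [this, List.take_left, List.drop_left]

open Classical in
/-- The valid words on `N` letters of which exactly `k` are good. -/
noncomputable def wordsWithGood (R : ℕ → ℕ → Prop) (N k : ℕ) : Finset (List ℕ) :=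
  (validWords R N).filter (goodCount R N · = k)

theorem erase_mem_validWords (hw : w ∈ validWords R (N + 1)) :
    w.erase N ∈ validWords R N ∧ goodCount R N (w.erase N) = goodCount R N w := by
  obtain ⟨hp, hV⟩ := mem_validWords.1 hw
  obtain ⟨u, v, rfl⟩ := exists_insert hp
  have hp' := perm_insert_iff.1 hp
  have hNu : N ∉ u := fun h => (lt_of_perm hp' N (by simp [h])).false
  rw [List.erase_append_right _ hNu, List.erase_cons_head]
  exact ⟨mem_validWords.2 ⟨hp', valid_of_insert (lt_of_perm hp') hV⟩, (goodCount_insert hp').symm⟩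

open Classical in
theorem card_filter_goodCount (hN0 : 0 < N) (k : ℕ) :
    ((validWords R (N + 1)).filter
      (fun w => w.head? ≠ some N ∧ goodCount R N w = k)).card =
      k * (wordsWithGood R N k).card := by
  rw [Finset.card_eq_sum_card_fiberwise (f := fun w => w.erase N) (t := wordsWithGood R N k)]
  · rw [Finset.sum_const_nat (m := k), mul_comm]
    intro w hw
    rw [wordsWithGood, Finset.mem_filter] at hw
    rw [← hw.2]
    refine Eq.trans ?_ (card_children hw.1 hN0)
    rw [Finset.filter_filter]
    congr 1
    refine Finset.filter_congr fun w' hw' => ?_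
    have := (erase_mem_validWords hw').2
    constructor
    · rintro ⟨⟨h1, h2⟩, h3⟩
      exact ⟨h3, h1⟩
    · rintro ⟨h3, h1⟩
      exact ⟨⟨h1, by rw [← this, h3]⟩, h3⟩
  · intro w hw
    simp only [Finset.coe_filter, Set.mem_ofPred_eq] at hw
    obtain ⟨h1, h2⟩ := erase_mem_validWords hw.1
    simp only [wordsWithGood, Finset.coe_filter, Set.mem_ofPred_eq]
    exact ⟨h1, h2.trans hw.2.2⟩

theorem good_max_of_head (hw : w ∈ validWords R (N + 1)) (h : w.head? = some N) :
    Good R w N := by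
  obtain ⟨hp, hV⟩ := mem_validWords.1 hw
  obtain ⟨v, rfl⟩ := List.head?_eq_some_iff.1 h
  exact (good_iff (u := []) (nodup_of_perm hp)).2 (hV [] N v rfl (by simp))

theorem card_wordsWithGood_self (hR : R = (· < ·) ∨ R = (· > ·)) (N : ℕ) :
    (wordsWithGood R (N + 1) (N + 1)).card = N + 1 := by
  classical
  refine Eq.trans ?_ (card_filter_good_max hR N).1
  rw [wordsWithGood]
  congr 1
  refine Finset.filter_congr fun w hw => ⟨fun h => ?_, fun h => ?_⟩
  · exact goodCount_eq_iff.1 h N (by omega)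
  · exact goodCount_of_good_max hR (mem_validWords.1 hw).1 h

theorem card_wordsWithGood_succ (hR : R = (· < ·) ∨ R = (· > ·)) (hN0 : 0 < N) {k : ℕ}
    (hk : k ≤ N) : (wordsWithGood R (N + 1) k).card + (if k = N then N else 0) =
      k * (wordsWithGood R N k).card := by
  classical
  rw [← card_filter_goodCount hN0,
    ← Finset.card_filter_add_card_filter_not (s := (validWords R (N + 1)).filter _) (Good R · N),
    Finset.filter_filter, Finset.filter_filter, add_comm]
  have hmax {w : List ℕ} (hw : w ∈ validWords R (N + 1)) (h : Good R w N) :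
      goodCount R N w = N := by
    have := goodCount_of_good_max hR (mem_validWords.1 hw).1 h
    rw [goodCount_succ, if_pos h] at this
    omega
  congr 1
  · split_ifs with h
    · subst h
      conv_lhs => rw [← (card_filter_good_max hR k).2]
      congr 1
      refine Finset.filter_congr fun w hw => ?_
      have := hmax hw
      tauto
    · symm
      rw [Finset.card_eq_zero, Finset.filter_eq_empty_iff]
      rintro w hw ⟨⟨-, h1⟩, h2⟩
      exact h (h1.symm.trans (hmax hw h2))
  · rw [wordsWithGood]
    congr 1
    refine Finset.filter_congr fun w hw => ?_
    rw [goodCount_succ]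
    have h1 := good_max_of_head hw
    have h2 := hmax hw
    by_cases h : Good R w N
    · have := h2 h
      simp only [h, if_true, not_true, and_false, iff_false]
      omega
    · simp only [h, if_false, not_false_eq_true, and_true, add_zero]
      tauto

theorem card_wordsWithGood (hR : R = (· < ·) ∨ R = (· > ·)) (k d : ℕ) :
    (wordsWithGood R (k + 1 + d + 1) (k + 1)).card = k * (k + 1) ^ (d + 1) := by
  induction d with
  | zero =>
    have := card_wordsWithGood_succ hR (N := k + 1) (by omega) le_rfl
    rw [card_wordsWithGood_self hR, if_pos rfl] at this
    simp only [add_zero, zero_add, pow_one]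
    nlinarith
  | succ d ih =>
    have := card_wordsWithGood_succ hR (N := k + 1 + d + 1) (k := k + 1) (by omega) (by omega)
    rw [if_neg (by omega), ih] at this
    rw [add_zero] at this
    rw [← add_assoc _ d 1, this]
    ring

theorem card_validWords (hR : R = (· < ·) ∨ R = (· > ·)) (N : ℕ) :
    (validWords R (N + 1)).card = 1 + ∑ i ∈ Finset.range (N + 1), i * (i + 1) ^ (N - i) := by
  classical
  rw [Finset.card_eq_sum_card_fiberwise (f := goodCount R (N + 1)) (t := Finset.range (N + 2))]
  · have hdef (k : ℕ) : ((validWords R (N + 1)).filter (goodCount R (N + 1) · = k)).card =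
        (wordsWithGood R (N + 1) k).card := rfl
    simp only [hdef]
    have h0 : (wordsWithGood R (N + 1) 0).card = 0 := by
      rcases N.eq_zero_or_pos with rfl | hN
      · rw [Finset.card_eq_zero, wordsWithGood, Finset.filter_eq_empty_iff]
        intro w hw h
        obtain ⟨hp, hV⟩ := mem_validWords.1 hw
        obtain rfl : w = [0] := by simpa using hp
        have := good_max_of_head hw rfl
        rw [goodCount_succ, if_pos this] at h
        omega
      · have := card_wordsWithGood_succ hR hN (Nat.zero_le N)
        omega
    rw [Finset.sum_range_succ', h0, Finset.sum_range_succ, card_wordsWithGood_self hR,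
      Finset.sum_range_succ, Finset.sum_congr rfl (g := fun i => i * (i + 1) ^ (N - i))]
    · simp; ring
    · intro k hk
      rw [Finset.mem_range] at hk
      obtain ⟨d, rfl⟩ := Nat.exists_eq_add_of_lt hk
      have := card_wordsWithGood hR k d
      rw [show k + d + 1 + 1 = k + 1 + d + 1 by omega, this]
      congr 2
      omega
  · intro w _
    have := goodCount_le (R := R) (N := N + 1) (w := w)
    simp
    omega

theorem orderedBelow_rotate (hu : ∀ z ∈ u ++ y :: v, z < N) :
    OrderedBelow R y ((N :: (u ++ y :: v)).rotate (u.length + 1)) ↔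
      OrderedBelow R y (v ++ u) := by
  have hy : y < N := hu y (by simp)
  rw [List.rotate_cons_succ, List.append_assoc, List.rotate_append_length_eq,
    ← orderedBelow_insert hy v u]
  simp [OrderedBelow]

theorem valid_iff_rotate (hw : ∀ z ∈ w, z < N) :
    Valid R w ↔ ∀ p (h : p < w.length), w[p] < (N :: w)[p]'(by simp; omega) →
      OrderedBelow R w[p] ((N :: w).rotate (p + 1)) := by
  constructor
  · intro H p h hp
    have e : w = w.take p ++ w[p] :: w.drop (p + 1) := by simp
    have hl : (w.take p).length = p := by simp [h.le]
    have h1 := H _ _ _ e (by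
      intro a ha
      rcases p with _ | p
      · simp at ha
      · rw [List.getLast?_take] at ha
        have h' : p < w.length := by omega
        simp [h'] at ha
        simpa [← ha] using hp)
    rw [← orderedBelow_rotate (N := N) (by rwa [← e]), hl, ← e] at h1
    exact h1
  · rintro H u y v rfl hu
    rw [← orderedBelow_rotate hw]
    have h1 := H u.length (by simp)
    simp only [List.getElem_append_right, le_refl, Nat.sub_self, List.getElem_cons_zero] at h1
    apply h1
    rcases List.eq_nil_or_concat' u with rfl | ⟨u, c, rfl⟩
    · simpa using hw y (by simp)
    · simpa using hu

theorem orderedBelow_rotate_iff {l : List ℕ} {q : ℕ} :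
    OrderedBelow R y (l.rotate q) ↔ ∀ i j, (hij : i < j) → (hj : j < l.length) →
      l[(i + q) % l.length]'(Nat.mod_lt _ (by omega)) < y →
      l[(j + q) % l.length]'(Nat.mod_lt _ (by omega)) < y →
      R (l[(i + q) % l.length]'(Nat.mod_lt _ (by omega)))
        (l[(j + q) % l.length]'(Nat.mod_lt _ (by omega))) := by
  rw [OrderedBelow, List.pairwise_filter, List.pairwise_iff_getElem]
  simp only [List.length_rotate, List.getElem_rotate, decide_eq_true_eq]
  constructor
  · intro H i j hij hj
    exact H i j (by omega) hj hij
  · intro H i j _ hj hij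
    exact H i j hij hj

/-- The entries of a permutation after the first one, complemented. -/
def word {M : ℕ} (σ : Equiv.Perm (Fin (M + 1))) : List ℕ :=
  List.ofFn fun i : Fin M => M - (σ i.succ).val

section

variable {M : ℕ} {σ : Equiv.Perm (Fin (M + 1))}

theorem val_succ_pos (h0 : σ 0 = 0) (i : Fin M) : 0 < (σ i.succ).val := by
  refine Nat.pos_of_ne_zero fun h => ?_
  have : σ i.succ = σ 0 := by rw [h0]; exact Fin.ext h
  exact Fin.succ_ne_zero i (σ.injective this)

theorem word_lt (h0 : σ 0 = 0) : ∀ z ∈ word σ, z < M := by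
  intro z hz
  obtain ⟨i, rfl⟩ := List.mem_ofFn.1 hz
  have := val_succ_pos h0 i
  have := i.pos
  omega

theorem word_perm (h0 : σ 0 = 0) : (word σ).Perm (List.range M) := by
  refine (List.Nodup.subperm ?_ ?_).perm_of_length_le (by simp [word])
  · refine List.nodup_ofFn.2 fun i j hij => ?_
    have h : (σ i.succ).val = (σ j.succ).val := by
      have := (σ i.succ).is_lt
      have := (σ j.succ).is_lt
      have hij' : M - (σ i.succ).val = M - (σ j.succ).val := hij
      omega
    exact Fin.succ_injective _ (σ.injective (Fin.ext h))
  · intro z hz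
    simpa using word_lt h0 z hz

theorem cons_word_getElem (h0 : σ 0 = 0) (p : ℕ) (hp : p < (M :: word σ).length) :
    (M :: word σ)[p] = M - (σ ⟨p, by simpa [word] using hp⟩).val := by
  rcases p with _ | p
  · have : (⟨0, by omega⟩ : Fin (M + 1)) = 0 := rfl
    simp [this, h0]
  · simp [word]

theorem valid_word_iff (h0 : σ 0 = 0) : Valid R (word σ) ↔
    ∀ (p : Fin (M + 1)) (k l : ℕ), 2 ≤ k → k < l → l < M + 1 → σ p < σ (cyc p 1) →
      σ (cyc p 1) < σ (cyc p k) → σ (cyc p 1) < σ (cyc p l) →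
      R (M - (σ (cyc p k)).val) (M - (σ (cyc p l)).val) := by
  have hlen : (M :: word σ).length = M + 1 := by simp [word]
  have hval (i j : Fin (M + 1)) : M - (σ i).val < M - (σ j).val ↔ σ j < σ i := by
    have := (σ i).is_lt
    have := (σ j).is_lt
    rw [Fin.lt_def]
    omega
  have hshift (p : Fin (M + 1)) (i : ℕ) :
      (⟨(i + (p.val + 1)) % (M + 1), Nat.mod_lt _ (by omega)⟩ : Fin (M + 1)) =
        cyc p (i + 1) := by
    simp only [cyc, Fin.mk.injEq]
    congr 1
    omega
  have hsucc (p : ℕ) (hp : p < (word σ).length) :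
      (word σ)[p] = M - (σ (cyc ⟨p, by simp [word] at hp; omega⟩ 1)).val := by
    have hp' : p + 1 < M + 1 := by simpa [word] using hp
    simp [word, cyc, Nat.mod_eq_of_lt hp']
  rw [valid_iff_rotate (word_lt h0)]
  simp only [orderedBelow_rotate_iff, cons_word_getElem h0, hlen, hsucc, hval]
  constructor
  · intro H p k l hk hkl hl h1 h2 h3
    have hp : p.val < M := by
      by_contra h
      have : cyc p 1 = 0 := by
        have : p.val = M := by omega
        simp [cyc, this]
      rw [this, h0] at h1
      exact absurd h1 (Fin.not_lt_zero _)
    have := H p.val (by simpa [word] using hp) h1 (k - 1) (l - 1) (by omega) (by omega)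
    simp only [hshift] at this
    rw [show k - 1 + 1 = k by omega, show l - 1 + 1 = l by omega] at this
    exact this h2 h3
  · intro H p hp h1 i j hij hj
    have hp' : p < M + 1 := by simp [word] at hp; omega
    have hs := hshift ⟨p, hp'⟩
    simp only at hs
    rw [hs i, hs j]
    intro h2 h3
    refine H ⟨p, hp'⟩ (i + 1) (j + 1) ?_ (by omega) ?_ h1 h2 h3
    · rcases i with _ | i
      · exact absurd h2 (lt_irrefl _)
      · omega
    · by_contra h
      have hj' : j + 1 = M + 1 := by omega
      have : cyc (⟨p, hp'⟩ : Fin (M + 1)) (j + 1) = ⟨p, hp'⟩ := by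
        simp [cyc, hj', Nat.mod_eq_of_lt hp']
      rw [this] at h3
      exact lt_asymm h1 h3

theorem cyc_ne (p : Fin (M + 1)) {k l : ℕ} (hkl : k < l) (hl : l < M + 1) :
    cyc p k ≠ cyc p l := by
  intro h
  have h1 : p.val + k ≡ p.val + l [MOD M + 1] := Fin.mk.inj h
  have h2 := Nat.ModEq.add_left_cancel' _ h1
  exact hkl.ne (h2.eq_of_lt_of_lt (by omega) hl)

theorem valid_word_lt_iff (h0 : σ 0 = 0) : Valid (· < ·) (word σ) ↔ ¬ Contains1234 σ := by
  rw [valid_word_iff h0]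
  constructor
  · rintro H ⟨p, k, l, hk, hkl, hl, h1, h2, h3⟩
    have := H p k l hk hkl hl h1 h2 (h2.trans h3)
    rw [Fin.lt_def] at h3
    omega
  · intro H p k l hk hkl hl h1 h2 h3
    have hne := σ.injective.ne (cyc_ne p hkl hl)
    rcases lt_or_gt_of_ne hne with h | h
    · exact (H ⟨p, k, l, hk, hkl, hl, h1, h2, h⟩).elim
    · rw [Fin.lt_def] at h
      omega

theorem valid_word_gt_iff (h0 : σ 0 = 0) : Valid (· > ·) (word σ) ↔ ¬ Contains1243 σ := by
  rw [valid_word_iff h0]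
  constructor
  · rintro H ⟨p, k, l, hk, hkl, hl, h1, h2, h3⟩
    have := H p k l hk hkl hl h1 (h2.trans h3) h2
    rw [Fin.lt_def] at h3
    omega
  · intro H p k l hk hkl hl h1 h2 h3
    have hne := σ.injective.ne (cyc_ne p hkl hl)
    rcases lt_or_gt_of_ne hne with h | h
    · rw [Fin.lt_def] at h
      omega
    · exact (H ⟨p, k, l, hk, hkl, hl, h1, h3, h⟩).elim

theorem word_injective {τ : Equiv.Perm (Fin (M + 1))} (hσ : σ 0 = 0) (hτ : τ 0 = 0)
    (h : word σ = word τ) : σ = τ := by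
  ext i
  refine Fin.cases ?_ (fun i => ?_) i
  · rw [hσ, hτ]
  · have h1 : M - (σ i.succ).val = M - (τ i.succ).val := congrFun (List.ofFn_injective h) i
    have := (σ i.succ).is_lt
    have := (τ i.succ).is_lt
    omega

theorem exists_word_eq (hw : w.Perm (List.range M)) :
    ∃ σ : Equiv.Perm (Fin (M + 1)), σ 0 = 0 ∧ word σ = w := by
  have hlen : w.length = M := by simpa using hw.length_eq
  have hlt (i : Fin M) : w[i] < M := lt_of_perm hw _ (List.getElem_mem _)
  let f : Fin (M + 1) → Fin (M + 1) := Fin.cons 0 fun i : Fin M => ⟨M - w[i], by omega⟩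
  have hf : Function.Injective f := by
    refine Fin.cons_injective_iff.2 ⟨?_, fun i j hij => ?_⟩
    · rintro ⟨i, hi⟩
      have h1 := Fin.val_eq_of_eq hi
      have h2 := hlt i
      simp only [Fin.val_zero] at h1
      omega
    · have h1 := Fin.mk.inj hij
      have h2 := hlt i
      have h3 := hlt j
      have h4 : w[i.val] = w[j.val] := by simp only [Fin.getElem_fin] at *; omega
      exact Fin.ext ((nodup_of_perm hw).getElem_inj_iff.1 h4)
  refine ⟨Equiv.ofBijective f (Finite.injective_iff_bijective.1 hf), rfl, ?_⟩
  refine List.ext_getElem (by simp [word, hlen]) fun i h1 h2 => ?_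
  have := hlt ⟨i, by omega⟩
  simp only [Fin.getElem_fin] at this
  simp [word, f]
  omega

end

theorem card_perm_eq_card_validWords {M : ℕ} {C : Equiv.Perm (Fin (M + 1)) → Prop}
    (hC : ∀ σ : Equiv.Perm (Fin (M + 1)), σ 0 = 0 → (Valid R (word σ) ↔ ¬ C σ)) :
    Nat.card {σ : Equiv.Perm (Fin (M + 1)) // σ 0 = 0 ∧ ¬ C σ} = (validWords R M).card := by
  rw [← Nat.card_eq_finsetCard]
  refine Nat.card_eq_of_bijective (fun σ => ⟨word σ.1,
    mem_validWords.2 ⟨word_perm σ.2.1, (hC σ.1 σ.2.1).2 σ.2.2⟩⟩) ⟨?_, ?_⟩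
  · intro σ τ h
    exact Subtype.ext (word_injective σ.2.1 τ.2.1 (Subtype.mk.inj h))
  · rintro ⟨w, hw⟩
    obtain ⟨hp, hV⟩ := mem_validWords.1 hw
    obtain ⟨σ, h0, rfl⟩ := exists_word_eq hp
    exact ⟨⟨σ, h0, (hC σ h0).1 hV⟩, rfl⟩

end

/-- for `n ≥ 2`, the number of cyclic permutations of length `n`
avoiding the vincular cyclic pattern 12-34 equals `1 + ∑_{i=0}^{n-2} i (i+1)^{n-i-2}`;
in particular 12-34 and 12-43 are Wilf equivalent as cyclic vincular patterns. -/
theorem stmt9 (n : ℕ) (hn : 2 ≤ n) :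
    (Nat.card {σ : Equiv.Perm (Fin n) //
        σ ⟨0, by omega⟩ = ⟨0, by omega⟩ ∧ ¬ Contains1234 σ} =
      1 + ∑ i ∈ Finset.range (n - 1), i * (i + 1) ^ (n - i - 2)) ∧
    (
    Nat.card {σ : Equiv.Perm (Fin n) //
        σ ⟨0, by omega⟩ = ⟨0, by omega⟩ ∧ ¬ Contains1234 σ} =
    Nat.card {σ : Equiv.Perm (Fin n) //
        σ ⟨0, by omega⟩ = ⟨0, by omega⟩ ∧ ¬ Contains1243 σ}) := by
  obtain ⟨N, rfl⟩ := Nat.exists_eq_add_of_le' hn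
  have h1 := card_perm_eq_card_validWords (M := N + 1) (C := Contains1234)
    fun σ h0 => valid_word_lt_iff h0
  have h2 := card_perm_eq_card_validWords (M := N + 1) (C := Contains1243)
    fun σ h0 => valid_word_gt_iff h0
  rw [card_validWords (Or.inl rfl)] at h1
  rw [card_validWords (Or.inr rfl)] at h2
  refine ⟨h1.trans ?_, h1.trans h2.symm⟩
  congr 1
  refine Finset.sum_congr rfl fun i _ => ?_
  congr 2
  omega
end

section
/- Let D_n be defined by D_1 = 2, D_2 = 1, D_3 = 1, and D_n = \sum_{k=1}^{n-3} D_k D_{n-k} for n ≥ 4. Then for all n ≥ 1, the number of cyclic permutations of length n avoiding the vincular cyclic pattern [\overline{13}42] equals D_{n+1}. -/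
/-- Contains the vincular cyclic pattern 13-42: entries `a = σ p`, `b = σ (p+1)`
cyclically adjacent, followed by `c = σ (p+k)` and `d = σ (p+l)` with
`a < d < b < c`. -/
def Contains1342 {n : ℕ} (σ : Equiv.Perm (Fin n)) : Prop :=
  ∃ (p : Fin n) (k l : ℕ), 2 ≤ k ∧ k < l ∧ l < n ∧
    σ p < σ (cyc p l) ∧ σ (cyc p l) < σ (cyc p 1) ∧ σ (cyc p 1) < σ (cyc p k)

/-- A list `l` avoids `13-42` cyclically, where the two adjacent entries of the pattern are not
allowed to be the last and the first entry of `l`. -/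
def ListAvoids (l : List ℕ) : Prop :=
  ∀ X a b Y, l = X ++ a :: b :: Y → (Y ++ X).Pairwise fun c d => ¬(a < d ∧ d < b ∧ b < c)

/-- The first entry of the list, if any, is its largest entry. -/
def HeadIsMax (l : List ℕ) : Prop :=
  ∀ x ∈ l.head?, ∀ y ∈ l, y ≤ x

/-- Rotating an avoiding list which starts with an extremal entry keeps it
avoiding. -/
theorem ListAvoids.rotate {P Q : List ℕ} {h : ℕ} (hav : ListAvoids (P ++ h :: Q))
    (hP : P ≠ [] → (∀ x ∈ P ++ h :: Q, x ≤ P.headI) ∨ (∀ x ∈ P ++ h :: Q, P.headI ≤ x)) :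
    ListAvoids (h :: Q ++ P) := by
  intro X a b Y hl
  rw [List.append_eq_append_iff] at hl
  obtain ⟨Z, rfl, rfl⟩ | ⟨Z, hZ, hZ'⟩ := hl
  · have := hav Z a b (Y ++ (h :: Q)) (by simp)
    simpa using this
  · match Z, hZ, hZ' with
    | [], hZ, hZ' =>
      obtain rfl : P = a :: b :: Y := by simpa using hZ'.symm
      have := hav [] a b (Y ++ h :: Q) (by simp)
      simp at hZ
      simpa [hZ] using this
    | [z], hZ, hZ' =>
      have hP' := hP (by rintro rfl; simp at hZ')
      simp only [List.cons_append, List.nil_append, List.cons.injEq] at hZ'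
      obtain ⟨rfl, rfl⟩ := hZ'
      rw [hZ] at hP'
      rw [List.pairwise_iff_forall_sublist]
      intro c d hcd
      have hc : c ∈ Y ++ X := hcd.subset (by simp)
      have hd : d ∈ Y ++ X := hcd.subset (by simp)
      rcases hP' with h1 | h1
      · have := h1 c (by simp at hc ⊢; tauto)
        simp at this; omega
      · have := h1 a (by simp)
        simp at this; omega
    | z :: w :: Z, hZ, hZ' =>
      simp only [List.cons_append, List.cons.injEq] at hZ'
      obtain ⟨rfl, rfl, rfl⟩ := hZ'
      have := hav (P ++ X) a b Z (by rw [hZ]; simp)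
      simpa using this

theorem pairwise_insert_small {a b : ℕ} {M Y Z : List ℕ} (hM : ∀ x ∈ M, x ≤ a ∧ x ≤ b)
    (h : (Y ++ Z).Pairwise fun c d => ¬(a < d ∧ d < b ∧ b < c)) :
    (Y ++ (M ++ Z)).Pairwise fun c d => ¬(a < d ∧ d < b ∧ b < c) := by
  rw [List.pairwise_append] at h
  obtain ⟨hY, hZ, hYZ⟩ := h
  refine List.pairwise_append.2 ⟨hY, List.pairwise_append.2 ⟨?_, hZ, ?_⟩, ?_⟩
  · exact List.pairwise_of_forall_mem_list fun c hc d hd => by grind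
  · intro c hc d hd
    grind
  · intro c hc d hd
    obtain hd | hd := List.mem_append.1 hd
    · grind
    · exact hYZ c hc d hd

theorem listAvoids_cons_min_cons_min {s b : ℕ} {R : List ℕ} (hs : s < b)
    (hR : ∀ x ∈ R, b < x) : ListAvoids (s :: b :: R) ↔ ListAvoids (b :: R) := by
  constructor
  · intro h X a b' Y hl
    refine (h (s :: X) a b' Y (by simp [hl])).sublist ?_
    exact List.Sublist.append_left (List.sublist_cons_self _ _) _
  · intro h X a b' Y hl
    match X, hl with
    | [], hl =>
      simp only [List.nil_append, List.cons.injEq] at hl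
      obtain ⟨rfl, rfl, rfl⟩ := hl
      simp only [List.append_nil]
      exact List.pairwise_of_forall_mem_list fun c _ d hd => by grind
    | x :: X, hl =>
      simp only [List.cons_append, List.cons.injEq] at hl
      obtain ⟨rfl, hl⟩ := hl
      have h1 := h X a b' Y hl
      have h2 : ∀ y ∈ b :: R, s < y := by grind
      have h3 := h2 a (by simp [hl])
      have h4 := h2 b' (by simp [hl])
      exact pairwise_insert_small (M := [s]) (by grind) h1

theorem listAvoids_cons_min {s b : ℕ} {L R : List ℕ} (hL0 : L ≠ []) (hs : s < b)
    (hsL : ∀ x ∈ L, s < x) (hL : ∀ x ∈ L, x < b) (hR : ∀ x ∈ R, b < x) :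
    ListAvoids (s :: (b :: L ++ R)) ↔ ListAvoids (b :: L) ∧ ListAvoids R ∧ HeadIsMax R := by
  constructor
  · intro h
    refine ⟨?_, ?_, ?_⟩
    · intro X a b' Y hl
      refine (h (s :: X) a b' (Y ++ R) (by simp [hl])).sublist ?_
      rw [List.append_assoc]
      exact List.Sublist.append_left (by simp) _
    · intro X a b' Y hl
      refine (h (s :: (b :: L ++ X)) a b' Y (by simp [hl])).sublist ?_
      refine List.Sublist.append_left ?_ _
      rw [← List.cons_append]
      exact List.sublist_append_right _ _
    · intro r hr y hy
      obtain ⟨R, rfl⟩ : ∃ R', R = r :: R' := by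
        cases R <;> simp_all
      obtain rfl | hy := List.mem_cons.1 hy
      · rfl
      have h1 := h (s :: b :: L.dropLast) (L.getLast hL0) r R (by
        conv_lhs => rw [← List.dropLast_append_getLast hL0]
        simp)
      rw [List.pairwise_append] at h1
      have h2 := h1.2.2 y hy b (by simp)
      have h3 := hL _ (List.getLast_mem hL0)
      have h4 := hR r (by simp)
      omega
  · rintro ⟨h1, h2, h3⟩ X a b' Y hl
    match X, hl with
    | [], hl =>
      simp only [List.nil_append, List.cons_append, List.cons.injEq] at hl
      obtain ⟨rfl, rfl, rfl⟩ := hl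
      simp only [List.append_nil, List.pairwise_append]
      refine ⟨List.pairwise_of_forall_mem_list ?_, List.pairwise_of_forall_mem_list ?_, ?_⟩ <;>
        grind
    | x :: X, hl =>
      change s :: (b :: L ++ R) = x :: (X ++ a :: b' :: Y) at hl
      rw [List.cons.injEq] at hl
      obtain ⟨rfl, hl⟩ := hl
      rw [List.append_eq_append_iff] at hl
      obtain ⟨Z, rfl, rfl⟩ | ⟨Z, hZ, hZ'⟩ := hl
      · have ha := hR a (by simp)
        have hb := hR b' (by simp)
        have := pairwise_insert_small (M := s :: b :: L) (by grind) (h2 Z a b' Y rfl)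
        simpa using this
      · match Z, hZ, hZ' with
        | [], hZ, hZ' =>
          simp only [List.nil_append, List.append_nil] at hZ hZ'
          subst hZ hZ'
          have ha := hR a (by simp)
          have hb := hR b' (by simp)
          have := pairwise_insert_small (M := s :: b :: L) (by grind) (h2 [] a b' Y rfl)
          simpa using this
        | [z], hZ, hZ' =>
          simp only [List.cons_append, List.nil_append, List.cons.injEq] at hZ'
          obtain ⟨rfl, rfl⟩ := hZ'
          have h4 := h3 b' (by simp)
          have h5 : ∀ x ∈ X, x ≤ b := fun x hx => by
            have : x ∈ b :: L := by simp [hZ, hx]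
            grind
          have h6 := hR b' (by simp)
          have h7 : ∀ x ∈ Y ++ s :: X, x ≤ b' := by grind
          exact List.pairwise_of_forall_mem_list fun c hc d _ h => by
            have := h7 c hc
            omega
        | z :: w :: Z, hZ, hZ' =>
          simp only [List.cons_append, List.cons.injEq] at hZ'
          obtain ⟨rfl, rfl, rfl⟩ := hZ'
          have h4 := h1 X a b' Z hZ
          have h5 : ∀ x ∈ X ++ a :: b' :: Z, x ≤ b ∧ s < x := by rw [← hZ]; grind
          have hb' := h5 b' (by simp)
          have h6 : (R.Pairwise fun c d => ¬(a < d ∧ d < b' ∧ b' < c)) :=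
            List.pairwise_of_forall_mem_list fun c _ d hd h => by
              have := hR d hd
              omega
          have h7 : ∀ d ∈ X, ¬ (a < d ∧ d < b') := by
            cases X with
            | nil => simp
            | cons x X =>
              simp only [List.cons_append, List.cons.injEq] at hZ
              obtain ⟨rfl, rfl⟩ := hZ
              simp only [List.pairwise_append, List.pairwise_cons] at h4
              grind
          simp only [List.pairwise_append, List.pairwise_cons] at h4 ⊢
          grind

theorem exists_split_of_pairwise {b : ℕ} {T : List ℕ} (hb : b ∉ T)
    (h : T.Pairwise fun c d => ¬(d < b ∧ b < c)) :
    ∃ L R, T = L ++ R ∧ (∀ x ∈ L, x < b) ∧ ∀ x ∈ R, b < x := by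
  induction T with
  | nil => exact ⟨[], [], by simp⟩
  | cons t T ih =>
    rw [List.pairwise_cons] at h
    obtain ht | ht := lt_or_gt_of_ne (show t ≠ b by grind)
    · obtain ⟨L, R, rfl, hL, hR⟩ := ih (by grind) h.2
      exact ⟨t :: L, R, by simp, by grind, hR⟩
    · exact ⟨[], t :: T, by simp, by simp, by grind⟩

open Classical in
/-- Avoiding arrangements of `s, …, s + m - 1` that start with `v`. -/
noncomputable def avoidersFrom (s m v : ℕ) : Finset (List ℕ) :=
  {l ∈ (List.range' s m).permutations.toFinset | l.head? = some v ∧ ListAvoids l}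

open Classical in
/-- Avoiding arrangements of `s, …, s + m - 1` whose first entry, if any, is the largest. -/
noncomputable def avoidersFromMax (s m : ℕ) : Finset (List ℕ) :=
  {l ∈ (List.range' s m).permutations.toFinset | HeadIsMax l ∧ ListAvoids l}

theorem perm_range'_iff {s m : ℕ} {l : List ℕ} :
    l.Perm (List.range' s m) ↔ l.Nodup ∧ ∀ x, x ∈ l ↔ s ≤ x ∧ x < s + m := by
  constructor
  · intro h
    exact ⟨h.nodup_iff.2 List.nodup_range', fun x => by rw [h.mem_iff, List.mem_range'_1]⟩
  · rintro ⟨h, h'⟩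
    rw [List.perm_ext_iff_of_nodup h List.nodup_range']
    intro x
    rw [h', List.mem_range'_1]

theorem mem_avoidersFrom {s m v : ℕ} {l : List ℕ} : l ∈ avoidersFrom s m v ↔
    (l.Nodup ∧ ∀ x, x ∈ l ↔ s ≤ x ∧ x < s + m) ∧ l.head? = some v ∧ ListAvoids l := by
  simp [avoidersFrom, ← perm_range'_iff]

theorem mem_avoidersFromMax {s m : ℕ} {l : List ℕ} : l ∈ avoidersFromMax s m ↔
    (l.Nodup ∧ ∀ x, x ∈ l ↔ s ≤ x ∧ x < s + m) ∧ HeadIsMax l ∧ ListAvoids l := by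
  simp [avoidersFromMax, ← perm_range'_iff]

theorem length_of_mem_avoidersFrom {s m v : ℕ} {l : List ℕ} (h : l ∈ avoidersFrom s m v) :
    l.length = m := by
  simpa using (perm_range'_iff.2 (mem_avoidersFrom.1 h).1).length_eq

theorem avoidersFromMax_zero (s : ℕ) : avoidersFromMax s 0 = {[]} := by
  ext l
  rw [mem_avoidersFromMax, ← perm_range'_iff]
  simp only [List.range'_zero, List.perm_nil, Finset.mem_singleton]
  constructor
  · exact fun h => h.1
  · rintro rfl
    exact ⟨rfl, by simp [HeadIsMax], fun X a b Y h => by simp at h⟩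

theorem avoidersFromMax_succ (s m : ℕ) :
    avoidersFromMax s (m + 1) = avoidersFrom s (m + 1) (s + m) := by
  ext l
  rw [mem_avoidersFromMax, mem_avoidersFrom]
  refine and_congr_right fun ⟨hn, hl⟩ => and_congr_left fun _ => ?_
  cases l with
  | nil => have := hl s; simp at this
  | cons x l =>
    have h1 := (hl (s + m)).2 (by omega)
    have h2 := (hl x).1 (by simp)
    simp only [HeadIsMax, List.head?_cons, Option.mem_some_iff, Option.some.injEq, forall_eq']
    constructor
    · intro h
      have := h _ h1
      omega
    · rintro rfl y hy
      have := (hl y).1 hy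
      omega

theorem card_avoidersFrom_le {s m v w : ℕ} (hv : v = s ∨ v + 1 = s + m)
    (hw : w = s ∨ w + 1 = s + m) (hm : 1 ≤ m) :
    (avoidersFrom s m v).card ≤ (avoidersFrom s m w).card := by
  refine Finset.card_le_card_of_injOn (fun l => l.rotate (l.idxOf w)) ?_ ?_
  · intro l hl
    rw [Finset.mem_coe, mem_avoidersFrom] at hl
    obtain ⟨⟨hn, hl⟩, hh, hav⟩ := hl
    obtain ⟨P, Q, rfl, hP⟩ := List.eq_append_cons_of_mem ((hl w).2 (by omega))
    have hrot : (P ++ w :: Q).rotate ((P ++ w :: Q).idxOf w) = w :: Q ++ P := by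
      rw [List.idxOf_append_of_notMem hP, List.idxOf_cons_self, Nat.add_zero,
        List.rotate_append_length_eq]
    simp only [Finset.mem_coe, hrot, mem_avoidersFrom]
    have hperm : (w :: Q ++ P).Perm (P ++ w :: Q) := List.perm_append_comm
    refine ⟨⟨hperm.nodup_iff.2 hn, fun x => by rw [hperm.mem_iff, hl]⟩, by simp, hav.rotate ?_⟩
    intro hP0
    obtain ⟨p, P, rfl⟩ := List.exists_cons_of_ne_nil hP0
    simp only [List.cons_append, List.head?_cons, Option.some.injEq] at hh
    subst hh
    simp only [hl, List.headI_cons]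
    rcases hv with hv | hv
    · right; intros; omega
    · left; intros; omega
  · intro l hl l' hl' heq
    rw [Finset.mem_coe] at hl hl'
    have hlen := length_of_mem_avoidersFrom hl
    rw [mem_avoidersFrom] at hl hl'
    replace heq : l.rotate (l.idxOf w) = l'.rotate (l'.idxOf w) := heq
    have hr : l ~r l' := (List.IsRotated.forall l (l.idxOf w)).symm.trans
      (heq.symm ▸ (List.IsRotated.forall l' (l'.idxOf w)))
    obtain ⟨k, rfl⟩ := hr
    have hk : k % l.length < l.length := Nat.mod_lt _ (by omega)
    have h0 : 0 < l.length := by omega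
    have hh := hl'.2.1
    rw [← List.rotate_mod, List.head?_rotate hk, ← hl.2.1, List.head?_eq_getElem?,
      List.getElem?_eq_getElem hk, List.getElem?_eq_getElem h0, Option.some.injEq,
      hl.1.1.getElem_inj_iff] at hh
    rw [← List.rotate_mod, hh, List.rotate_zero]

theorem avoidersFrom_decomp (s m : ℕ) :
    avoidersFrom s (m + 2) s =
      (avoidersFrom (s + 1) (m + 1) (s + 1)).image (List.cons s) ∪
      (Finset.range m).biUnion fun j =>
        (avoidersFrom (s + 1) (j + 2) (s + j + 2) ×ˢ avoidersFromMax (s + j + 3) (m - 1 - j)).image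
          fun q => s :: (q.1 ++ q.2) := by
  ext l
  simp only [Finset.mem_union, Finset.mem_image, Finset.mem_biUnion, Finset.mem_range,
    Finset.mem_product, Prod.exists]
  constructor
  · intro h
    obtain ⟨⟨hn, hl⟩, hh, hav⟩ := mem_avoidersFrom.1 h
    obtain ⟨l, rfl⟩ : ∃ l', l = s :: l' := by cases l <;> simp_all
    cases l with
    | nil => have := (hl (s + 1)).2 (by omega); simp at this
    | cons b T =>
      have h1 := hav [] s b T rfl
      simp only [List.nodup_cons, List.mem_cons, not_or] at hn
      obtain ⟨⟨hsb, hsT⟩, hbT, hT⟩ := hn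
      have hlT : ∀ x ∈ T, s < x := by grind
      have hb : s < b := by
        have := (hl b).1 (by simp)
        omega
      obtain ⟨L, R, rfl, hL, hR⟩ := exists_split_of_pairwise hbT (by
        rw [List.append_nil] at h1
        refine List.Pairwise.imp_of_mem ?_ h1
        grind)
      obtain rfl | hb' := eq_or_lt_of_le (Nat.succ_le_of_lt hb)
      · have : L = [] := by
          rw [List.eq_nil_iff_forall_not_mem]
          grind
        subst this
        refine Or.inl ⟨(s + 1) :: R, ?_, rfl⟩
        rw [mem_avoidersFrom]
        refine ⟨⟨by grind, by grind⟩, by simp, ?_⟩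
        exact (listAvoids_cons_min_cons_min hb hR).1 hav
      · have hL0 : L ≠ [] := by
          rintro rfl
          have := hl (s + 1)
          grind
        obtain ⟨ha1, ha2, ha3⟩ := (listAvoids_cons_min hL0 hb (by grind) hL hR).1 hav
        obtain ⟨j, rfl⟩ : ∃ j, b = s + j + 2 := ⟨b - s - 2, by grind⟩
        have hbl := (hl (s + j + 2)).1 (by simp)
        refine Or.inr ⟨j, by omega, (s + j + 2) :: L, R, ⟨?_, ?_⟩, rfl⟩
        · rw [mem_avoidersFrom]
          refine ⟨⟨by grind, fun x => ?_⟩, by simp, ha1⟩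
          have := hl x
          grind
        · rw [mem_avoidersFromMax]
          refine ⟨⟨by grind, fun x => ?_⟩, ha3, ha2⟩
          have := hl x
          grind
  · rintro (⟨l, h, rfl⟩ | ⟨j, hj, P, R, ⟨hP, hR⟩, rfl⟩)
    · obtain ⟨⟨hn, hl⟩, hh, hav⟩ := mem_avoidersFrom.1 h
      obtain ⟨l, rfl⟩ : ∃ l', l = (s + 1) :: l' := by cases l <;> simp_all
      rw [mem_avoidersFrom]
      refine ⟨⟨by grind, by grind⟩, by simp, ?_⟩
      rw [listAvoids_cons_min_cons_min (by omega) (by grind)]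
      exact hav
    · obtain ⟨⟨hn, hl⟩, hh, hav⟩ := mem_avoidersFrom.1 hP
      obtain ⟨⟨hn', hl'⟩, hh', hav'⟩ := mem_avoidersFromMax.1 hR
      obtain ⟨L, rfl⟩ : ∃ L, P = (s + j + 2) :: L := by cases P <;> simp_all
      rw [mem_avoidersFrom]
      refine ⟨⟨?_, ?_⟩, by simp, ?_⟩
      · rw [List.nodup_cons, List.nodup_append]
        grind
      · grind
      · rw [listAvoids_cons_min _ (by omega) (by grind) (by grind) (by grind)]
        · exact ⟨hav, hav', hh'⟩
        · rintro rfl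
          have := hl (s + 1)
          grind

theorem card_avoidersFrom_succ_succ (s m : ℕ) :
    (avoidersFrom s (m + 2) s).card = (avoidersFrom (s + 1) (m + 1) (s + 1)).card +
      ∑ j ∈ Finset.range m, (avoidersFrom (s + 1) (j + 2) (s + j + 2)).card *
        (avoidersFromMax (s + j + 3) (m - 1 - j)).card := by
  rw [avoidersFrom_decomp, Finset.card_union_of_disjoint, Finset.card_biUnion,
    Finset.card_image_of_injective _ (List.cons_injective)]
  · congr 1
    refine Finset.sum_congr rfl fun j _ => ?_
    rw [Finset.card_image_of_injOn, Finset.card_product]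
    rintro ⟨P, R⟩ h ⟨P', R'⟩ h' heq
    simp only [Finset.mem_coe, Finset.mem_product] at h h'
    simp only [List.cons.injEq, true_and] at heq
    have := List.append_inj heq (by
      rw [length_of_mem_avoidersFrom h.1, length_of_mem_avoidersFrom h'.1])
    simp [this]
  · intro i _ j _ hij
    rw [Function.onFun, Finset.disjoint_left]
    intro l hi hj
    simp only [Finset.mem_image, Finset.mem_product, Prod.exists, mem_avoidersFrom] at hi hj
    obtain ⟨P, R, ⟨⟨-, hP, -⟩, -⟩, rfl⟩ := hi
    obtain ⟨P', R', ⟨⟨-, hP', -⟩, -⟩, heq⟩ := hj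
    cases P <;> cases P' <;> simp at hP hP' heq
    omega
  · rw [Finset.disjoint_left]
    intro l hi hj
    simp only [Finset.mem_image, Finset.mem_biUnion, Finset.mem_product, Prod.exists,
      mem_avoidersFrom] at hi hj
    obtain ⟨P, ⟨-, hP, -⟩, rfl⟩ := hi
    obtain ⟨j, -, P', R', ⟨⟨-, hP', -⟩, -⟩, heq⟩ := hj
    cases P <;> cases P' <;> simp at hP hP' heq
    omega

theorem card_avoidersFrom (D : ℕ → ℕ) (hD1 : D 1 = 2) (hD2 : D 2 = 1) (hD3 : D 3 = 1)
    (hDrec : ∀ m, 4 ≤ m → D m = ∑ k ∈ Finset.Icc 1 (m - 3), D k * D (m - k)) (m s v : ℕ)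
    (hm : 1 ≤ m) (hv : v = s ∨ v + 1 = s + m) : (avoidersFrom s m v).card = D (m + 1) := by
  induction m using Nat.strong_induction_on generalizing s v with
  | _ m ih =>
  have hvs : (avoidersFrom s m v).card = (avoidersFrom s m s).card :=
    (card_avoidersFrom_le hv (Or.inl rfl) hm).antisymm (card_avoidersFrom_le (Or.inl rfl) hv hm)
  rw [hvs]
  obtain rfl | ⟨m, rfl⟩ : m = 1 ∨ ∃ k, m = k + 2 := by
    obtain rfl | h := eq_or_ne m 1
    · simp
    · exact Or.inr ⟨m - 2, by omega⟩
  · rw [hD2, Finset.card_eq_one]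
    refine ⟨[s], ?_⟩
    ext l
    rw [mem_avoidersFrom, ← perm_range'_iff]
    simp only [List.range'_one, List.perm_singleton, Finset.mem_singleton]
    constructor
    · exact fun h => h.1
    · rintro rfl
      refine ⟨rfl, rfl, fun X a b Y h => ?_⟩
      have := congrArg List.length h
      simp at this
      omega
  · rw [card_avoidersFrom_succ_succ, ih (m + 1) (by omega) _ _ (by omega) (Or.inl rfl)]
    rcases m with _ | m
    · simp [hD2, hD3]
    · have hsum : ∑ j ∈ Finset.range m, (avoidersFrom (s + 1) (j + 2) (s + j + 2)).card *
          (avoidersFromMax (s + j + 3) (m - j)).card =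
          ∑ k ∈ Finset.range m, D (k + 2) * D (m + 2 - k) := by
        rw [← Finset.sum_range_reflect]
        refine Finset.sum_congr rfl fun j hj => ?_
        rw [Finset.mem_range] at hj
        obtain ⟨i, rfl⟩ := Nat.exists_eq_add_of_lt hj
        rw [show j + i + 1 - 1 - j = i by omega, show j + i + 1 - i = j + 1 by omega,
          avoidersFromMax_succ, ih (i + 2) (by omega) _ _ (by omega) (by omega),
          ih (j + 1) (by omega) _ _ (by omega) (by omega),
          show j + i + 1 + 2 - j = i + 2 + 1 by omega, mul_comm]
      rw [Finset.sum_range_succ, Nat.add_sub_cancel, Nat.sub_self, avoidersFromMax_zero,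
        ih (m + 2) (by omega) _ _ (by omega) (by omega), hsum, hDrec (m + 1 + 2 + 1) (by omega),
        show m + 1 + 2 + 1 - 3 = m + 1 by omega, ← Finset.Ico_add_one_right_eq_Icc,
        Finset.sum_Ico_eq_sum_range, Nat.add_sub_cancel, Finset.sum_range_succ', hD1,
        Finset.card_singleton]
      have : ∀ k, D (1 + (k + 1)) * D (m + 1 + 2 + 1 - (1 + (k + 1))) =
          D (k + 2) * D (m + 2 - k) := fun k => by
        congr 2 <;> omega
      simp only [this]
      rw [show m + 1 + 2 + 1 - (1 + 0) = m + 3 by omega]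
      ring

theorem getElem_rotate_ofFn {n : ℕ} (σ : Equiv.Perm (Fin n)) (p : Fin n) (k : ℕ)
    (hk : k < ((List.ofFn fun i => (σ i).val).rotate p).length) :
    ((List.ofFn fun i => (σ i).val).rotate p)[k] = (σ (cyc p k)).val := by
  rw [List.getElem_rotate, List.getElem_ofFn]
  simp [cyc, Nat.add_comm]

theorem listAvoids_ofFn_iff {n : ℕ} (hn : 1 ≤ n) (σ : Equiv.Perm (Fin n))
    (hσ : σ ⟨0, hn⟩ = ⟨0, hn⟩) :
    ListAvoids (List.ofFn fun i => (σ i).val) ↔ ¬Contains1342 σ := by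
  constructor
  · rintro h ⟨p, k, l, hk, hkl, hln, h1, h2, h3⟩
    obtain hp | hp : p.val + 1 = n ∨ p.val + 1 < n := by omega
    · have : cyc p 1 = ⟨0, hn⟩ := by simp [cyc, hp]
      rw [this, hσ, Fin.lt_def] at h2
      simp at h2
    · obtain ⟨a, b, Y, hY⟩ : ∃ a b Y, (List.ofFn fun i => (σ i).val).drop p = a :: b :: Y := by
        have hlen : ((List.ofFn fun i => (σ i).val).drop p).length = n - p := by simp
        match (List.ofFn fun i => (σ i).val).drop p, hlen with
        | [], h => simp at h; omega
        | [_], h => simp at h; omega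
        | a :: b :: Y, _ => exact ⟨a, b, Y, rfl⟩
      have hpw := h (List.take p (List.ofFn fun i => (σ i).val)) a b Y (by
        rw [← hY, List.take_append_drop])
      have hrot : (List.ofFn fun i => (σ i).val).rotate p =
          a :: b :: (Y ++ (List.ofFn fun i => (σ i).val).take p) := by
        rw [List.rotate_eq_drop_append_take (by simp), hY]
        rfl
      have hget := getElem_rotate_ofFn σ p
      simp only [hrot] at hget
      have hlen := congrArg List.length hrot
      simp only [List.length_rotate, List.length_ofFn, List.length_cons] at hlen
      have h0 := hget 0 (by simp)
      have h1' := hget 1 (by simp)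
      rw [List.pairwise_iff_getElem] at hpw
      obtain ⟨k, rfl⟩ := Nat.exists_eq_add_of_le' hk
      obtain ⟨l, rfl⟩ := Nat.exists_eq_add_of_le' (hk.trans hkl.le)
      apply hpw k l (by omega) (by omega) (by omega)
      have hk' := hget (k + 2) (by simp only [List.length_cons]; omega)
      have hl' := hget (l + 2) (by simp only [List.length_cons]; omega)
      have hp0 : cyc p 0 = p := by simp [cyc, Nat.mod_eq_of_lt p.isLt]
      simp only [List.getElem_cons_succ, List.getElem_cons_zero, hp0] at h0 h1' hk' hl'
      exact ⟨h0.trans_lt ((Fin.lt_def.1 h1).trans_eq hl'.symm),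
        hl'.trans_lt ((Fin.lt_def.1 h2).trans_eq h1'.symm),
        h1'.trans_lt ((Fin.lt_def.1 h3).trans_eq hk'.symm)⟩
  · intro h X a b Y hl
    rw [List.pairwise_iff_getElem]
    rintro i j hi hj hij ⟨h1, h2, h3⟩
    apply h
    have hlen := congrArg List.length hl
    simp only [List.length_ofFn, List.length_append, List.length_cons] at hlen hi hj
    have hrot : (List.ofFn fun i => (σ i).val).rotate X.length = a :: b :: (Y ++ X) := by
      rw [hl, List.rotate_append_length_eq]
      rfl
    have hget := getElem_rotate_ofFn σ ⟨X.length, by omega⟩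
    simp only [hrot] at hget
    have hp : X.length < n := by omega
    have hp0 : cyc (⟨X.length, hp⟩ : Fin n) 0 = ⟨X.length, hp⟩ := by
      simp [cyc, Nat.mod_eq_of_lt hp]
    have ha := hget 0 (by simp)
    have hb := hget 1 (by simp)
    have hc := hget (i + 2) (by simp only [List.length_cons, List.length_append]; omega)
    have hd := hget (j + 2) (by simp only [List.length_cons, List.length_append]; omega)
    simp only [List.getElem_cons_succ, List.getElem_cons_zero, hp0] at ha hb hc hd
    refine ⟨⟨X.length, hp⟩, i + 2, j + 2, by omega, by omega, by omega, ?_⟩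
    simp only [Fin.lt_def]
    rw [← ha, ← hb, ← hc, ← hd]
    exact ⟨h1, h2, h3⟩

/-- if `D` satisfies `D 1 = 2`, `D 2 = 1`, `D 3 = 1` and
`D n = ∑_{k=1}^{n-3} D k * D (n-k)` for `n ≥ 4`, then for all `n ≥ 1` the number
of cyclic permutations of length `n` avoiding the vincular cyclic pattern 13-42
equals `D (n+1)`. -/
theorem stmt11 (D : ℕ → ℕ) (hD1 : D 1 = 2) (hD2 : D 2 = 1) (hD3 : D 3 = 1)
    (hDrec : ∀ m, 4 ≤ m → D m = ∑ k ∈ Finset.Icc 1 (m - 3), D k * D (m - k))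
    (n : ℕ) (hn : 1 ≤ n) :
    Nat.card {σ : Equiv.Perm (Fin n) //
        σ ⟨0, hn⟩ = ⟨0, hn⟩ ∧ ¬ Contains1342 σ} = D (n + 1) := by
  rw [← card_avoidersFrom D hD1 hD2 hD3 hDrec n 0 0 hn (Or.inl rfl), ← Nat.card_eq_finsetCard]
  have hmem (σ : Equiv.Perm (Fin n)) (h : σ ⟨0, hn⟩ = ⟨0, hn⟩ ∧ ¬Contains1342 σ) :
      (List.ofFn fun i => (σ i).val) ∈ avoidersFrom 0 n 0 := by
    rw [mem_avoidersFrom, listAvoids_ofFn_iff hn σ h.1]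
    refine ⟨⟨?_, fun x => ?_⟩, ?_, h.2⟩
    · rw [List.nodup_ofFn]
      exact Fin.val_injective.comp σ.injective
    · rw [List.mem_ofFn']
      constructor
      · rintro ⟨i, rfl⟩
        simp
      · intro hx
        exact ⟨σ.symm ⟨x, by omega⟩, by simp⟩
    · simp [List.head?_eq_getElem?, h.1, Nat.pos_iff_ne_zero.1 hn]
  refine Nat.card_eq_of_bijective (fun σ => ⟨List.ofFn fun i => (σ.1 i).val, hmem σ.1 σ.2⟩) ⟨?_, ?_⟩
  · intro σ τ h
    rw [Subtype.mk.injEq, List.ofFn_inj] at h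
    exact Subtype.ext (Equiv.ext fun i => Fin.ext (congrFun h i))
  · rintro ⟨l, hl⟩
    have hlen := length_of_mem_avoidersFrom hl
    obtain ⟨⟨hnd, hmem⟩, hhead, hav⟩ := mem_avoidersFrom.1 hl
    subst hlen
    have hinj : Function.Injective fun i : Fin l.length =>
        (⟨l[i], by simpa using (hmem l[i]).1 (List.getElem_mem _)⟩ : Fin l.length) := by
      intro i j h
      simpa [hnd.getElem_inj_iff, Fin.ext_iff] using h
    let σ := Equiv.ofBijective _ (Finite.injective_iff_bijective.1 hinj)
    have hσ : (List.ofFn fun i => (σ i).val) = l := by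
      simp [σ]
    have hσ0 : σ ⟨0, hn⟩ = ⟨0, hn⟩ := by
      rw [List.head?_eq_getElem?, List.getElem?_eq_getElem hn, Option.some.injEq] at hhead
      simpa [σ, Fin.ext_iff] using hhead
    exact ⟨⟨σ, hσ0, (listAvoids_ofFn_iff hn σ hσ0).1 (by rwa [hσ])⟩, Subtype.ext hσ⟩
end

section
/- For all n ≥ 1, the number of cyclic permutations of length n avoiding the vincular cyclic pattern [\overline{14}23] equals the Catalan number C_{n-1}. -/
/-- Contains the vincular cyclic pattern 14-23: entries `a = σ p`, `b = σ (p+1)`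
cyclically adjacent, followed by `c = σ (p+k)` and `d = σ (p+l)` with
`a < c < d < b`. -/
def Contains1423 {n : ℕ} (σ : Equiv.Perm (Fin n)) : Prop :=
  ∃ (p : Fin n) (k l : ℕ), 2 ≤ k ∧ k < l ∧ l < n ∧
    σ p < σ (cyc p k) ∧ σ (cyc p k) < σ (cyc p l) ∧ σ (cyc p l) < σ (cyc p 1)

namespace CyclicAvoidance

open List

/-- A word, read cyclically, avoids the complementary pattern 41-32: between two cyclically
adjacent entries `a`, `b`, the values strictly between `b` and `a` are read in increasing order. -/
def Avoids (l : List ℕ) : Prop :=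
  ∀ a b w, (a :: b :: w) ~r l → w.Pairwise fun x y => ¬ (b < y ∧ y < x ∧ x < a)

/-- The avoiding arrangements of `0, …, n - 1` starting with `b`, in which the entries exceeding
`b` are read in increasing order. -/
def avoidersFrom (n b : ℕ) : Set (List ℕ) :=
  {l | l ~ range n ∧ Avoids l ∧ ∃ t, l = b :: t ∧ t.Pairwise fun x y => ¬ (b < y ∧ y < x)}

/-- The rotation of `l` starting at the first occurrence of `b`. -/
def rotateTo (b : ℕ) (l : List ℕ) : List ℕ :=
  l.dropWhile (· ≠ b) ++ l.takeWhile (· ≠ b)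

theorem isRotated_iff_exists_append {l l' : List ℕ} :
    l ~r l' ↔ ∃ x y, l = x ++ y ∧ l' = y ++ x := by
  constructor
  · intro h
    obtain ⟨n, hn, rfl⟩ := isRotated_iff_mod.1 h
    exact ⟨l.take n, l.drop n, by simp, rotate_eq_drop_append_take hn⟩
  · rintro ⟨x, y, rfl, rfl⟩
    exact isRotated_append

theorem eq_of_isRotated_cons {a : ℕ} {u v : List ℕ} (h : (a :: u) ~r (a :: v))
    (hd : (a :: u).Nodup) : u = v := by
  obtain ⟨x, y, hx, hy⟩ := isRotated_iff_exists_append.1 h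
  rcases x with _ | ⟨a', x⟩
  · rw [append_nil] at hy
    rw [nil_append, ← hy, cons.injEq] at hx
    exact hx.2
  rcases y with _ | ⟨b', y⟩
  · rw [nil_append, ← append_nil (a' :: x), ← hx, cons.injEq] at hy
    exact hy.2.symm
  simp only [cons_append, cons.injEq] at hx hy
  obtain ⟨rfl, rfl⟩ := hx
  obtain ⟨rfl, -⟩ := hy
  simp at hd

theorem rotateTo_isRotated (b : ℕ) (l : List ℕ) : rotateTo b l ~r l := by
  have h := isRotated_append (l := l.dropWhile (· ≠ b)) (l' := l.takeWhile (· ≠ b))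
  rwa [takeWhile_append_dropWhile] at h

theorem rotateTo_append_cons {b : ℕ} {x y : List ℕ} (h : b ∉ x) :
    rotateTo b (x ++ b :: y) = b :: y ++ x := by
  have h' : ∀ a ∈ x, decide (a ≠ b) = true := by
    intro a ha
    simp only [decide_eq_true_eq]
    rintro rfl
    exact h ha
  rw [rotateTo, dropWhile_append_of_pos h', takeWhile_append_of_pos h']
  simp

theorem Avoids.congr {l l' : List ℕ} (h : l ~r l') (hl : Avoids l) : Avoids l' :=
  fun a b w hw => hl a b w (hw.trans h.symm)

theorem avoids_cons_iff {n b : ℕ} {t : List ℕ} (hlt : ∀ x ∈ b :: t, x < n)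
    (hq : t.Pairwise fun x y => ¬ (b < y ∧ y < x)) : Avoids (n :: b :: t) ↔ Avoids (b :: t) := by
  constructor
  · intro h a c w hw
    obtain ⟨x, y, hx, hy⟩ := isRotated_iff_exists_append.1 hw
    rcases x with _ | ⟨a', x⟩
    · simp only [nil_append, append_nil] at hx hy
      have : (a :: c :: (w ++ [n])) ~r (n :: b :: t) := by
        rw [hy, ← hx]
        exact (isRotated_concat n (a :: c :: w))
      exact (pairwise_append.1 (h _ _ _ this)).1
    rcases x with _ | ⟨c', x⟩
    · simp only [cons_append, nil_append, cons.injEq] at hx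
      obtain ⟨rfl, rfl⟩ := hx
      simp only [cons_append, cons.injEq] at hy
      obtain ⟨rfl, rfl⟩ := hy
      exact (pairwise_append.1 hq).1.imp fun h1 h2 => h1 ⟨h2.1, h2.2.1⟩
    · simp only [cons_append, cons.injEq] at hx
      obtain ⟨rfl, rfl, rfl⟩ := hx
      have : (a :: c :: (x ++ n :: y)) ~r (n :: b :: t) := by
        rw [hy]
        exact isRotated_append (l := a :: c :: x) (l' := n :: y)
      exact (h _ _ _ this).sublist (by simp)
  · intro h a c w hw
    have hle : ∀ z ∈ a :: c :: w, z ≤ n := by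
      intro z hz
      rcases mem_cons.1 (hw.mem_iff.1 hz) with rfl | hz
      · exact le_rfl
      · exact (hlt z hz).le
    obtain ⟨x, y, hx, hy⟩ := isRotated_iff_exists_append.1 hw
    rcases y with _ | ⟨n', y⟩
    · simp only [nil_append, append_nil] at hx hy
      rw [← hx] at hy
      simp only [cons.injEq] at hy
      obtain ⟨rfl, rfl, rfl⟩ := hy
      exact hq.imp fun h1 h2 => h1 ⟨h2.1, h2.2.1⟩
    simp only [cons_append, cons.injEq] at hy
    obtain ⟨rfl, hy⟩ := hy
    rcases x with _ | ⟨a', x⟩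
    · simp only [nil_append, append_nil, cons.injEq] at hx hy
      obtain ⟨rfl, rfl⟩ := hx
      simp only [cons.injEq] at hy
      obtain ⟨rfl, rfl⟩ := hy
      exact hq.imp fun h1 h2 => h1 ⟨h2.1, h2.2.1⟩
    rcases x with _ | ⟨c', x⟩
    · simp only [cons_append, nil_append, cons.injEq] at hx
      obtain ⟨rfl, rfl, rfl⟩ := hx
      have hy' : a ∈ b :: t := by simp [hy]
      refine Pairwise.imp_of_mem ?_ (pairwise_of_forall (R := fun _ _ => True) (by simp))
      intro x y hx hy _ h3
      have := hle x (by simp [hx])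
      have := hlt a (by simp [hy'])
      omega
    · simp only [cons_append, cons.injEq] at hx
      obtain ⟨rfl, rfl, rfl⟩ := hx
      have : (a :: c :: (x ++ y)) ~r (b :: t) := by
        rw [hy]
        exact isRotated_append (l := a :: c :: x) (l' := y)
      have h1 := h _ _ _ this
      have hlt' : ∀ z ∈ y ++ a :: c :: x, z < n := by rw [← hy]; exact hlt
      rw [pairwise_append] at h1 ⊢
      have ha : a < n := hlt' a (by simp)
      refine ⟨h1.1, pairwise_cons.2 ⟨?_, h1.2.1⟩, ?_⟩
      · intro z hz
        omega
      · intro z hz z' hz'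
        have hz1 := hlt' z (by simp [hz])
        rcases mem_cons.1 hz' with rfl | hz'
        · omega
        · exact h1.2.2 z hz z' hz'

theorem avoidersFrom_finite (n b : ℕ) : (avoidersFrom n b).Finite :=
  ((range n).permutations.toFinset.finite_toSet).subset fun l hl => by
    simpa using hl.1

theorem mem_iff_lt {n b : ℕ} {l : List ℕ} (hl : l ∈ avoidersFrom n b) {x : ℕ} : x ∈ l ↔ x < n := by
  rw [hl.1.mem_iff, mem_range]

theorem nodup_of_mem {n b : ℕ} {l : List ℕ} (hl : l ∈ avoidersFrom n b) : l.Nodup :=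
  hl.1.nodup_iff.2 nodup_range

theorem avoidersFrom_eq_empty {n b : ℕ} (h : n ≤ b) : avoidersFrom n b = ∅ := by
  rw [Set.eq_empty_iff_forall_notMem]
  intro l hl
  obtain ⟨t, rfl, -⟩ := hl.2.2
  have := (mem_iff_lt hl (x := b)).1 (by simp)
  omega

theorem append_mem_avoidersFrom_iff {n b : ℕ} (hn : 1 ≤ n) {l : List ℕ} :
    l ++ [n] ∈ avoidersFrom (n + 1) b ↔ l ∈ avoidersFrom n b := by
  have hperm : l ++ [n] ~ range (n + 1) ↔ l ~ range n := by
    rw [range_succ, perm_append_right_iff]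
  have hrot : (l ++ [n]) ~r (n :: l) := isRotated_concat n l
  constructor
  · rintro ⟨h1, h2, t, h3, h4⟩
    rw [hperm] at h1
    rcases l with _ | ⟨b', s⟩
    · have := h1.length_eq
      simp at this
      omega
    simp only [cons_append, cons.injEq] at h3
    obtain ⟨rfl, rfl⟩ := h3
    have hq := (pairwise_append.1 h4).1
    have hlt : ∀ x ∈ b' :: s, x < n := fun x hx => mem_range.1 (h1.mem_iff.1 hx)
    exact ⟨h1, (avoids_cons_iff hlt hq).1 (h2.congr hrot), s, rfl, hq⟩
  · intro hl
    obtain ⟨h1, h2, t, rfl, hq⟩ := id hl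
    have hlt : ∀ x ∈ b :: t, x < n := fun x hx => (mem_iff_lt hl).1 hx
    refine ⟨hperm.2 h1, ((avoids_cons_iff hlt hq).2 h2).congr hrot.symm, t ++ [n], rfl, ?_⟩
    refine pairwise_append.2 ⟨hq, by simp, ?_⟩
    intro x hx y hy
    have := hlt x (by simp [hx])
    simp only [mem_singleton] at hy
    omega

theorem exists_eq_append_of_not_concat {n b : ℕ} {l : List ℕ} (hb : b ≤ n)
    (hl : l ∈ avoidersFrom (n + 1) b) (hn : 1 ≤ n) (hlast : ∀ w, l ≠ w ++ [n]) :
    ∃ (c : ℕ) (x y : List ℕ), b = c + 1 ∧ l = b :: x ++ c :: y ∧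
      c :: y ++ b :: x ∈ avoidersFrom (n + 1) c := by
  have hnd := nodup_of_mem hl
  obtain ⟨h1, h2, t, rfl, hq⟩ := id hl
  have key : ∀ (c : ℕ) (x y : List ℕ), b = c + 1 → b :: t = b :: x ++ c :: y →
      (y ++ b :: x).Pairwise (fun x y => ¬ (c < y ∧ y < x)) →
      c :: y ++ b :: x ∈ avoidersFrom (n + 1) c := by
    intro c x y _ h h'
    have hrot : (b :: t) ~r (c :: y ++ b :: x) := by
      rw [h]
      exact isRotated_append
    exact ⟨hrot.perm.symm.trans h1, h2.congr hrot, _, rfl, h'⟩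
  rcases hb.eq_or_lt with rfl | hb
  · obtain ⟨c, rfl⟩ : ∃ c : ℕ, b = c + 1 := ⟨b - 1, by omega⟩
    have hc : c ∈ (c + 1) :: t := (mem_iff_lt hl).2 (by omega)
    obtain ⟨x, y, rfl⟩ := append_of_mem (by simpa using hc : c ∈ t)
    refine ⟨c, x, y, rfl, rfl, key c x y rfl rfl ?_⟩
    refine Pairwise.imp_of_mem ?_ (pairwise_of_forall (R := fun _ _ => True) (by simp))
    intro z w hz hw _ h
    have := (mem_iff_lt hl (x := z)).1 (by simp at hz ⊢; tauto)
    omega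
  · have hmem : n ∈ b :: t := (mem_iff_lt hl).2 (by omega)
    obtain ⟨x, y, rfl⟩ := append_of_mem ((mem_cons.1 hmem).resolve_left (by omega))
    have hy : ∀ z ∈ y, z < b := by
      intro z hz
      have hz1 := (mem_iff_lt hl (x := z)).1 (by simp [hz])
      have hz2 : z ≠ n := by
        rintro rfl
        simp [nodup_append, hz] at hnd
      have hz3 : z ≠ b := by
        rintro rfl
        simp [hz] at hnd
      have := (pairwise_cons.1 (pairwise_append.1 hq).2.1).1 z hz
      omega
    rcases y with _ | ⟨d, y⟩
    · exact absurd rfl (hlast (b :: x))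
    obtain ⟨c, rfl⟩ : ∃ c : ℕ, b = c + 1 := ⟨b - 1, by have := hy d (by simp); omega⟩
    have hc : c ∈ (c + 1) :: (x ++ n :: d :: y) := (mem_iff_lt hl).2 (by omega)
    have hcx : c ∉ x := by
      intro hcx
      have hrot : (n :: d :: (y ++ (c + 1) :: x)) ~r ((c + 1) :: (x ++ n :: d :: y)) :=
        isRotated_append (l := n :: d :: y) (l' := (c + 1) :: x)
      have h := h2 _ _ _ hrot
      have h' := (pairwise_cons.1 (pairwise_append.1 h).2.1).1 c hcx
      have : d ≠ c := by
        rintro rfl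
        simp [nodup_append] at hnd
        have := hnd.2.2.2 d hcx
        tauto
      have := hy d (by simp)
      omega
    have hcy : c ∈ d :: y := by
      simp only [mem_cons, mem_append] at hc ⊢
      rcases hc with h | h | h | h
      · omega
      · exact absurd h hcx
      · omega
      · exact h
    obtain ⟨y₁, y₂, hy'⟩ := append_of_mem hcy
    rw [hy'] at hnd hq hy ⊢
    refine ⟨c, x ++ n :: y₁, y₂, rfl, by simp, key c _ _ rfl (by simp [hy']) ?_⟩
    have hy₁ : ∀ z ∈ y₁, z ≤ c := fun z hz => by have := hy z (by simp [hz]); omega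
    have hy₂ : ∀ z ∈ y₂, z ≤ c := fun z hz => by have := hy z (by simp [hz]); omega
    have hxn : ∀ z ∈ x, z ≠ c + 1 := by
      rintro z hz rfl
      simp [hz] at hnd
    have hx : (x ++ [n]).Pairwise fun x y => ¬ (c < y ∧ y < x) := by
      have : (x ++ [n]).Pairwise fun x y => ¬ (c + 1 < y ∧ y < x) := hq.sublist (by simp)
      refine this.imp_of_mem ?_
      intro z w hz hw h
      simp only [mem_append, mem_singleton] at hw
      rcases hw with hw | rfl
      · have := hxn w hw
        omega
      · omega
    rw [pairwise_append]
    refine ⟨pairwise_of_forall_mem_list ?_, ?_, ?_⟩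
    · intro z hz w hw
      have := hy₂ w hw
      omega
    · rw [show x ++ n :: y₁ = (x ++ [n]) ++ y₁ by simp, pairwise_cons, pairwise_append]
      refine ⟨fun z _ => by omega, hx, pairwise_of_forall_mem_list ?_, ?_⟩
      · intro z hz w hw
        have := hy₁ w hw
        omega
      · intro z hz w hw
        have := hy₁ w hw
        omega
    · intro z hz w hw
      have := hy₂ z hz
      omega

theorem rotate_mem_avoidersFrom_succ {n c : ℕ} {l : List ℕ} (hc : c + 1 ≤ n)
    (hl : l ∈ avoidersFrom (n + 1) c) :
    ∃ x y, l = c :: x ++ (c + 1) :: y ∧ (c + 1) :: y ++ c :: x ∈ avoidersFrom (n + 1) (c + 1) ∧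
      ∀ w, (c + 1) :: y ++ c :: x ≠ w ++ [n] := by
  have hnd := nodup_of_mem hl
  obtain ⟨h1, h2, t, rfl, hq⟩ := id hl
  have hmem : c + 1 ∈ c :: t := (mem_iff_lt hl).2 (by omega)
  obtain ⟨x, y, rfl⟩ := append_of_mem ((mem_cons.1 hmem).resolve_left (by omega))
  have hx : ∀ z ∈ x, z ≤ c := by
    intro z hz
    have hz1 : z ≠ c + 1 := by
      rintro rfl
      simp [nodup_middle, hz] at hnd
    have := (pairwise_append.1 hq).2.2 z hz (c + 1) (by simp)
    omega
  have hrot : (c :: (x ++ (c + 1) :: y)) ~r ((c + 1) :: y ++ c :: x) :=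
    isRotated_append (l := c :: x) (l' := (c + 1) :: y)
  refine ⟨x, y, rfl, ⟨hrot.perm.symm.trans h1, h2.congr hrot, _, rfl, ?_⟩, ?_⟩
  · have hy : y.Pairwise fun x y => ¬ (c < y ∧ y < x) := hq.sublist (by simp)
    refine pairwise_append.2 ⟨hy.imp fun h h' => h (by omega),
      pairwise_of_forall_mem_list ?_, ?_⟩
    all_goals
      intro z hz w hw
      have : w ≤ c := by
        rcases mem_cons.1 hw with rfl | hw
        · exact le_rfl
        · exact hx w hw
      omega
  · intro w hw
    have h := congrArg getLast? hw
    rw [getLast?_append_of_ne_nil _ (by simp), getLast?_append_of_ne_nil _ (by simp)] at h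
    have hm : n ∈ c :: x := mem_of_getLast? (h.trans (by simp))
    rcases mem_cons.1 hm with rfl | hm
    · omega
    · have := hx n hm
      omega

theorem ncard_concat_mem {n b : ℕ} (hn : 1 ≤ n) :
    {l ∈ avoidersFrom (n + 1) b | ∃ w, l = w ++ [n]}.ncard = (avoidersFrom n b).ncard := by
  symm
  refine Set.ncard_congr (fun l _ => l ++ [n]) ?_ ?_ ?_
  · exact fun l hl => ⟨(append_mem_avoidersFrom_iff hn).2 hl, l, rfl⟩
  · intro l l' _ _ h
    simpa using h
  · rintro _ ⟨hl, w, rfl⟩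
    exact ⟨w, (append_mem_avoidersFrom_iff hn).1 hl, rfl⟩

theorem ncard_not_concat_mem {n c : ℕ} (hc : c + 1 ≤ n) :
    {l ∈ avoidersFrom (n + 1) (c + 1) | ¬ ∃ w, l = w ++ [n]}.ncard =
      (avoidersFrom (n + 1) c).ncard := by
  have hrt : ∀ (a : ℕ) (x y : List ℕ), (x ++ a :: y).Nodup →
      rotateTo a (x ++ a :: y) = a :: y ++ x := by
    intro a x y h
    refine rotateTo_append_cons fun ha => ?_
    simp [nodup_middle, ha] at h
  have fwd : ∀ l ∈ {l ∈ avoidersFrom (n + 1) (c + 1) | ¬ ∃ w, l = w ++ [n]},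
      rotateTo c l ∈ avoidersFrom (n + 1) c := by
    rintro l ⟨hl, hw⟩
    obtain ⟨c', x, y, h, rfl, hm⟩ :=
      exists_eq_append_of_not_concat hc hl (by omega) (not_exists.1 hw)
    obtain rfl : c = c' := by omega
    rwa [hrt _ _ _ (nodup_of_mem hl)]
  refine Set.ncard_congr (fun l _ => rotateTo c l) fwd ?_ ?_
  · rintro l l' ⟨hl, hw⟩ ⟨hl', hw'⟩ h
    have hrot : l ~r l' := by
      refine (rotateTo_isRotated c l).symm.trans ?_
      rw [show rotateTo c l = rotateTo c l' from h]
      exact rotateTo_isRotated c l'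
    have hnd := nodup_of_mem hl
    obtain ⟨-, -, t, rfl, -⟩ := hl
    obtain ⟨-, -, t', rfl, -⟩ := hl'
    rw [eq_of_isRotated_cons hrot hnd]
  · intro l hl
    obtain ⟨x, y, rfl, hm, hw⟩ := rotate_mem_avoidersFrom_succ hc hl
    exact ⟨_, ⟨hm, not_exists.2 hw⟩, hrt _ _ _ (nodup_of_mem hm)⟩

theorem ncard_avoidersFrom_split (n b : ℕ) :
    (avoidersFrom (n + 1) b).ncard =
      {l ∈ avoidersFrom (n + 1) b | ∃ w, l = w ++ [n]}.ncard +
      {l ∈ avoidersFrom (n + 1) b | ¬ ∃ w, l = w ++ [n]}.ncard := by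
  have hf := avoidersFrom_finite (n + 1) b
  rw [← Set.ncard_union_eq ?_ (hf.subset (Set.sep_subset _ _)) (hf.subset (Set.sep_subset _ _))]
  · congr 1
    ext l
    simp only [Set.mem_union, Set.mem_ofPred_eq]
    tauto
  · rw [Set.disjoint_left]
    exact fun l h h' => h'.2 h.2

theorem ncard_avoidersFrom_succ_succ {n c : ℕ} (hc : c + 1 ≤ n) :
    (avoidersFrom (n + 1) (c + 1)).ncard =
      (avoidersFrom n (c + 1)).ncard + (avoidersFrom (n + 1) c).ncard := by
  rw [ncard_avoidersFrom_split, ncard_concat_mem (by omega), ncard_not_concat_mem hc]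

theorem ncard_avoidersFrom_zero (n : ℕ) : (avoidersFrom (n + 1) 0).ncard = 1 := by
  induction n with
  | zero =>
    rw [Set.ncard_eq_one]
    refine ⟨[0], Set.eq_singleton_iff_unique_mem.2 ⟨⟨by simp, ?_, [], rfl, by simp⟩, ?_⟩⟩
    · intro a b w h
      simpa using h.perm.length_eq
    · intro l hl
      simpa using hl.1
  | succ n ih =>
    have : {l ∈ avoidersFrom (n + 1 + 1) 0 | ¬ ∃ w, l = w ++ [n + 1]} = ∅ := by
      rw [Set.eq_empty_iff_forall_notMem]
      rintro l ⟨hl, hw⟩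
      obtain ⟨c, x, y, h, -⟩ :=
        exists_eq_append_of_not_concat (by omega) hl (by omega) (not_exists.1 hw)
      omega
    rw [ncard_avoidersFrom_split, ncard_concat_mem (by omega), this, ih, Set.ncard_empty]

theorem ncard_avoidersFrom_add_choose (n c : ℕ) (hc : c ≤ n) :
    (avoidersFrom (n + 1) (c + 1)).ncard + (n + c + 1).choose c = (n + c + 1).choose (c + 1) := by
  induction n generalizing c with
  | zero =>
    obtain rfl : c = 0 := by omega
    simp [avoidersFrom_eq_empty]
  | succ n ih =>
    rcases hc.eq_or_lt with rfl | hc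
    · rw [avoidersFrom_eq_empty le_rfl, Set.ncard_empty, zero_add]
      exact Nat.choose_symm_of_eq_add (by omega)
    induction c with
    | zero =>
      rw [ncard_avoidersFrom_succ_succ (by omega), ncard_avoidersFrom_zero]
      have := ih 0 (by omega)
      simp at this ⊢
      omega
    | succ c ihc =>
      have h1 := ihc (by omega) (by omega)
      have h2 := ih (c + 1) (by omega)
      rw [ncard_avoidersFrom_succ_succ (by omega)]
      have e1 : n + 1 + (c + 1) + 1 = (n + c + 2) + 1 := by omega
      have e2 : n + (c + 1) + 1 = n + c + 2 := by omega
      have e3 : n + 1 + c + 1 = n + c + 2 := by omega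
      rw [e1, Nat.choose_succ_succ, Nat.choose_succ_succ (n + c + 2) (c + 1)]
      rw [e2] at h2
      rw [e3] at h1
      simp only [Nat.succ_eq_add_one] at *
      omega

theorem ncard_avoidersFrom_self (n : ℕ) : (avoidersFrom (n + 1) n).ncard = catalan n := by
  rcases n with _ | n
  · rw [ncard_avoidersFrom_zero, catalan_zero]
  have h1 : (avoidersFrom (n + 2) (n + 1)).ncard = (avoidersFrom (n + 2) n).ncard := by
    rw [ncard_avoidersFrom_succ_succ le_rfl, avoidersFrom_eq_empty le_rfl, Set.ncard_empty,
      zero_add]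
  have h2 := ncard_avoidersFrom_add_choose (n + 1) n (by omega)
  have h3 := succ_mul_catalan_eq_centralBinom (n + 1)
  rw [Nat.centralBinom_eq_two_mul_choose, show 2 * (n + 1) = n + 1 + n + 1 by omega] at h3
  have h4 := Nat.choose_succ_right_eq (n + 1 + n + 1) n
  rw [show n + 1 + n + 1 - n = n + 2 by omega] at h4
  refine Nat.eq_of_mul_eq_mul_left (Nat.succ_pos (n + 1)) ?_
  simp only [Nat.succ_eq_add_one]
  nlinarith

/-- The word of the complement of `σ`. -/
def word {n : ℕ} (σ : Equiv.Perm (Fin n)) : List ℕ :=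
  List.ofFn fun i => ((σ i).rev : ℕ)

theorem word_length {n : ℕ} (σ : Equiv.Perm (Fin n)) : (word σ).length = n := by
  simp [word]

theorem word_injective {n : ℕ} : Function.Injective (word (n := n)) := by
  intro σ τ h
  ext i
  have := congrFun (List.ofFn_injective h) i
  simp only [Fin.val_rev] at this
  omega

theorem word_perm_range {n : ℕ} (σ : Equiv.Perm (Fin n)) : word σ ~ range n := by
  have hnd : (word σ).Nodup := by
    rw [word, nodup_ofFn]
    intro i j h
    exact σ.injective (Fin.rev_injective (Fin.ext h))
  refine (perm_ext_iff_of_nodup hnd nodup_range).2 fun a => ?_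
  rw [word, mem_ofFn, mem_range]
  constructor
  · rintro ⟨i, rfl⟩
    exact (σ i).rev.2
  · intro h
    exact ⟨σ.symm (Fin.rev ⟨a, h⟩), by simp⟩

theorem exists_word_eq {n : ℕ} {l : List ℕ} (hl : l ~ range n) :
    ∃ σ : Equiv.Perm (Fin n), word σ = l := by
  have hlen : l.length = n := by simpa using hl.length_eq
  subst hlen
  have hlt : ∀ i : Fin l.length, l[i] < l.length := fun i =>
    mem_range.1 (hl.mem_iff.1 (getElem_mem i.2))
  let f : Fin l.length → Fin l.length := fun i => Fin.rev ⟨l[i], hlt i⟩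
  have hf : Function.Injective f := by
    intro i j h
    simp only [f, Fin.rev_inj, Fin.mk.injEq] at h
    exact Fin.ext ((hl.nodup_iff.2 nodup_range).getElem_inj_iff.1 h)
  refine ⟨Equiv.ofBijective f (Finite.injective_iff_bijective.1 hf), ?_⟩
  refine List.ext_getElem (by simp [word]) fun i h1 h2 => ?_
  simp [word, f]

theorem getElem_rotate_word {n : ℕ} (σ : Equiv.Perm (Fin n)) (p : Fin n) (k : ℕ)
    (hk : k < ((word σ).rotate p).length) :
    ((word σ).rotate p)[k] = ((σ (cyc p k)).rev : ℕ) := by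
  rw [getElem_rotate]
  simp [word, cyc, add_comm]

theorem avoids_word_iff {n : ℕ} (σ : Equiv.Perm (Fin n)) :
    Avoids (word σ) ↔ ¬ Contains1423 σ := by
  have hcyc : ∀ p : Fin n, cyc p 0 = p := fun p => by
    ext
    simp [cyc, Nat.mod_eq_of_lt p.2]
  constructor
  · rintro h ⟨p, k, l, hk, hkl, hln, h1, h2, h3⟩
    have hlen : ((word σ).rotate p).length = n := by rw [length_rotate, word_length]
    have hget := getElem_rotate_word σ p
    have hrot : ((word σ).rotate p) ~r word σ := IsRotated.forall _ _
    generalize (word σ).rotate p = r at *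
    rcases r with _ | ⟨a, _ | ⟨b, w⟩⟩
    · simp at hlen
      omega
    · simp at hlen
      omega
    have hw := h a b w hrot
    obtain ⟨k, rfl⟩ := Nat.exists_eq_add_of_le' hk
    obtain ⟨l, rfl⟩ := Nat.exists_eq_add_of_le' (hk.trans hkl.le)
    simp only [length_cons] at hlen
    refine pairwise_iff_getElem.1 hw k l (by omega) (by omega) (by omega) ?_
    have g0 := hget 0 (by simp)
    have g1 := hget 1 (by simp)
    have gk := hget (k + 2) (by simp; omega)
    have gl := hget (l + 2) (by simp; omega)
    simp only [getElem_cons_zero, getElem_cons_succ] at g0 g1 gk gl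
    rw [g0, g1, gk, gl, hcyc]
    simp only [Fin.val_rev, Fin.lt_def] at *
    omega
  · intro h a b w hw
    obtain ⟨m, hm, hr⟩ := isRotated_iff_mod.1 hw.symm
    have hlen := congrArg length hr
    rw [length_rotate, word_length] at hlen
    simp only [length_cons] at hlen
    have hn : 0 < n := by omega
    rw [← rotate_mod, word_length] at hr
    have hget := getElem_rotate_word σ ⟨m % n, Nat.mod_lt _ hn⟩
    simp only [hr] at hget
    refine pairwise_iff_getElem.2 fun k l hk hl hkl hc => h ?_
    have g0 := hget 0 (by simp)
    have g1 := hget 1 (by simp)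
    have gk := hget (k + 2) (by simp; omega)
    have gl := hget (l + 2) (by simp; omega)
    simp only [getElem_cons_zero, getElem_cons_succ] at g0 g1 gk gl
    rw [g0, g1, gk, gl, hcyc] at hc
    refine ⟨⟨m % n, Nat.mod_lt _ hn⟩, k + 2, l + 2, by omega, by omega, by omega, ?_⟩
    simp only [Fin.val_rev, Fin.lt_def] at *
    omega

theorem word_mem_avoidersFrom_iff {n : ℕ} (σ : Equiv.Perm (Fin (n + 1))) :
    word σ ∈ avoidersFrom (n + 1) n ↔ σ 0 = 0 ∧ ¬ Contains1423 σ := by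
  have hw : word σ = ((σ 0).rev : ℕ) :: List.ofFn fun i : Fin n => ((σ i.succ).rev : ℕ) := by
    rw [word, List.ofFn_succ]
  rw [← avoids_word_iff]
  constructor
  · rintro ⟨-, h, t, ht, -⟩
    refine ⟨?_, h⟩
    rw [hw, cons.injEq] at ht
    have := ht.1
    ext
    simp only [Fin.val_rev] at this
    simp only [Fin.val_zero]
    omega
  · rintro ⟨h0, h⟩
    refine ⟨word_perm_range σ, h, _, by rw [hw, h0]; simp; rfl, ?_⟩
    refine pairwise_of_forall_mem_list ?_
    intro x hx y hy
    obtain ⟨i, rfl⟩ := (mem_ofFn' _ _).1 hx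
    have := (σ i.succ).rev.2
    dsimp only
    omega

end CyclicAvoidance

/-- for `n ≥ 1`, the number of cyclic permutations of length `n`
avoiding the vincular cyclic pattern 14-23 is the Catalan number `C_{n-1}`. -/
theorem stmt12 (n : ℕ) (hn : 1 ≤ n) :
    Nat.card {σ : Equiv.Perm (Fin n) //
        σ ⟨0, hn⟩ = ⟨0, hn⟩ ∧ ¬ Contains1423 σ} = catalan (n - 1) := by
  obtain ⟨n, rfl⟩ := Nat.exists_eq_add_of_le' hn
  rw [Nat.add_sub_cancel, ← CyclicAvoidance.ncard_avoidersFrom_self]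
  change Set.ncard {σ : Equiv.Perm (Fin (n + 1)) | σ 0 = 0 ∧ ¬ Contains1423 σ} = _
  refine Set.ncard_congr (fun σ _ => CyclicAvoidance.word σ) ?_ ?_ ?_
  · exact fun σ h => (CyclicAvoidance.word_mem_avoidersFrom_iff σ).2 h
  · exact fun σ τ _ _ h => CyclicAvoidance.word_injective h
  · intro l hl
    obtain ⟨σ, rfl⟩ := CyclicAvoidance.exists_word_eq hl.1
    exact ⟨σ, (CyclicAvoidance.word_mem_avoidersFrom_iff σ).1 hl, rfl⟩
end

section
/- For all n ≥ 1, the number of cyclic permutations of length n avoiding the vincular cyclic pattern [\overline{14}32] equals the Catalan number C_{n-1}. -/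
/-- Contains the vincular cyclic pattern 14-32: entries `a = σ p`, `b = σ (p+1)`
cyclically adjacent, followed by `c = σ (p+k)` and `d = σ (p+l)` with
`a < d < c < b`. -/
def Contains1432 {n : ℕ} (σ : Equiv.Perm (Fin n)) : Prop :=
  ∃ (p : Fin n) (k l : ℕ), 2 ≤ k ∧ k < l ∧ l < n ∧
    σ p < σ (cyc p l) ∧ σ (cyc p l) < σ (cyc p k) ∧ σ (cyc p k) < σ (cyc p 1)


namespace Cyc1432
open List

/-- The cyclic sequence `l` avoids the complement of the pattern 14-32: after any cyclically
adjacent `a`, `b`, the entries with values strictly between `b` and `a` appear in decreasing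
order. -/
def Av (l : List ℕ) : Prop :=
  ∀ a b t, l ~r a :: b :: t → t.Pairwise fun x y => b < x ∧ x < a → b < y ∧ y < a → y < x

theorem Av.rotated {l l' : List ℕ} (h : l ~r l') (hl : Av l) : Av l' :=
  fun a b t ht => hl a b t (h.trans ht)

theorem eq_of_isRotated_cons {α : Type*} {a : α} {p q : List α} (hp : (a :: p).Nodup)
    (h : (a :: p) ~r (a :: q)) : p = q := by
  obtain ⟨k, hk, e⟩ := isRotated_iff_mod.1 h
  rcases Nat.lt_or_ge k (a :: p).length with hk | hk
  · have h0 := congrArg (fun l => l[0]?) e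
    simp only [getElem?_rotate (by simp : 0 < (a :: p).length)] at h0
    rw [Nat.zero_add, Nat.mod_eq_of_lt hk, getElem?_eq_getElem hk] at h0
    have : k = 0 := by
      have := (hp.getElem_inj_iff (i := k) (j := 0) (hi := hk) (hj := by simp)).1 (by simpa using h0)
      exact this
    subst this
    simpa using e
  · have : k = (a :: p).length := by omega
    subst this
    rw [rotate_length] at e
    simpa using e

theorem exists_isRotated_cons {α : Type*} {b : α} {l : List α} (h : b ∈ l) :
    ∃ t, l ~r (b :: t) := by
  obtain ⟨s, t, rfl⟩ := append_of_mem h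
  exact ⟨t ++ s, by simpa using isRotated_append (l := s) (l' := b :: t)⟩

theorem exists_append_of_isRotated {α : Type*} {l l' : List α} (h : l ~r l') :
    ∃ p q, l = p ++ q ∧ l' = q ++ p := by
  obtain ⟨k, hk, rfl⟩ := isRotated_iff_mod.1 h
  exact ⟨l.take k, l.drop k, by simp, rotate_eq_drop_append_take hk⟩

theorem av_cons_cons {M b : ℕ} {u : List ℕ} (hn : (M :: b :: u).Nodup)
    (hM : ∀ x ∈ b :: u, x < M) :
    Av (M :: b :: u) ↔ Av (b :: u) ∧ u.Pairwise fun x y => b < x → b < y → y < x := by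
  constructor
  · intro h
    have hu : u.Pairwise fun x y => b < x → b < y → y < x := by
      refine (h M b u (IsRotated.refl _)).imp_of_mem ?_
      intro x y hx hy hxy h1 h2
      exact hxy ⟨h1, hM x (by simp [hx])⟩ ⟨h2, hM y (by simp [hy])⟩
    refine ⟨?_, hu⟩
    intro x y t ht
    obtain ⟨p, q, e1, e2⟩ := exists_append_of_isRotated ht
    match q, e1, e2 with
    | [], e1, e2 =>
      rw [nil_append] at e2
      rw [append_nil, ← e2] at e1
      have : M :: b :: u ~r x :: y :: (t ++ [M]) := by
        rw [e1]; simpa using isRotated_append (l := [M]) (l' := x :: y :: t)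
      exact (pairwise_append.1 (h _ _ _ this)).1
    | [z], e1, e2 =>
      simp only [singleton_append, cons.injEq] at e2
      obtain ⟨rfl, rfl⟩ := e2
      simp only [cons_append, cons.injEq] at e1
      obtain ⟨rfl, rfl⟩ := e1
      exact (pairwise_append.1 hu).1.imp fun hxy h1 h2 => hxy h1.1 h2.1
    | z :: z' :: q, e1, e2 =>
      simp only [cons_append, cons.injEq] at e2
      obtain ⟨rfl, rfl, rfl⟩ := e2
      have : M :: b :: u ~r x :: y :: (q ++ M :: p) := by
        rw [e1]; simpa using isRotated_append (l := M :: p) (l' := x :: y :: q)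
      exact (h _ _ _ this).sublist (by simp)
  · rintro ⟨h, hu⟩ x y t ht
    have hmem : ∀ z ∈ x :: y :: t, z ≤ M := by
      intro z hz
      rcases mem_cons.1 (ht.mem_iff.2 hz) with rfl | hz
      · exact le_rfl
      · exact (hM z hz).le
    have hMm : M ∈ x :: y :: t := ht.mem_iff.1 (by simp)
    rcases mem_cons.1 hMm with rfl | hMm
    · have := eq_of_isRotated_cons hn ht
      simp only [cons.injEq] at this
      obtain ⟨rfl, rfl⟩ := this
      exact hu.imp fun hxy h1 h2 => hxy h1.1 h2.1
    rcases mem_cons.1 hMm with rfl | hMm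
    · have hx := hmem x (by simp)
      exact pairwise_of_forall fun z z' h1 _ => by omega
    · obtain ⟨t1, t2, rfl⟩ := append_of_mem hMm
      have hr : M :: b :: u ~r M :: (t2 ++ x :: y :: t1) :=
        ht.trans (by simpa using isRotated_append (l := x :: y :: t1) (l' := M :: t2))
      have e := eq_of_isRotated_cons hn hr
      have h3 := h x y (t1 ++ t2)
        (e ▸ by simpa using isRotated_append (l := t2) (l' := x :: y :: t1))
      have hx := hmem x (by simp)
      rw [pairwise_append] at h3 ⊢
      refine ⟨h3.1, pairwise_cons.2 ⟨fun z _ h1 _ => by omega, h3.2.1⟩, ?_⟩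
      intro z hz v hv
      rcases mem_cons.1 hv with rfl | hv
      · intro _ _; omega
      · exact h3.2.2 z hz v hv

/-- The entries of `w` that are at least `c` appear in decreasing order. -/
def DecrFrom (c : ℕ) (w : List ℕ) : Prop := w.Pairwise fun x y => c ≤ x → c ≤ y → y < x

theorem DecrFrom.mono {c d : ℕ} {w : List ℕ} (h : DecrFrom c w) (hcd : c ≤ d) : DecrFrom d w :=
  Pairwise.imp (fun hxy h1 h2 => hxy (hcd.trans h1) (hcd.trans h2)) h

theorem decrFrom_of_forall_lt {c : ℕ} {w : List ℕ} (h : ∀ x ∈ w, x < c) : DecrFrom c w :=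
  Pairwise.imp_of_mem (R := fun _ _ => True)
    (fun hx _ _ h1 => absurd (h _ hx) (by omega)) (pairwise_of_forall (by simp))

/-- The least `c` such that the entries of `w` that are at least `c` are decreasing. -/
noncomputable def lo (w : List ℕ) : ℕ := sInf {c | DecrFrom c w}

theorem lo_le_iff {c : ℕ} {w : List ℕ} : lo w ≤ c ↔ DecrFrom c w := by
  constructor
  · intro h
    refine DecrFrom.mono (Nat.sInf_mem (s := {c | DecrFrom c w}) ?_) h
    exact ⟨w.sum + 1, decrFrom_of_forall_lt fun x hx => Nat.lt_succ_of_le (le_sum_of_mem hx)⟩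
  · exact fun h => Nat.sInf_le h

theorem pairwise_iff_decrFrom {n b : ℕ} {w u : List ℕ} (hn : (n :: w).Nodup)
    (hw : ∀ x ∈ w, x < n) (h : n :: w ~r b :: u) :
    (u.Pairwise fun x y => b < x → b < y → y < x) ↔ DecrFrom b w := by
  have hb : b ∈ n :: w := h.mem_iff.2 (by simp)
  rcases mem_cons.1 hb with rfl | hb
  · obtain rfl := eq_of_isRotated_cons hn h
    refine ⟨fun _ => decrFrom_of_forall_lt hw, fun _ => ?_⟩
    refine Pairwise.imp_of_mem (R := fun _ _ => True)
      (fun hx _ _ h1 => absurd (hw _ hx) (by omega)) (pairwise_of_forall (by simp))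
  · obtain ⟨x, y, rfl⟩ := append_of_mem hb
    have hr : n :: (x ++ b :: y) ~r b :: (y ++ n :: x) := by
      simpa using isRotated_append (l := n :: x) (l' := b :: y)
    obtain rfl := eq_of_isRotated_cons (hr.nodup_iff.1 hn) (hr.symm.trans h)
    have hbn := hw b hb
    simp only [DecrFrom, pairwise_append, pairwise_cons, mem_cons, nodup_cons, mem_append,
      nodup_append] at *
    constructor
    · rintro ⟨h1, ⟨h2, h3⟩, h4⟩
      have hy : ∀ a ∈ y, a < b := by
        intro a ha
        have h5 := h4 a ha n (Or.inl rfl)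
        have h6 := hw a (by simp [ha])
        have h7 : b ≠ a := fun e => hn.2.2.1.1 (e ▸ ha)
        omega
      have hx : ∀ a ∈ x, a ≠ b := fun a ha => hn.2.2.2 a ha b (Or.inl rfl)
      refine ⟨h3.imp_of_mem ?_, ⟨fun a ha _ h => absurd (hy a ha) (by omega), ?_⟩, ?_⟩
      · intro a c ha hc hac h5 h6
        have := hx a ha
        have := hx c hc
        exact hac (by omega) (by omega)
      · exact decrFrom_of_forall_lt hy
      · intro a ha c hc h5 h6
        have := hx a ha
        rcases hc with rfl | hc
        · omega
        · have := hy c hc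
          omega
    · rintro ⟨h1, ⟨h2, h3⟩, h4⟩
      have hy : ∀ a ∈ y, a < b := by
        intro a ha
        have := h2 a ha
        omega
      refine ⟨?_, ⟨fun a ha _ _ => hw a (by simp [ha]), ?_⟩, ?_⟩
      · exact (decrFrom_of_forall_lt hy).imp fun hac h5 h6 => hac (by omega) (by omega)
      · exact h1.imp fun hac h5 h6 => hac (by omega) (by omega)
      · intro a ha c hc h5
        have := hy a ha
        omega

theorem lo_cons {n : ℕ} {w : List ℕ} (hw : ∀ x ∈ w, x < n) : lo (n :: w) = lo w := by
  refine eq_of_forall_ge_iff fun c => ?_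
  rw [lo_le_iff, lo_le_iff, DecrFrom, pairwise_cons]
  exact ⟨fun h => h.2, fun h => ⟨fun x hx _ _ => hw x hx, h⟩⟩

theorem lo_of_isRotated {n b : ℕ} {w u : List ℕ} (hn : (n :: w).Nodup)
    (hw : ∀ x ∈ w, x < n) (h : n :: w ~r b :: u) (hb : b < n) (hd : DecrFrom b w) :
    lo (b :: u) = b + 1 := by
  have hu := (pairwise_iff_decrFrom hn hw h).2 hd
  have hnu : n ∈ u := by
    have : n ∈ b :: u := h.mem_iff.1 (by simp)
    simpa [hb.ne'] using this
  refine eq_of_forall_ge_iff fun c => ?_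
  rw [lo_le_iff, DecrFrom, pairwise_cons]
  constructor
  · intro hc
    by_contra hlt
    have := hc.1 n hnu (by omega) (by omega)
    omega
  · intro hc
    exact ⟨fun x hx h1 => by omega,
      hu.imp fun hxy h1 h2 => hxy (by omega) (by omega)⟩

/-- The coefficient of `X ^ m` in the `k`-th power of the Catalan generating function. -/
noncomputable def ballot (m k : ℕ) : ℕ :=
  PowerSeries.coeff m (PowerSeries.catalanSeries ^ k)

theorem ballot_one (m : ℕ) : ballot m 1 = catalan m := by simp [ballot]

theorem ballot_zero (k : ℕ) : ballot 0 k = 1 := by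
  simp [ballot]

theorem ballot_succ_succ (m k : ℕ) :
    ballot (m + 1) (k + 1) = ballot (m + 1) k + ballot m (k + 2) := by
  have : (PowerSeries.catalanSeries ^ (k + 1) : PowerSeries ℕ) =
      PowerSeries.catalanSeries ^ k + PowerSeries.catalanSeries ^ (k + 2) * PowerSeries.X := by
    calc (PowerSeries.catalanSeries ^ (k + 1) : PowerSeries ℕ)
        = PowerSeries.catalanSeries ^ k *
            (PowerSeries.catalanSeries ^ 2 * PowerSeries.X + 1) := by
          rw [PowerSeries.catalanSeries_sq_mul_X_add_one, pow_succ]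
      _ = _ := by ring
  rw [ballot, this, map_add, PowerSeries.coeff_succ_mul_X, ballot, ballot]

theorem sum_range_ballot (m k : ℕ) :
    ∑ j ∈ Finset.range k, ballot m (j + 2) = ballot (m + 1) k := by
  induction k with
  | zero => simp [ballot, PowerSeries.coeff_one]
  | succ k ih => rw [Finset.sum_range_succ, ih, ballot_succ_succ]

theorem sum_Icc_ballot (m : ℕ) {n l : ℕ} (h : l ≤ n) :
    ∑ b ∈ Finset.Icc l n, ballot m (n + 2 - if b = n then l else b + 1) =
      ballot (m + 1) (n + 1 - l) := by
  obtain ⟨k, rfl⟩ := Nat.exists_eq_add_of_le h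
  rw [show l + k + 1 - l = k + 1 by omega, ← sum_range_ballot, Finset.sum_range_succ,
    ← Finset.Ico_add_one_right_eq_Icc, Finset.sum_Ico_eq_sum_range,
    show l + k + 1 - l = k + 1 by omega, Finset.sum_range_succ, if_pos rfl,
    show l + k + 2 - l = k + 2 by omega]
  congr 1
  rw [← Finset.sum_range_reflect]
  refine Finset.sum_congr rfl fun j hj => ?_
  rw [Finset.mem_range] at hj
  rw [if_neg (by omega)]
  congr 1
  omega

open Classical in
/-- The arrangements `w` of `0, …, n - 1` for which the cyclic sequence `n :: w` is avoiding. -/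
noncomputable def avoiders (n : ℕ) : Finset (List ℕ) :=
  {w ∈ (List.range n).permutations.toFinset | Av (n :: w)}

theorem mem_avoiders {n : ℕ} {w : List ℕ} : w ∈ avoiders n ↔ w ~ List.range n ∧ Av (n :: w) := by
  simp [avoiders]

theorem lt_of_perm_range {n : ℕ} {w : List ℕ} (h : w ~ List.range n) : ∀ x ∈ w, x < n :=
  fun _ hx => List.mem_range.1 (h.mem_iff.1 hx)

theorem cons_perm_range {n : ℕ} {w : List ℕ} : n :: w ~ List.range (n + 1) ↔ w ~ List.range n := by
  have : List.range (n + 1) ~ n :: List.range n := by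
    rw [List.range_succ]; exact perm_append_singleton _ _
  rw [this.congr_right, perm_cons]

theorem nodup_of_perm_range {n : ℕ} {w : List ℕ} (h : w ~ List.range n) : w.Nodup :=
  h.nodup_iff.2 List.nodup_range

theorem cons_mem_avoiders_succ {n b : ℕ} {w u : List ℕ} (h : n :: w ~r b :: u) :
    b :: u ∈ avoiders (n + 1) ↔ w ∈ avoiders n ∧ b ∈ Finset.Icc (lo w) n := by
  rw [mem_avoiders, mem_avoiders, ← h.perm.congr_left, cons_perm_range, Finset.mem_Icc, lo_le_iff,
    and_assoc]
  refine and_congr_right fun hw => ?_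
  have hn := nodup_of_perm_range (cons_perm_range.2 hw)
  have hlt := lt_of_perm_range hw
  have hlt' : ∀ x ∈ b :: u, x < n + 1 :=
    lt_of_perm_range (h.perm.symm.trans (cons_perm_range.2 hw))
  have hn' : ((n + 1) :: b :: u).Nodup :=
    nodup_cons.2 ⟨fun hm => (hlt' _ hm).false, h.nodup_iff.1 hn⟩
  rw [av_cons_cons hn' hlt', pairwise_iff_decrFrom hn hlt h]
  have hb := hlt' b (by simp)
  exact ⟨fun h' => ⟨h'.1.rotated h.symm, h'.2, by omega⟩,
    fun h' => ⟨h'.1.rotated h, h'.2.1⟩⟩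

theorem exists_rotation (n b : ℕ) (w : List ℕ) :
    ∃ u, b ∈ n :: w → n :: w ~r b :: u := by
  by_cases h : b ∈ n :: w
  · obtain ⟨u, hu⟩ := exists_isRotated_cons h
    exact ⟨u, fun _ => hu⟩
  · exact ⟨[], fun h' => absurd h' h⟩

theorem sum_avoiders_succ (n : ℕ) (F : List ℕ → ℕ) (G : List ℕ → ℕ → ℕ)
    (hFG : ∀ w u b, w ∈ avoiders n → b ∈ Finset.Icc (lo w) n → n :: w ~r b :: u →
      F (b :: u) = G w b) :
    ∑ w ∈ avoiders (n + 1), F w = ∑ w ∈ avoiders n, ∑ b ∈ Finset.Icc (lo w) n, G w b := by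
  choose tl htl using exists_rotation n
  have hmem : ∀ {w b}, w ∈ avoiders n → b ∈ Finset.Icc (lo w) n → n :: w ~r b :: tl b w := by
    intro w b hw hb
    refine htl b w ((cons_perm_range.2 (mem_avoiders.1 hw).1).mem_iff.2 ?_)
    have := (Finset.mem_Icc.1 hb).2
    exact List.mem_range.2 (by omega)
  rw [Finset.sum_sigma']
  symm
  refine Finset.sum_bij (fun p _ => p.2 :: tl p.2 p.1) ?_ ?_ ?_ ?_
  · rintro ⟨w, b⟩ h
    obtain ⟨hw, hb⟩ := Finset.mem_sigma.1 h
    exact (cons_mem_avoiders_succ (hmem hw hb)).2 ⟨hw, hb⟩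
  · rintro ⟨w, b⟩ h ⟨w', b'⟩ h' e
    obtain ⟨hw, hb⟩ := Finset.mem_sigma.1 h
    obtain ⟨hw', hb'⟩ := Finset.mem_sigma.1 h'
    have h1 := hmem hw hb
    have h2 := hmem hw' hb'
    dsimp only at e h1 h2
    rw [← e] at h2
    have hn := nodup_of_perm_range (cons_perm_range.2 (mem_avoiders.1 hw).1)
    obtain rfl := eq_of_isRotated_cons hn (h1.trans h2.symm)
    rw [(cons.inj e).1]
  · intro v hv
    have hp := (mem_avoiders.1 hv).1
    obtain ⟨b, u, rfl⟩ : ∃ b u, v = b :: u := by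
      refine exists_cons_of_ne_nil ?_
      rintro rfl
      simpa using hp.length_eq
    obtain ⟨w, hw⟩ := exists_isRotated_cons (hp.mem_iff.2 (List.mem_range.2 n.lt_succ_self))
    obtain ⟨h1, h2⟩ := (cons_mem_avoiders_succ hw.symm).1 hv
    refine ⟨⟨w, b⟩, Finset.mem_sigma.2 ⟨h1, h2⟩, ?_⟩
    have := eq_of_isRotated_cons (nodup_of_perm_range hp) (hw.trans (hmem h1 h2))
    simp [← this]
  · rintro ⟨w, b⟩ h
    obtain ⟨hw, hb⟩ := Finset.mem_sigma.1 h
    exact (hFG w _ b hw hb (hmem hw hb)).symm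

theorem sum_ballot_avoiders (n m : ℕ) :
    ∑ w ∈ avoiders n, ballot m (n + 1 - lo w) = catalan (n + m) := by
  induction n generalizing m with
  | zero =>
    have h0 : avoiders 0 = {[]} := by
      ext w
      rw [mem_avoiders, Finset.mem_singleton, List.range_zero, perm_nil]
      refine ⟨fun h => h.1, fun h => ⟨h, ?_⟩⟩
      subst h
      intro a b t ht
      have := ht.perm.length_eq
      simp at this
    have h1 : lo [] ≤ 0 := lo_le_iff.2 Pairwise.nil
    rw [h0, Finset.sum_singleton, show 0 + 1 - lo [] = 1 by omega, ballot_one, Nat.zero_add]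
  | succ n ih =>
    rw [sum_avoiders_succ n _ fun w b => ballot m (n + 2 - if b = n then lo w else b + 1)]
    · rw [show n + 1 + m = n + (m + 1) by omega, ← ih]
      refine Finset.sum_congr rfl fun w hw => sum_Icc_ballot m ?_
      exact lo_le_iff.2 (decrFrom_of_forall_lt (lt_of_perm_range (mem_avoiders.1 hw).1))
    · intro w u b hw hb h
      have hp := (mem_avoiders.1 hw).1
      have hn := nodup_of_perm_range (cons_perm_range.2 hp)
      have hlt := lt_of_perm_range hp
      rw [Finset.mem_Icc, lo_le_iff] at hb
      split_ifs with hbn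
      · subst hbn
        rw [← eq_of_isRotated_cons hn h, lo_cons hlt]
      · rw [lo_of_isRotated hn hlt h (by omega) hb.1]

theorem card_avoiders (n : ℕ) : (avoiders n).card = catalan n := by
  simpa [ballot_zero] using sum_ballot_avoiders n 0

/-- The values of `σ` in one-line notation, each `v` replaced by `N - v`. -/
def complement {N : ℕ} (σ : Equiv.Perm (Fin (N + 1))) : List ℕ := List.ofFn fun i => N - (σ i).val

theorem complement_perm {N : ℕ} (σ : Equiv.Perm (Fin (N + 1))) :
    complement σ ~ List.range (N + 1) := by
  refine (perm_ext_iff_of_nodup ?_ List.nodup_range).2 fun x => ?_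
  · refine nodup_ofFn.2 fun i j h => σ.injective (Fin.ext ?_)
    have := (σ i).isLt
    have := (σ j).isLt
    omega
  · rw [complement, mem_ofFn, List.mem_range]
    constructor
    · rintro ⟨i, rfl⟩
      omega
    · intro hx
      refine ⟨σ.symm ⟨N - x, by omega⟩, ?_⟩
      simp only [Equiv.apply_symm_apply]
      omega

theorem getElem_rotate_complement {N : ℕ} (σ : Equiv.Perm (Fin (N + 1))) (p : Fin (N + 1)) (k : ℕ)
    (h : k < ((complement σ).rotate p).length) :
    ((complement σ).rotate p)[k] = N - (σ (cyc p k)).val := by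
  rw [getElem_rotate]
  simp only [complement, cyc, length_ofFn, List.getElem_ofFn, Nat.add_comm]

theorem av_complement_iff {N : ℕ} (σ : Equiv.Perm (Fin (N + 1))) :
    Av (complement σ) ↔ ¬ Contains1432 σ := by
  have hlen : (complement σ).length = N + 1 := length_ofFn
  have hc0 : ∀ p : Fin (N + 1), cyc p 0 = p := fun p =>
    Fin.ext (Nat.mod_eq_of_lt p.isLt)
  constructor
  · rintro h ⟨p, k, l, hk, hkl, hl, h1, h2, h3⟩
    have hlr : ((complement σ).rotate p).length = N + 1 := by rw [length_rotate, hlen]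
    have hget := getElem_rotate_complement σ p
    have hr : complement σ ~r (complement σ).rotate p := ⟨p, rfl⟩
    generalize (complement σ).rotate p = v at hlr hget hr
    match v, hlr, hget, hr with
    | [], hlr, _, _ => simp at hlr
    | [_], hlr, _, _ => simp at hlr; omega
    | a :: b :: t, hlr, hget, hr =>
      have hlt : t.length + 2 = N + 1 := hlr
      have ha := hget 0 (by simp)
      have hb := hget 1 (by simp)
      obtain ⟨k, rfl⟩ := Nat.exists_eq_add_of_le' hk
      obtain ⟨l, rfl⟩ := Nat.exists_eq_add_of_le' (hk.trans hkl.le)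
      have hc := hget (k + 2) (by rw [hlr]; omega)
      have hd := hget (l + 2) (by rw [hlr]; omega)
      have := pairwise_iff_getElem.1 (h a b t hr) k l (by omega) (by omega) (by omega)
      simp only [getElem_cons_zero, getElem_cons_succ, hc0] at ha hb hc hd
      rw [hc, hd, ha, hb] at this
      rw [Fin.lt_def] at h1 h2 h3
      have := (σ (cyc p 1)).isLt
      omega
  · intro h a b t hr
    obtain ⟨p, hp, e⟩ := isRotated_iff_mod.1 hr
    obtain ⟨p, e⟩ : ∃ p : Fin (N + 1), (complement σ).rotate p = a :: b :: t := by
      refine ⟨⟨p % (N + 1), Nat.mod_lt _ N.succ_pos⟩, ?_⟩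
      rw [← e]
      simpa only [hlen] using rotate_mod (complement σ) p
    have hlr : (a :: b :: t).length = N + 1 := by rw [← e, length_rotate, hlen]
    have hlt : t.length + 2 = N + 1 := hlr
    have hget := getElem_rotate_complement σ p
    have hn : (a :: b :: t).Nodup :=
      hr.nodup_iff.1 (nodup_of_perm_range (complement_perm σ))
    simp only [e] at hget
    have ha := hget 0 (by simp)
    have hb := hget 1 (by simp)
    refine pairwise_iff_getElem.2 fun k l hk hl hkl h1 h2 => ?_
    have hc := hget (k + 2) (by simpa using hk)
    have hd := hget (l + 2) (by simpa using hl)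
    simp only [getElem_cons_zero, getElem_cons_succ, hc0] at ha hb hc hd
    by_contra hlt'
    have hne : t[k] ≠ t[l] := fun he =>
      hkl.ne ((nodup_cons.1 (nodup_cons.1 hn).2).2.getElem_inj_iff.1 he)
    refine h ⟨p, k + 2, l + 2, by omega, by omega, by omega, ?_, ?_, ?_⟩ <;> rw [Fin.lt_def] <;>
      omega

theorem complement_injective (N : ℕ) : Function.Injective (complement (N := N)) := by
  intro σ τ h
  ext i
  have := congrFun (ofFn_injective h) i
  have := (σ i).isLt
  have := (τ i).isLt
  omega

theorem exists_complement_eq {N : ℕ} {l : List ℕ} (h : l ~ List.range (N + 1)) :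
    ∃ σ : Equiv.Perm (Fin (N + 1)), complement σ = l := by
  have hlen : l.length = N + 1 := by simpa using h.length_eq
  have hlt := lt_of_perm_range h
  let f : Fin (N + 1) → Fin (N + 1) := fun i =>
    ⟨N - l[i.val]'(by omega), by omega⟩
  have hf : Function.Injective f := by
    intro i j hij
    have h1 := hlt _ (getElem_mem (l := l) (n := i.val) (by omega))
    have h2 := hlt _ (getElem_mem (l := l) (n := j.val) (by omega))
    have h3 := congrArg Fin.val hij
    dsimp only [f] at h3
    exact Fin.ext ((nodup_of_perm_range h).getElem_inj_iff.1 (by omega : l[i.val] = l[j.val]))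
  refine ⟨Equiv.ofBijective f (Finite.injective_iff_bijective.1 hf), ?_⟩
  refine ext_getElem (by simp [complement, hlen]) fun i h1 h2 => ?_
  have := hlt _ (getElem_mem h2)
  simp only [complement, List.getElem_ofFn, Equiv.ofBijective_apply, f]
  omega

theorem complement_eq_cons_iff {N : ℕ} (σ : Equiv.Perm (Fin (N + 1))) :
    σ 0 = 0 ↔ ∃ w, complement σ = N :: w := by
  rw [complement, ofFn_succ]
  have := (σ 0).isLt
  constructor
  · intro h
    exact ⟨_, by rw [h]; rfl⟩
  · rintro ⟨w, hw⟩
    have := (cons.inj hw).1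
    refine Fin.ext ?_
    rw [Fin.val_zero]
    omega

end Cyc1432

/-- for `n ≥ 1`, the number of cyclic permutations of length `n`
avoiding the vincular cyclic pattern 14-32 is the Catalan number `C_{n-1}`. -/
theorem stmt13 (n : ℕ) (hn : 1 ≤ n) :
    Nat.card {σ : Equiv.Perm (Fin n) //
        σ ⟨0, hn⟩ = ⟨0, hn⟩ ∧ ¬ Contains1432 σ} = catalan (n - 1) := by
  obtain ⟨N, rfl⟩ := Nat.exists_eq_add_of_le' hn
  rw [Nat.add_sub_cancel, ← Cyc1432.card_avoiders, ← Nat.card_eq_finsetCard]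
  have hmem : ∀ σ : Equiv.Perm (Fin (N + 1)), σ 0 = 0 ∧ ¬ Contains1432 σ →
      ∃ w ∈ Cyc1432.avoiders N, Cyc1432.complement σ = N :: w := by
    rintro σ ⟨h0, hσ⟩
    obtain ⟨w, hw⟩ := (Cyc1432.complement_eq_cons_iff σ).1 h0
    refine ⟨w, Cyc1432.mem_avoiders.2 ⟨?_, ?_⟩, hw⟩
    · exact Cyc1432.cons_perm_range.1 (hw ▸ Cyc1432.complement_perm σ)
    · exact hw ▸ (Cyc1432.av_complement_iff σ).2 hσ
  choose f hf hfc using hmem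
  refine Nat.card_eq_of_bijective (fun σ => ⟨f σ.1 σ.2, hf σ.1 σ.2⟩) ⟨?_, ?_⟩
  · intro σ τ h
    refine Subtype.ext (Cyc1432.complement_injective N ?_)
    exact (hfc σ.1 σ.2).trans ((congrArg (N :: ·) (Subtype.ext_iff.1 h)).trans (hfc τ.1 τ.2).symm)
  · rintro ⟨w, hw⟩
    obtain ⟨h1, h2⟩ := Cyc1432.mem_avoiders.1 hw
    obtain ⟨σ, hσ⟩ := Cyc1432.exists_complement_eq (Cyc1432.cons_perm_range.2 h1)
    have h : σ 0 = 0 ∧ ¬ Contains1432 σ :=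
      ⟨(Cyc1432.complement_eq_cons_iff σ).2 ⟨w, hσ⟩,
        (Cyc1432.av_complement_iff σ).1 (hσ ▸ h2)⟩
    exact ⟨⟨σ, h⟩, Subtype.ext (List.cons.inj ((hfc σ h).symm.trans hσ)).2⟩
end

section
/- For all n ≥ 2, the number of cyclic permutations of length n avoiding the vincular cyclic pattern [\overline{23}14] equals \sum_{i=0}^{n-2} binom(n-2, i)·A_i, where A_i is the number of strongly monotone set partitions of {1,…,i}. -/
/-- Contains the vincular cyclic pattern 23-14: entries `a = σ p`, `b = σ (p+1)`
cyclically adjacent, followed by `c = σ (p+k)` and `d = σ (p+l)` with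
`c < a < b < d`. -/
def Contains2314 {n : ℕ} (σ : Equiv.Perm (Fin n)) : Prop :=
  ∃ (p : Fin n) (k l : ℕ), 2 ≤ k ∧ k < l ∧ l < n ∧
    σ (cyc p k) < σ p ∧ σ p < σ (cyc p 1) ∧ σ (cyc p 1) < σ (cyc p l)

/-- A partition of `Fin i` is strongly monotone if whenever one block has a
smaller minimum than another, it also has a smaller maximum. -/
def StronglyMonotonePartition {i : ℕ}
    (P : Finpartition (Finset.univ : Finset (Fin i))) : Prop :=
  ∀ B ∈ P.parts, ∀ C ∈ P.parts, ∀ (hB : B.Nonempty) (hC : C.Nonempty),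
    B.min' hB < C.min' hC → B.max' hB < C.max' hC

/-- `A i`: the number of strongly monotone partitions of a set of size `i`. -/
noncomputable def smCount (i : ℕ) : ℕ :=
  Nat.card {P : Finpartition (Finset.univ : Finset (Fin i)) //
    StronglyMonotonePartition P}

/-- `f` sends each element to the maximum of its block, for some partition into blocks. -/
structure IsBlockMax {α : Type*} [LinearOrder α] (f : α → α) : Prop where
  le_apply : ∀ x, x ≤ f x
  apply_apply : ∀ x, f (f x) = f x

/-- The minimum of the block with maximum `b` is below the minimum of the block with maximum
`c`. -/
def BlockMinLT {α : Type*} [LinearOrder α] (f : α → α) (b c : α) : Prop :=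
  ∃ x, f x = b ∧ ∀ y, f y = c → x < y

/-- The partition with block maxima `f` is strongly monotone. -/
structure IsStronglyMonotone {α : Type*} [LinearOrder α] (f : α → α) : Prop
    extends IsBlockMax f where
  blockMinLT : ∀ b c, f b = b → f c = c → b < c → BlockMinLT f b c

/-- `{0}` is a block, and the blocks other than that of the last element form a strongly monotone
partition. -/
structure IsStronglyMonotoneBelowLast {m : ℕ} (f : Fin (m + 2) → Fin (m + 2)) : Prop
    extends IsBlockMax f where
  apply_zero : f 0 = 0
  blockMinLT : ∀ b c, f b = b → f c = c → b < c → c < Fin.last _ → BlockMinLT f b c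

/-- Positions `p`, `p + 1` at which `σ` ascends are preceded only by values below `σ (p + 1)`. -/
def AscentTopsAreRecords {m : ℕ} (σ : Equiv.Perm (Fin (m + 1))) : Prop :=
  ∀ (p : Fin m) (q : Fin (m + 1)), q < p.castSucc → σ p.castSucc < σ p.succ → σ q < σ p.succ

/-- Positions `p`, `p + 1` at which `σ` ascends are not followed by a value below `σ p` and then a
value above `σ (p + 1)`. -/
def AvoidsAfterAscents {m : ℕ} (σ : Equiv.Perm (Fin (m + 1))) : Prop :=
  ∀ (p : Fin m) (s t : Fin (m + 1)), p.succ < s → s < t → σ p.castSucc < σ p.succ →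
    σ s < σ p.castSucc → ¬ σ p.succ < σ t

lemma cyc_eq_of_val_eq {n : ℕ} {p q : Fin n} {k : ℕ} (h : p.val + k = q.val) : cyc p k = q := by
  ext
  simp only [cyc, h, Nat.mod_eq_of_lt q.isLt]

lemma cyc_eq_of_val_add_eq {n : ℕ} {p q : Fin n} {k : ℕ} (h : p.val + k = q.val + n) :
    cyc p k = q := by
  ext
  simp only [cyc, h, Nat.add_mod_right, Nat.mod_eq_of_lt q.isLt]

lemma not_contains2314_iff {m : ℕ} {σ : Equiv.Perm (Fin (m + 1))} (h0 : σ 0 = 0) :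
    ¬ Contains2314 σ ↔ AscentTopsAreRecords σ ∧ AvoidsAfterAscents σ := by
  constructor
  · intro h
    refine ⟨fun p q hq hp ↦ ?_, fun p s t hs hst hp hsp hpt ↦ ?_⟩
    · by_contra! hlt
      have hne : σ p.succ ≠ σ q := fun e ↦ by
        have := congrArg Fin.val (σ.injective e)
        simp only [Fin.lt_def, Fin.val_castSucc, Fin.val_succ] at hq this
        omega
      have hq0 : q ≠ 0 := by
        rintro rfl
        rw [h0, Fin.le_zero_iff] at hlt
        exact hne (by rw [hlt, h0])
      have hq0' : 0 < q.val := Fin.pos_iff_ne_zero.2 hq0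
      have hqp : q.val < p.val := hq
      have hpm := p.isLt
      have hp0 : p.castSucc ≠ 0 := by
        intro e
        have := congrArg Fin.val e
        simp at this
        omega
      refine h ⟨p.castSucc, m + 1 - p.val, m + 1 - p.val + q.val, by omega, by omega, by omega, ?_⟩
      rw [cyc_eq_of_val_add_eq (q := (0 : Fin (m + 1))) (by simp; omega),
        cyc_eq_of_val_eq (q := p.succ) (by simp),
        cyc_eq_of_val_add_eq (q := q) (by simp; omega), h0]
      refine ⟨?_, hp, lt_of_le_of_ne hlt hne⟩
      rw [Fin.pos_iff_ne_zero]
      exact fun e ↦ hp0 (σ.injective (e.trans h0.symm))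
    · have h1 : p.val + 1 < s.val := hs
      have h2 : s.val < t.val := hst
      refine h ⟨p.castSucc, s.val - p.val, t.val - p.val, by omega, by omega, by omega, ?_⟩
      rw [cyc_eq_of_val_eq (q := s) (by simp; omega), cyc_eq_of_val_eq (q := p.succ) (by simp),
        cyc_eq_of_val_eq (q := t) (by simp; omega)]
      exact ⟨hsp, hp, hpt⟩
  · rintro ⟨h1, h2⟩ ⟨p, k, l, hk, hkl, hl, ha, hb, hc⟩
    induction p using Fin.lastCases with
    | last =>
      rw [cyc_eq_of_val_add_eq (q := (0 : Fin (m + 1))) (by simp), h0] at hb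
      exact absurd hb (Fin.not_lt_zero _)
    | cast p =>
      rw [cyc_eq_of_val_eq (q := p.succ) (by simp)] at hb hc
      by_cases hpl : p.val + l < m + 1
      · rw [cyc_eq_of_val_eq (q := ⟨p.val + l, hpl⟩) (by simp)] at hc
        rw [cyc_eq_of_val_eq (q := ⟨p.val + k, by omega⟩) (by simp)] at ha
        refine h2 p _ _ ?_ ?_ hb ha hc <;> simp [Fin.lt_def] <;> omega
      · rw [cyc_eq_of_val_add_eq (q := ⟨p.val + l - (m + 1), by omega⟩) (by simp; omega)] at hc
        refine lt_asymm hc (h1 p _ ?_ hb)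
        simp [Fin.lt_def]; omega

/-- The running maximum of `σ`, as a function of the value rather than the position. -/
def recordMax {m : ℕ} (σ : Equiv.Perm (Fin (m + 1))) (x : Fin (m + 1)) : Fin (m + 1) :=
  partialSups σ (σ.symm x)

lemma recordMax_apply {m : ℕ} (σ : Equiv.Perm (Fin (m + 1))) (p : Fin (m + 1)) :
    recordMax σ (σ p) = partialSups σ p := by simp [recordMax]

lemma isBlockMax_recordMax {m : ℕ} (σ : Equiv.Perm (Fin (m + 1))) : IsBlockMax (recordMax σ) where
  le_apply x := by
    simpa [recordMax] using le_partialSups (⇑σ) (σ.symm x)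
  apply_apply x := by
    obtain ⟨j, hj, hx⟩ := exists_partialSups_eq σ (σ.symm x)
    rw [show recordMax σ x = σ j from hx, recordMax_apply]
    exact le_antisymm (hx ▸ (partialSups σ).monotone hj) (le_partialSups (⇑σ) j)

lemma isStronglyMonotoneBelowLast_recordMax {m : ℕ} {σ : Equiv.Perm (Fin (m + 2))} (h0 : σ 0 = 0)
    (h2 : AvoidsAfterAscents σ) : IsStronglyMonotoneBelowLast (recordMax σ) where
  toIsBlockMax := isBlockMax_recordMax σ
  apply_zero := by
    rw [recordMax, ← Fin.le_zero_iff, partialSups_le_iff]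
    intro j hj
    rw [σ.symm_apply_eq.2 h0.symm, Fin.le_zero_iff] at hj
    rw [hj, h0]
  blockMinLT b c hb hc hbc hcl := by
    obtain ⟨pb, rfl⟩ := σ.surjective b
    obtain ⟨pc, rfl⟩ := σ.surjective c
    rw [recordMax_apply] at hb hc
    have hmono := (partialSups (⇑σ)).monotone
    obtain ⟨p, hp, hmax⟩ := (Finset.univ.filter fun p ↦ partialSups σ p = σ pb).exists_maximal
      ⟨pb, by simpa using hb⟩
    simp only [Finset.mem_filter, Finset.mem_univ, true_and] at hp hmax
    have hlt : ∀ s, partialSups σ s = σ pc → p < s := by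
      intro s hs
      by_contra! hle
      have := hmono hle
      rw [hs, hp] at this
      exact absurd hbc this.not_gt
    induction p using Fin.lastCases with
    | last => exact absurd (hlt pc hc) (Fin.le_last _).not_gt
    | cast p =>
    have hle : ∀ s, partialSups σ s = σ pc → p.succ ≤ s := fun s hs ↦ hlt s hs
    have hne : partialSups σ p.succ ≠ σ pb := fun e ↦
      absurd (hmax e p.castSucc_lt_succ.le) p.castSucc_lt_succ.not_ge
    have hrec : σ pb < σ p.succ := by
      have h1 := hmono p.castSucc_lt_succ.le
      rw [hp] at h1
      by_contra! hle'
      refine hne (le_antisymm (partialSups_le _ _ _ fun j hj ↦ ?_) h1)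
      rcases hj.eq_or_lt with rfl | hj
      · exact hle'
      · rw [← hp]; exact le_partialSups_of_le _ (Fin.le_castSucc_iff.2 hj)
    have hasc : σ p.castSucc < σ p.succ := by
      refine lt_of_le_of_lt ?_ hrec
      rw [← hp]; exact le_partialSups (⇑σ) _
    refine ⟨σ p.castSucc, by rw [recordMax_apply, hp], fun y hy ↦ ?_⟩
    obtain ⟨s, rfl⟩ := σ.surjective y
    rw [recordMax_apply] at hy
    have hs := hle s hy
    rcases hs.eq_or_lt with rfl | hs
    · exact hasc
    obtain ⟨t, ht⟩ := σ.surjective (Fin.last _)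
    by_contra! hys
    have hys' : σ s < σ p.castSucc := lt_of_le_of_ne hys fun e ↦ by
      have := σ.injective e
      subst this
      exact absurd hs p.castSucc_lt_succ.not_gt
    refine h2 p s t hs ?_ hasc hys' ?_
    · by_contra! hts
      have := le_partialSups_of_le σ hts
      rw [ht, hy] at this
      exact absurd hcl this.not_gt
    · rw [ht]
      refine lt_of_le_of_lt ?_ hcl
      rw [← hc]
      exact le_partialSups_of_le σ (hle pc hc)

/-- Orders elements by the maximum of their block, and decreasingly within a block. -/
def blockKey {α : Type*} (f : α → α) (x : α) : α ×ₗ αᵒᵈ := toLex (f x, OrderDual.toDual x)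

lemma blockKey_lt {α : Type*} [LinearOrder α] {f : α → α} {x y : α} :
    blockKey f x < blockKey f y ↔ f x < f y ∨ f x = f y ∧ y < x := by
  simp [blockKey, Prod.Lex.toLex_lt_toLex]

lemma blockKey_injective {α : Type*} (f : α → α) : Function.Injective (blockKey f) := by
  intro x y h
  exact congrArg (fun z ↦ OrderDual.ofDual (ofLex z).2) h

lemma strictMono_blockKey_recordMax {m : ℕ} {σ : Equiv.Perm (Fin (m + 1))}
    (h1 : AscentTopsAreRecords σ) : StrictMono (blockKey (recordMax σ) ∘ σ) := by
  rw [Fin.strictMono_iff_lt_succ]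
  intro p
  simp only [Function.comp_apply, blockKey_lt, recordMax_apply]
  have hmono := (partialSups (⇑σ)).monotone p.castSucc_lt_succ.le
  refine hmono.lt_or_eq.imp_right fun e ↦ ⟨e, ?_⟩
  refine lt_of_le_of_ne ?_ fun h ↦ p.castSucc_lt_succ.ne (σ.injective h).symm
  by_contra! hlt
  refine absurd (le_partialSups (⇑σ) p.succ) (not_le.2 ?_)
  rw [← e]
  obtain ⟨j, hj, hx⟩ := exists_partialSups_eq σ p.castSucc
  rw [hx]
  rcases hj.eq_or_lt with rfl | hj
  · exact hlt
  · exact h1 p j hj hlt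

lemma eq_of_strictMono_blockKey {m : ℕ} {f : Fin m → Fin m} {σ τ : Equiv.Perm (Fin m)}
    (hσ : StrictMono (blockKey f ∘ σ)) (hτ : StrictMono (blockKey f ∘ τ)) : σ = τ := by
  ext1 x
  exact blockKey_injective f (congrFun (Tuple.unique_monotone hσ.monotone hτ.monotone) x)

section SortedByBlocks

variable {m : ℕ} {f : Fin (m + 1) → Fin (m + 1)} {σ : Equiv.Perm (Fin (m + 1))}

lemma apply_le_apply_of_strictMono_blockKey (hσ : StrictMono (blockKey f ∘ σ))
    {p q : Fin (m + 1)} (h : p ≤ q) : f (σ p) ≤ f (σ q) := by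
  rcases h.eq_or_lt with rfl | h
  · rfl
  · rcases blockKey_lt.1 (hσ h) with h | h
    exacts [h.le, h.1.le]

lemma apply_lt_apply_of_ascent (hσ : StrictMono (blockKey f ∘ σ)) {p q : Fin (m + 1)}
    (h : p < q) (hpq : σ p < σ q) : f (σ p) < f (σ q) :=
  (blockKey_lt.1 (hσ h)).resolve_right fun h' ↦ hpq.not_gt h'.2

lemma recordMax_eq_of_strictMono_blockKey (hf : IsBlockMax f)
    (hσ : StrictMono (blockKey f ∘ σ)) : recordMax σ = f := by
  ext1 x
  obtain ⟨p, rfl⟩ := σ.surjective x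
  rw [recordMax_apply]
  refine le_antisymm (partialSups_le _ _ _ fun j hj ↦ (hf.le_apply _).trans
    (apply_le_apply_of_strictMono_blockKey hσ hj)) ?_
  obtain ⟨g, hg⟩ := σ.surjective (f (σ p))
  rw [← hg]
  refine le_partialSups_of_le σ (hσ.le_iff_le.1 (not_lt.1 fun h ↦ ?_))
  simp only [Function.comp_apply, blockKey_lt, hg, hf.apply_apply] at h
  rcases h with h | h
  · exact h.false
  · exact absurd h.2 (hf.le_apply _).not_gt

lemma apply_zero_of_strictMono_blockKey (hf : IsBlockMax f) (hf0 : f 0 = 0)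
    (hσ : StrictMono (blockKey f ∘ σ)) : σ 0 = 0 := by
  obtain ⟨z, hz⟩ := σ.surjective 0
  have h := apply_le_apply_of_strictMono_blockKey hσ (Fin.zero_le z)
  rw [hz, hf0] at h
  exact Fin.le_zero_iff.1 ((hf.le_apply _).trans h)

/-- The element at the top of an ascent is the maximum of its block. -/
lemma apply_succ_of_ascent (hf : IsBlockMax f) (hσ : StrictMono (blockKey f ∘ σ)) {p : Fin m}
    (hp : σ p.castSucc < σ p.succ) : f (σ p.succ) = σ p.succ := by
  have hlt := apply_lt_apply_of_ascent hσ p.castSucc_lt_succ hp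
  obtain ⟨g, hg⟩ := σ.surjective (f (σ p.succ))
  have hpg : p.castSucc < g := by
    refine hσ.lt_iff_lt.1 (blockKey_lt.2 (Or.inl ?_))
    rwa [hg, hf.apply_apply]
  rcases (show p.succ ≤ g from hpg).eq_or_lt with h | h
  · rw [← hg, h]
  · have := blockKey_lt.1 (hσ h)
    rw [hg, hf.apply_apply] at this
    exact absurd (this.resolve_left (lt_irrefl _)).2 (hf.le_apply _).not_gt

lemma ascentTopsAreRecords_of_strictMono_blockKey (hf : IsBlockMax f)
    (hσ : StrictMono (blockKey f ∘ σ)) : AscentTopsAreRecords σ := by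
  intro p q hq hp
  calc σ q ≤ f (σ q) := hf.le_apply _
    _ ≤ f (σ p.castSucc) := apply_le_apply_of_strictMono_blockKey hσ hq.le
    _ < f (σ p.succ) := apply_lt_apply_of_ascent hσ p.castSucc_lt_succ hp
    _ = σ p.succ := apply_succ_of_ascent hf hσ hp

end SortedByBlocks

lemma avoidsAfterAscents_of_strictMono_blockKey {m : ℕ} {f : Fin (m + 2) → Fin (m + 2)}
    {σ : Equiv.Perm (Fin (m + 2))} (hf : IsStronglyMonotoneBelowLast f)
    (hσ : StrictMono (blockKey f ∘ σ)) : AvoidsAfterAscents σ := by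
  intro p s t hs hst hp hsp hpt
  have hlt := apply_lt_apply_of_ascent hσ p.castSucc_lt_succ hp
  have hsucc := apply_succ_of_ascent hf.toIsBlockMax hσ hp
  obtain ⟨x, hx, hxy⟩ := hf.blockMinLT (f (σ p.castSucc)) (f (σ s)) (hf.apply_apply _)
    (hf.apply_apply _) (hlt.trans_le (apply_le_apply_of_strictMono_blockKey hσ hs.le))
    ((apply_lt_apply_of_ascent hσ hst (hsp.trans (hp.trans hpt))).trans_le (Fin.le_last _))
  have hxs := hxy _ rfl
  obtain ⟨q, rfl⟩ := σ.surjective x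
  have hqp : q < p.succ := hσ.lt_iff_lt.1 (blockKey_lt.2 (Or.inl (hx ▸ hlt)))
  rcases (Fin.le_castSucc_iff.2 hqp).eq_or_lt with rfl | hqp
  · exact lt_asymm hxs hsp
  · rcases blockKey_lt.1 (hσ hqp) with h | h
    · exact h.ne hx
    · exact lt_asymm (h.2.trans hxs) hsp

lemma card_avoiding_eq (m : ℕ) :
    Nat.card {σ : Equiv.Perm (Fin (m + 2)) // σ 0 = 0 ∧ ¬ Contains2314 σ} =
      Nat.card {f : Fin (m + 2) → Fin (m + 2) // IsStronglyMonotoneBelowLast f} := by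
  refine Nat.card_eq_of_bijective (fun σ ↦ ⟨recordMax σ.1,
    isStronglyMonotoneBelowLast_recordMax σ.2.1 ((not_contains2314_iff σ.2.1).1 σ.2.2).2⟩) ⟨?_, ?_⟩
  · rintro ⟨σ, hσ0, hσ⟩ ⟨τ, hτ0, hτ⟩ h
    have hmax : recordMax σ = recordMax τ := congrArg Subtype.val h
    have hσ' := strictMono_blockKey_recordMax ((not_contains2314_iff hσ0).1 hσ).1
    have hτ' := strictMono_blockKey_recordMax ((not_contains2314_iff hτ0).1 hτ).1
    exact Subtype.ext (eq_of_strictMono_blockKey hσ' (hmax ▸ hτ'))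
  · rintro ⟨f, hf⟩
    have hσ : StrictMono (blockKey f ∘ Tuple.sort (blockKey f)) :=
      (Tuple.monotone_sort _).strictMono_of_injective
        ((blockKey_injective f).comp (Equiv.injective _))
    have h0 := apply_zero_of_strictMono_blockKey hf.toIsBlockMax hf.apply_zero hσ
    exact ⟨⟨_, h0, (not_contains2314_iff h0).2
      ⟨ascentTopsAreRecords_of_strictMono_blockKey hf.toIsBlockMax hσ,
        avoidsAfterAscents_of_strictMono_blockKey hf hσ⟩⟩,
      Subtype.ext (recordMax_eq_of_strictMono_blockKey hf.toIsBlockMax hσ)⟩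

lemma stronglyMonotonePartition_iff {i : ℕ} {P : Finpartition (Finset.univ : Finset (Fin i))}
    {f : Fin i → Fin i} (hf : IsBlockMax f) (hP : ∀ x y, y ∈ P.part x ↔ f x = f y) :
    StronglyMonotonePartition P ↔ IsStronglyMonotone f := by
  have hmem : ∀ B ∈ P.parts, ∀ x ∈ B, ∀ y, y ∈ B ↔ f x = f y := fun B hB x hx y ↦ by
    rw [← hP, P.part_eq_of_mem hB hx]
  have hmax : ∀ B ∈ P.parts, ∀ (hB' : B.Nonempty), ∀ x ∈ B, B.max' hB' = f x := by
    intro B hB hB' x hx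
    refine le_antisymm (Finset.max'_le _ _ _ fun y hy ↦ ?_) (Finset.le_max' _ _ ?_)
    · rw [(hmem B hB x hx y).1 hy]; exact hf.le_apply y
    · rw [hmem B hB x hx, hf.apply_apply]
  constructor
  · refine fun h ↦ ⟨hf, fun b c hb hc hbc ↦ ?_⟩
    have hB := P.part_mem.2 (Finset.mem_univ b)
    have hC := P.part_mem.2 (Finset.mem_univ c)
    have hbB := P.mem_part (Finset.mem_univ b)
    have hcC := P.mem_part (Finset.mem_univ c)
    have hmB := (P.part b).min'_mem ⟨b, hbB⟩
    have hmC := (P.part c).min'_mem ⟨c, hcC⟩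
    refine ⟨(P.part b).min' ⟨b, hbB⟩, ?_, fun y hy ↦ ?_⟩
    · rw [← (hP _ _).1 hmB, hb]
    · refine lt_of_lt_of_le ?_ ((P.part c).min'_le y ((hP _ _).2 (hc.trans hy.symm)))
      by_contra! hle
      rcases hle.eq_or_lt with e | hlt
      · rw [e] at hmC
        exact hbc.ne (by rw [← hb, ← hc, (hP _ _).1 hmB, (hP _ _).1 hmC])
      · have := h _ hC _ hB _ _ hlt
        rw [hmax _ hC ⟨c, hcC⟩ c hcC, hmax _ hB ⟨b, hbB⟩ b hbB, hb, hc] at this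
        exact lt_asymm this hbc
  · intro h B hB C hC hB' hC' hlt
    have hmB := B.min'_mem hB'
    have hmC := C.min'_mem hC'
    rw [hmax B hB _ _ hmB, hmax C hC _ _ hmC]
    by_contra! hle
    rcases hle.eq_or_lt with e | hlt'
    · exact hlt.not_ge (C.min'_le _ ((hmem C hC _ hmC _).2 e))
    · obtain ⟨x, hx, hxy⟩ := h.blockMinLT _ _ (hf.apply_apply _) (hf.apply_apply _) hlt'
      exact ((hxy _ rfl).trans hlt).not_ge (C.min'_le _ ((hmem C hC _ hmC _).2 hx.symm))

lemma smCount_eq_card (i : ℕ) :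
    smCount i = Nat.card {f : Fin i → Fin i // IsStronglyMonotone f} := by
  classical
  have hpart : ∀ f : Fin i → Fin i, ∀ x y,
      y ∈ (Finpartition.ofSetoid (Setoid.ker f)).part x ↔ f x = f y := fun f x y ↦
    Finpartition.mem_part_ofSetoid_iff_rel
  symm
  refine Nat.card_eq_of_bijective (fun f ↦ ⟨Finpartition.ofSetoid (Setoid.ker f.1),
    (stronglyMonotonePartition_iff f.2.toIsBlockMax (hpart _)).2 f.2⟩) ⟨?_, ?_⟩
  · rintro ⟨f, hf⟩ ⟨g, hg⟩ h
    have hP : Finpartition.ofSetoid (Setoid.ker f) = Finpartition.ofSetoid (Setoid.ker g) :=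
      congrArg Subtype.val h
    have hfg : ∀ x y, f x = f y ↔ g x = g y := fun x y ↦ by rw [← hpart f, hP, hpart g]
    refine Subtype.ext (funext fun x ↦ le_antisymm ?_ ?_)
    · change f x ≤ g x
      rw [(hfg x (f x)).1 (hf.apply_apply x).symm]
      exact hg.le_apply _
    · change g x ≤ f x
      rw [(hfg x (g x)).2 (hg.apply_apply x).symm]
      exact hf.le_apply _
  · rintro ⟨P, hP⟩
    have hne : ∀ x, (P.part x).Nonempty := fun x ↦ ⟨x, P.mem_part (Finset.mem_univ x)⟩
    have hpm : ∀ x y, y ∈ P.part x → P.part y = P.part x := fun x y h ↦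
      P.part_eq_of_mem (P.part_mem.2 (Finset.mem_univ x)) h
    let f : Fin i → Fin i := fun x ↦ (P.part x).max' (hne x)
    have hcongr : ∀ x y, P.part x = P.part y → f x = f y := fun x y h ↦ by
      simp only [f, h]
    have hf : IsBlockMax f :=
      ⟨fun x ↦ Finset.le_max' _ _ (P.mem_part (Finset.mem_univ x)),
        fun x ↦ hcongr _ _ (hpm _ _ (Finset.max'_mem _ _))⟩
    have hfP : ∀ x y, y ∈ P.part x ↔ f x = f y := by
      refine fun x y ↦ ⟨fun h ↦ hcongr _ _ (hpm _ _ h).symm, fun h ↦ ?_⟩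
      have hx : P.part (f x) = P.part x := hpm _ _ (Finset.max'_mem _ _)
      have hy : P.part (f y) = P.part y := hpm _ _ (Finset.max'_mem _ _)
      rw [← hx, h, hy]
      exact P.mem_part (Finset.mem_univ y)
    refine ⟨⟨f, (stronglyMonotonePartition_iff hf hfP).1 hP⟩, Subtype.ext (Finpartition.ext ?_)⟩
    have hparts : ∀ x, (Finpartition.ofSetoid (Setoid.ker f)).part x = P.part x := fun x ↦ by
      ext y; rw [hpart, hfP]
    have hsub : ∀ Q R : Finpartition (Finset.univ : Finset (Fin i)),
        (∀ x, Q.part x = R.part x) → Q.parts ⊆ R.parts := fun Q R h B hB ↦ by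
      obtain ⟨x, hx⟩ := Q.nonempty_of_mem_parts hB
      rw [← Q.part_eq_of_mem hB hx, h]
      exact R.part_mem.2 (Finset.mem_univ x)
    exact (hsub _ _ hparts).antisymm (hsub _ _ fun x ↦ (hparts x).symm)

lemma IsStronglyMonotone.conj {α β : Type*} [LinearOrder α] [LinearOrder β] (e : α ≃o β)
    {f : α → α} (hf : IsStronglyMonotone f) : IsStronglyMonotone (e ∘ f ∘ e.symm) where
  le_apply x := e.symm_apply_le.1 (hf.le_apply _)
  apply_apply x := by simp [hf.apply_apply]
  blockMinLT b c hb hc hbc := by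
    simp only [Function.comp_apply, ← e.eq_symm_apply] at hb hc
    obtain ⟨x, hx, hxy⟩ := hf.blockMinLT _ _ hb hc (e.symm.lt_iff_lt.2 hbc)
    exact ⟨e x, by simp [hx], fun y hy ↦ e.lt_symm_apply.1 (hxy _ (e.eq_symm_apply.2 hy))⟩

lemma card_isStronglyMonotone {α : Type*} [LinearOrder α] (S : Finset α) :
    Nat.card {f : S → S // IsStronglyMonotone f} = smCount S.card := by
  rw [smCount_eq_card]
  let e := S.orderIsoOfFin rfl
  refine Nat.card_congr
    { toFun f := ⟨_, f.2.conj e.symm⟩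
      invFun f := ⟨_, f.2.conj e⟩
      left_inv f := ?_
      right_inv f := ?_ } <;> ext x <;> simp

/-- The nonzero elements outside the block of the last element. -/
def lowerBlocks {m : ℕ} (f : Fin (m + 2) → Fin (m + 2)) : Finset (Fin (m + 2)) :=
  {x | x ≠ 0 ∧ f x ≠ Fin.last _}

lemma mem_lowerBlocks {m : ℕ} {f : Fin (m + 2) → Fin (m + 2)} {x : Fin (m + 2)} :
    x ∈ lowerBlocks f ↔ x ≠ 0 ∧ f x ≠ Fin.last _ := by
  simp [lowerBlocks]

lemma IsStronglyMonotoneBelowLast.apply_eq_zero {m : ℕ} {f : Fin (m + 2) → Fin (m + 2)}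
    (hf : IsStronglyMonotoneBelowLast f) {x : Fin (m + 2)} : f x = 0 ↔ x = 0 :=
  ⟨fun h ↦ Fin.le_zero_iff.1 (h ▸ hf.le_apply x), fun h ↦ h ▸ hf.apply_zero⟩

lemma IsStronglyMonotoneBelowLast.apply_mem_lowerBlocks {m : ℕ} {f : Fin (m + 2) → Fin (m + 2)}
    (hf : IsStronglyMonotoneBelowLast f) {x : Fin (m + 2)} :
    f x ∈ lowerBlocks f ↔ x ∈ lowerBlocks f := by
  simp [mem_lowerBlocks, hf.apply_apply, hf.apply_eq_zero]

/-- The restriction to `lowerBlocks f`. -/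
def IsStronglyMonotoneBelowLast.restrict {m : ℕ} {f : Fin (m + 2) → Fin (m + 2)}
    (hf : IsStronglyMonotoneBelowLast f) (x : lowerBlocks f) : lowerBlocks f :=
  ⟨f x, hf.apply_mem_lowerBlocks.2 x.2⟩

lemma IsStronglyMonotoneBelowLast.isStronglyMonotone_restrict {m : ℕ}
    {f : Fin (m + 2) → Fin (m + 2)} (hf : IsStronglyMonotoneBelowLast f) :
    IsStronglyMonotone hf.restrict where
  le_apply x := hf.le_apply x
  apply_apply x := Subtype.ext (hf.apply_apply x)
  blockMinLT b c hb hc hbc := by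
    have hb' : f b = b := congrArg Subtype.val hb
    have hc' : f c = c := congrArg Subtype.val hc
    obtain ⟨x, hx, hxy⟩ := hf.blockMinLT b c hb' hc' hbc
      (lt_of_le_of_ne (Fin.le_last _) (hc' ▸ (mem_lowerBlocks.1 c.2).2))
    refine ⟨⟨x, hf.apply_mem_lowerBlocks.1 (hx ▸ b.2)⟩, Subtype.ext hx, fun y hy ↦ ?_⟩
    exact hxy y (congrArg Subtype.val hy)

/-- The extension of `g` by the block `{0}` and a block of all remaining elements. -/
def extendByLast {m : ℕ} {S : Finset (Fin (m + 2))} (g : S → S) (x : Fin (m + 2)) :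
    Fin (m + 2) :=
  if h : x ∈ S then g ⟨x, h⟩ else if x = 0 then 0 else Fin.last _

lemma extendByLast_coe {m : ℕ} {S : Finset (Fin (m + 2))} (g : S → S) (x : S) :
    extendByLast g x = g x := by
  simp [extendByLast]

lemma extendByLast_of_notMem {m : ℕ} {S : Finset (Fin (m + 2))} (g : S → S) {x : Fin (m + 2)}
    (hx : x ∉ S) (h0 : x ≠ 0) : extendByLast g x = Fin.last _ := by
  simp [extendByLast, hx, h0]

lemma extendByLast_zero {m : ℕ} {S : Finset (Fin (m + 2))} (g : S → S) (h0 : 0 ∉ S) :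
    extendByLast g 0 = 0 := by
  simp [extendByLast, h0]

lemma isStronglyMonotoneBelowLast_extendByLast {m : ℕ} {S : Finset (Fin (m + 2))} {g : S → S}
    (hg : IsStronglyMonotone g) (h0 : 0 ∉ S) (hl : Fin.last _ ∉ S) :
    IsStronglyMonotoneBelowLast (extendByLast g) where
  le_apply x := by
    by_cases hx : x ∈ S
    · rw [extendByLast_coe g ⟨x, hx⟩]; exact hg.le_apply ⟨x, hx⟩
    · by_cases hx0 : x = 0
      · subst hx0; exact Fin.zero_le _
      · rw [extendByLast_of_notMem g hx hx0]; exact Fin.le_last _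
  apply_apply x := by
    by_cases hx : x ∈ S
    · rw [extendByLast_coe g ⟨x, hx⟩, extendByLast_coe, hg.apply_apply]
    · by_cases hx0 : x = 0
      · subst hx0; rw [extendByLast_zero g h0, extendByLast_zero g h0]
      · rw [extendByLast_of_notMem g hx hx0,
          extendByLast_of_notMem g hl (Fin.last_pos.ne')]
  apply_zero := extendByLast_zero g h0
  blockMinLT b c hb hc hbc hcl := by
    have hfix : ∀ x, extendByLast g x = x → x ≠ 0 → x < Fin.last _ → x ∈ S := by
      intro x hx hx0 hxl
      by_contra hxS
      rw [extendByLast_of_notMem g hxS hx0] at hx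
      exact hxl.ne' hx
    by_cases hb0 : b = 0
    · subst hb0
      refine ⟨0, hb, fun y hy ↦ Fin.pos_iff_ne_zero.2 ?_⟩
      rintro rfl
      exact hbc.ne (hb.symm.trans hy)
    lift b to S using hfix b hb hb0 (hbc.trans hcl)
    lift c to S using hfix c hc ((Fin.zero_le _).trans_lt hbc).ne' hcl
    rw [extendByLast_coe, Subtype.coe_inj] at hb hc
    obtain ⟨x, hx, hxy⟩ := hg.blockMinLT b c hb hc hbc
    refine ⟨x, by rw [extendByLast_coe, hx], fun y hy ↦ ?_⟩
    have hyS : y ∈ S := by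
      by_contra hyS
      by_cases hy0 : y = 0
      · subst hy0
        rw [extendByLast_zero g h0] at hy
        exact h0 (hy ▸ c.2)
      · rw [extendByLast_of_notMem g hyS hy0] at hy
        exact hl (hy ▸ c.2)
    lift y to S using hyS
    rw [extendByLast_coe, Subtype.coe_inj] at hy
    exact hxy y hy

lemma lowerBlocks_extendByLast {m : ℕ} {S : Finset (Fin (m + 2))} (g : S → S)
    (h0 : 0 ∉ S) (hl : Fin.last _ ∉ S) : lowerBlocks (extendByLast g) = S := by
  ext x
  rw [mem_lowerBlocks]
  constructor
  · rintro ⟨hx0, hx⟩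
    by_contra hxS
    exact hx (extendByLast_of_notMem g hxS hx0)
  · intro hx
    rw [extendByLast_coe g ⟨x, hx⟩]
    exact ⟨fun h ↦ h0 (h ▸ hx), fun h ↦ hl (h ▸ (g ⟨x, hx⟩).2)⟩

lemma IsStronglyMonotoneBelowLast.extendByLast_restrict {m : ℕ} {f : Fin (m + 2) → Fin (m + 2)}
    (hf : IsStronglyMonotoneBelowLast f) : extendByLast hf.restrict = f := by
  ext1 x
  by_cases hx : x ∈ lowerBlocks f
  · exact extendByLast_coe hf.restrict ⟨x, hx⟩
  · by_cases hx0 : x = 0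
    · subst hx0
      rw [extendByLast_zero _ hx, hf.apply_zero]
    · rw [extendByLast_of_notMem _ hx hx0]
      by_contra h
      exact hx (mem_lowerBlocks.2 ⟨hx0, Ne.symm h⟩)

lemma card_lowerBlocks_eq {m : ℕ} {S : Finset (Fin (m + 2))} (h0 : 0 ∉ S)
    (hl : Fin.last _ ∉ S) :
    Nat.card {f : Fin (m + 2) → Fin (m + 2) // IsStronglyMonotoneBelowLast f ∧ lowerBlocks f = S} =
      smCount S.card := by
  rw [← card_isStronglyMonotone]
  symm
  refine Nat.card_eq_of_bijective (fun g ↦ ⟨extendByLast g.1,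
    isStronglyMonotoneBelowLast_extendByLast g.2 h0 hl, lowerBlocks_extendByLast _ h0 hl⟩) ⟨?_, ?_⟩
  · rintro ⟨g, hg⟩ ⟨g', hg'⟩ h
    have h' : extendByLast g = extendByLast g' := congrArg Subtype.val h
    refine Subtype.ext (funext fun x ↦ Subtype.ext ?_)
    rw [← extendByLast_coe, h', extendByLast_coe]
  · rintro ⟨f, hf, rfl⟩
    exact ⟨⟨_, hf.isStronglyMonotone_restrict⟩, Subtype.ext hf.extendByLast_restrict⟩

lemma card_isStronglyMonotoneBelowLast (m : ℕ) :
    Nat.card {f : Fin (m + 2) → Fin (m + 2) // IsStronglyMonotoneBelowLast f} =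
      ∑ i ∈ Finset.range (m + 1), m.choose i * smCount i := by
  classical
  let T : Finset (Fin (m + 2)) := {0, Fin.last _}ᶜ
  have hT : T.card = m := by
    rw [Finset.card_compl, Finset.card_pair Fin.last_pos.ne, Fintype.card_fin, Nat.add_sub_cancel]
  have hmaps : Set.MapsTo (lowerBlocks (m := m))
      ↑(Finset.univ.filter (IsStronglyMonotoneBelowLast (m := m))) ↑T.powerset := by
    intro f hf
    replace hf : IsStronglyMonotoneBelowLast f := by simpa using hf
    simp only [Finset.coe_powerset, Set.mem_preimage, Set.mem_powerset_iff, Finset.coe_subset]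
    intro x hx
    obtain ⟨hx0, hxl⟩ := mem_lowerBlocks.1 hx
    simp only [T, Finset.mem_compl, Finset.mem_insert, Finset.mem_singleton, not_or]
    refine ⟨hx0, ?_⟩
    rintro rfl
    exact hxl (le_antisymm (Fin.le_last _) (hf.le_apply _))
  rw [Nat.card_eq_fintype_card, Fintype.card_subtype, Finset.card_eq_sum_card_fiberwise hmaps]
  have hfiber : ∀ S ∈ T.powerset, ((Finset.univ.filter IsStronglyMonotoneBelowLast).filter
      fun f ↦ lowerBlocks f = S).card = smCount S.card := by
    intro S hS
    have hST := Finset.mem_powerset.1 hS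
    rw [← card_lowerBlocks_eq (fun h ↦ by simpa [T] using hST h)
      (fun h ↦ by simpa [T] using hST h), Nat.card_eq_fintype_card, Fintype.card_subtype,
      Finset.filter_filter]
  rw [Finset.sum_congr rfl hfiber, Finset.sum_powerset_apply_card, hT]
  simp

/-- for `n ≥ 2`, the number of cyclic permutations of length `n`
avoiding the vincular cyclic pattern 23-14 equals
`∑_{i=0}^{n-2} binom(n-2, i) * A_i`. -/
theorem stmt14 (n : ℕ) (hn : 2 ≤ n) :
    Nat.card {σ : Equiv.Perm (Fin n) //
        σ ⟨0, by omega⟩ = ⟨0, by omega⟩ ∧ ¬ Contains2314 σ} =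
      ∑ i ∈ Finset.range (n - 1), Nat.choose (n - 2) i * smCount i := by
  obtain ⟨m, rfl⟩ := Nat.exists_eq_add_of_le' hn
  exact (card_avoiding_eq m).trans (card_isStronglyMonotoneBelowLast m)
end
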